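/- arXiv:1404.1724 — 4 statements merged into one kernel-verified Lean document; each statement's English description precedes it below -/
import Mathlib

section
/- Comparison principle on an exterior interval: Let 0 ≤ r₁ < ∞. Let ū be a super-solution and u̲ a sub-solution of (⋆) on (r₁,∞), both extending continuously to r₁, such that: 0 ≤ ū, u̲ ≤ s_+ on (r₁,∞); ū(r₁) ≥ 0 and u̲(r₁) = 0; ū(r) = s_+ − β̄·r^{−2} + o(r^{−2}) and u̲(r) = s_+ − β̲·r^{−2} + o(r^{−2}) as r → ∞, with β̲ > 0 and β̲ ≥ β̄. Then ū(r) ≥ u̲(r) for all r ∈ (r₁,∞); moreover, if ū(r₀) = u̲(r₀) for some r₀ ∈ (r₁,∞), then ū ≡ u̲ on (r₁,∞). -/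
open Set Filter Topology MeasureTheory
open scoped ENNReal NNReal

/-- `γ₊ = ((1-p) + √((p-1)² + 4q))/2`, the positive root of `γ² + (p-1)γ - q = 0`. -/
noncomputable def gammaPlus (p q : ℝ) : ℝ :=
  ((1 - p) + Real.sqrt ((p - 1) ^ 2 + 4 * q)) / 2

/-- Condition (condF) on the nonlinearity `F` (with `0 < sp` recorded separately). -/
def CondF (F : ℝ → ℝ) (sp : ℝ) : Prop :=
  ContDiff ℝ 1 F ∧ F 0 = 0 ∧ F sp = 0 ∧
    (∀ t ∈ Set.Ioo 0 sp, F t < 0) ∧ (∀ t, sp < t → 0 < F t) ∧ 0 < deriv F sp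

/-- The ODE (⋆) `u'' + (p/r) u' - (q/r²) u = F(u)` holds at the point `r`. -/
def ODEAt (p q : ℝ) (F : ℝ → ℝ) (u : ℝ → ℝ) (r : ℝ) : Prop :=
  deriv (deriv u) r + (p / r) * deriv u r - (q / r ^ 2) * u r = F (u r)

/-- `ψ` is locally Lipschitz on the set `I`. -/
def LocLipOn (I : Set ℝ) (ψ : ℝ → ℝ) : Prop :=
  ∀ x ∈ I, ∃ K : ℝ≥0, ∃ t ∈ nhdsWithin x I, LipschitzOnWith K ψ t

/-- `ψ` is a locally Lipschitz, piecewise `C²` super-solution of (⋆) on `I`: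
outside a locally finite set `S` of jump points it is `C²` and satisfies
`ψ'' + (p/r)ψ' - (q/r²)ψ ≤ F(ψ)`, and at each jump point the one-sided
derivatives exist with `ψ'(r₀⁻) > ψ'(r₀⁺)`. -/
def IsSuperSolutionOn (p q : ℝ) (F : ℝ → ℝ) (I : Set ℝ) (ψ : ℝ → ℝ) : Prop :=
  LocLipOn I ψ ∧
    ∃ S : Set ℝ,
      (∀ x ∈ I, ∃ ε > 0, (S ∩ Set.Ioo (x - ε) (x + ε)).Finite) ∧
      (∀ x ∈ I \ S, ContDiffAt ℝ 2 ψ x ∧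
        deriv (deriv ψ) x + (p / x) * deriv ψ x - (q / x ^ 2) * ψ x ≤ F (ψ x)) ∧
      (∀ x ∈ I ∩ S, ∃ dl dr : ℝ, HasDerivWithinAt ψ dl (Set.Iio x) x ∧
        HasDerivWithinAt ψ dr (Set.Ioi x) x ∧ dr < dl)

/-- `ψ` is a locally Lipschitz, piecewise `C²` sub-solution of (⋆) on `I`. -/
def IsSubSolutionOn (p q : ℝ) (F : ℝ → ℝ) (I : Set ℝ) (ψ : ℝ → ℝ) : Prop :=
  LocLipOn I ψ ∧
    ∃ S : Set ℝ,
      (∀ x ∈ I, ∃ ε > 0, (S ∩ Set.Ioo (x - ε) (x + ε)).Finite) ∧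
      (∀ x ∈ I \ S, ContDiffAt ℝ 2 ψ x ∧
        F (ψ x) ≤ deriv (deriv ψ) x + (p / x) * deriv ψ x - (q / x ^ 2) * ψ x) ∧
      (∀ x ∈ I ∩ S, ∃ dl dr : ℝ, HasDerivWithinAt ψ dl (Set.Iio x) x ∧
        HasDerivWithinAt ψ dr (Set.Ioi x) x ∧ dl < dr)

/-- `u(r) = α·r^γ + o(r^γ)` as `r → 0⁺`. -/
def AsympZero (u : ℝ → ℝ) (α γ : ℝ) : Prop :=
  Filter.Tendsto (fun r : ℝ => (u r - α * r ^ γ) / r ^ γ) (nhdsWithin 0 (Set.Ioi 0)) (nhds 0)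

/-- `u(r) = sp - β·r⁻² + o(r⁻²)` as `r → ∞`. -/
def AsympInfty (u : ℝ → ℝ) (sp β : ℝ) : Prop :=
  Filter.Tendsto (fun r : ℝ => (u r - (sp - β / r ^ 2)) * r ^ 2) Filter.atTop (nhds 0)

theorem eq_zero_of_deriv_mul_le {D G G' c : ℝ → ℝ} {x y C K : ℝ}
    (hD : ∀ r ∈ Icc x y, HasDerivAt D (c r * G r) r)
    (hG : ∀ r ∈ Icc x y, HasDerivAt G (G' r) r)
    (hc : ∀ r ∈ Icc x y, 0 ≤ c r ∧ c r ≤ C)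
    (hG' : ∀ r ∈ Icc x y, G' r ≤ K * D r)
    (hD0 : ∀ r ∈ Icc x y, 0 ≤ D r) (hDx : D x = 0) (hGx : G x = 0)
    (hK : 0 ≤ K) (hCK : C * K * (y - x) ^ 2 < 1) :
    ∀ r ∈ Icc x y, D r = 0 := by
  intro r hr
  have hxy : x ≤ y := hr.1.trans hr.2
  have hDc : ContinuousOn D (Icc x y) := fun r hr => (hD r hr).continuousAt.continuousWithinAt
  have hGc : ContinuousOn G (Icc x y) := fun r hr => (hG r hr).continuousAt.continuousWithinAt
  obtain ⟨z, hz, hmax⟩ := isCompact_Icc.exists_isMaxOn ⟨x, left_mem_Icc.2 hxy⟩ hDc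
  have hC : 0 ≤ C := (hc r hr).1.trans (hc r hr).2
  have hM : 0 ≤ D z := hD0 z hz
  have hGle : ∀ ⦃s⦄, s ∈ Icc x y → G s ≤ K * D z * (s - x) := by
    refine image_le_of_deriv_right_le_deriv_boundary (B' := fun _ => K * D z) hGc
      (fun s hs => (hG s (Ico_subset_Icc_self hs)).hasDerivWithinAt) (by simp [hGx]) (by fun_prop)
      (fun s _ => ?_) fun s hs => ?_
    · simpa using (((hasDerivAt_id s).sub_const x).const_mul (K * D z)).hasDerivWithinAt
    · exact (hG' s (Ico_subset_Icc_self hs)).trans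
        (mul_le_mul_of_nonneg_left (hmax (Ico_subset_Icc_self hs)) hK)
  have hDle : ∀ ⦃s⦄, s ∈ Icc x y → D s ≤ C * (K * D z * (y - x)) * (s - x) := by
    refine image_le_of_deriv_right_le_deriv_boundary (B' := fun _ => C * (K * D z * (y - x))) hDc
      (fun s hs => (hD s (Ico_subset_Icc_self hs)).hasDerivWithinAt) (by simp [hDx]) (by fun_prop)
      (fun s _ => ?_) fun s hs => ?_
    · simpa using
        (((hasDerivAt_id s).sub_const x).const_mul (C * (K * D z * (y - x)))).hasDerivWithinAt
    · have hs' := Ico_subset_Icc_self hs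
      have h1 : G s ≤ K * D z * (y - x) :=
        (hGle hs').trans (mul_le_mul_of_nonneg_left (by linarith [hs.2]) (mul_nonneg hK hM))
      have h2 : 0 ≤ K * D z * (y - x) := mul_nonneg (mul_nonneg hK hM) (by linarith)
      exact (mul_le_mul_of_nonneg_left h1 (hc s hs').1).trans
        (mul_le_mul_of_nonneg_right (hc s hs').2 h2)
  have h3 : D z ≤ C * K * (y - x) ^ 2 * D z := by
    have h2 : 0 ≤ C * (K * D z * (y - x)) :=
      mul_nonneg hC (mul_nonneg (mul_nonneg hK hM) (by linarith))
    calc D z ≤ C * (K * D z * (y - x)) * (z - x) := hDle hz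
      _ ≤ C * (K * D z * (y - x)) * (y - x) :=
        mul_le_mul_of_nonneg_left (by linarith [hz.2]) h2
      _ = _ := by ring
  have h4 : D z ≤ 0 := by nlinarith
  exact le_antisymm ((hmax hr).trans h4) (hD0 r hr)

theorem ContDiffAt.hasDerivAt_and_deriv {u : ℝ → ℝ} {y : ℝ} (h : ContDiffAt ℝ 2 u y) :
    HasDerivAt u (deriv u y) y ∧ HasDerivAt (deriv u) (deriv (deriv u) y) y := by
  refine ⟨(h.differentiableAt (by norm_num)).hasDerivAt, ?_⟩
  have h1 : ContDiffAt ℝ 1 (deriv u) y :=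
    (h.fderiv_right (m := 1) (by norm_num)).clm_apply contDiffAt_const
  exact (h1.differentiableAt (by norm_num)).hasDerivAt

theorem IsLocalMin.hasDerivWithinAt_Ioi_nonneg {f : ℝ → ℝ} {x d : ℝ} (h : IsLocalMin f x)
    (hd : HasDerivWithinAt f d (Ioi x) x) : 0 ≤ d := by
  refine ge_of_tendsto ((hasDerivWithinAt_iff_tendsto_slope' (by simp)).1 hd) ?_
  filter_upwards [nhdsWithin_le_nhds h, self_mem_nhdsWithin] with y hy hxy
  rw [slope_def_field]
  exact div_nonneg (sub_nonneg.2 hy) (sub_nonneg.2 (le_of_lt hxy))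

theorem IsLocalMin.hasDerivWithinAt_Iio_nonpos {f : ℝ → ℝ} {x d : ℝ} (h : IsLocalMin f x)
    (hd : HasDerivWithinAt f d (Iio x) x) : d ≤ 0 := by
  refine le_of_tendsto ((hasDerivWithinAt_iff_tendsto_slope' (by simp)).1 hd) ?_
  filter_upwards [nhdsWithin_le_nhds h, self_mem_nhdsWithin] with y hy hxy
  rw [slope_def_field]
  exact div_nonpos_of_nonneg_of_nonpos (sub_nonneg.2 hy) (sub_nonpos.2 (le_of_lt hxy))

theorem IsLocalMin.deriv_deriv_nonneg {f : ℝ → ℝ} {x : ℝ} (h : IsLocalMin f x)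
    (hf : ContinuousAt f x) : 0 ≤ deriv (deriv f) x := by
  by_contra! hneg
  have hmax := isLocalMax_of_deriv_deriv_neg hneg h.deriv_eq_zero hf
  have hconst : f =ᶠ[𝓝 x] fun _ => f x := by
    filter_upwards [h, hmax] with y h1 h2 using le_antisymm h2 h1
  have : deriv (deriv f) x = 0 := by
    rw [hconst.deriv.deriv_eq]; simp
  exact hneg.ne this

theorem eventually_notMem_of_locallyFinite {S : Set ℝ} {x ε : ℝ} (hε : 0 < ε)
    (hS : (S ∩ Ioo (x - ε) (x + ε)).Finite) (hx : x ∉ S) : ∀ᶠ y in 𝓝 x, y ∉ S := by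
  filter_upwards [hS.isClosed.isOpen_compl.mem_nhds (fun h => hx h.1),
    Ioo_mem_nhds (sub_lt_self x hε) (lt_add_of_pos_right x hε)] with y hy hy' h using hy ⟨h, hy'⟩

/-- A contact point of a super-solution and a sub-solution is not a jump point of either. -/
theorem eventually_contDiffAt_of_isLocalMin_sub {p q : ℝ} {F u w : ℝ → ℝ} {a x : ℝ}
    (hu : IsSuperSolutionOn p q F (Ioi a) u) (hw : IsSubSolutionOn p q F (Ioi a) w)
    (hx : a < x) (hmin : IsLocalMin (fun r => u r - w r) x) :
    ∀ᶠ y in 𝓝 x,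
      (ContDiffAt ℝ 2 u y ∧
        deriv (deriv u) y + (p / y) * deriv u y - (q / y ^ 2) * u y ≤ F (u y)) ∧
      (ContDiffAt ℝ 2 w y ∧
        F (w y) ≤ deriv (deriv w) y + (p / y) * deriv w y - (q / y ^ 2) * w y) := by
  obtain ⟨-, S, hS, hSu, hSj⟩ := hu
  obtain ⟨-, T, hT, hTw, hTj⟩ := hw
  have key : ∀ {ul ur wl wr : ℝ}, HasDerivWithinAt u ul (Iio x) x →
      HasDerivWithinAt u ur (Ioi x) x → HasDerivWithinAt w wl (Iio x) x →
      HasDerivWithinAt w wr (Ioi x) x → ul - wl ≤ 0 ∧ 0 ≤ ur - wr := fun h1 h2 h3 h4 =>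
    ⟨hmin.hasDerivWithinAt_Iio_nonpos (h1.fun_sub h3),
      hmin.hasDerivWithinAt_Ioi_nonneg (h2.fun_sub h4)⟩
  have hdu : x ∉ S → HasDerivAt u (deriv u x) x := fun h =>
    (hSu x ⟨hx, h⟩).1.hasDerivAt_and_deriv.1
  have hdw : x ∉ T → HasDerivAt w (deriv w x) x := fun h =>
    (hTw x ⟨hx, h⟩).1.hasDerivAt_and_deriv.1
  have hST : x ∉ S ∧ x ∉ T := by
    by_cases h1 : x ∈ S <;> by_cases h2 : x ∈ T
    · obtain ⟨ul, ur, hul, hur, hlt⟩ := hSj x ⟨hx, h1⟩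
      obtain ⟨wl, wr, hwl, hwr, hlt'⟩ := hTj x ⟨hx, h2⟩
      have := key hul hur hwl hwr
      linarith
    · obtain ⟨ul, ur, hul, hur, hlt⟩ := hSj x ⟨hx, h1⟩
      have := key hul hur (hdw h2).hasDerivWithinAt (hdw h2).hasDerivWithinAt
      linarith
    · obtain ⟨wl, wr, hwl, hwr, hlt'⟩ := hTj x ⟨hx, h2⟩
      have := key (hdu h1).hasDerivWithinAt (hdu h1).hasDerivWithinAt hwl hwr
      linarith
    · exact ⟨h1, h2⟩
  obtain ⟨ε, hε, hεS⟩ := hS x hx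
  obtain ⟨δ, hδ, hδT⟩ := hT x hx
  filter_upwards [eventually_notMem_of_locallyFinite hε hεS hST.1,
    eventually_notMem_of_locallyFinite hδ hδT hST.2, Ioi_mem_nhds hx] with y h1 h2 h3
  exact ⟨hSu y ⟨h3, h1⟩, hTw y ⟨h3, h2⟩⟩

theorem LocLipOn.continuousOn {I : Set ℝ} {ψ : ℝ → ℝ} (h : LocLipOn I ψ) : ContinuousOn ψ I := by
  intro x hx
  obtain ⟨K, t, ht, hK⟩ := h x hx
  exact (hK.continuousOn x (mem_of_mem_nhdsWithin hx ht)).mono_of_mem_nhdsWithin ht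

theorem ContDiff.exists_abs_sub_le_mul {F : ℝ → ℝ} (hF : ContDiff ℝ 1 F) (a b : ℝ) :
    ∃ L : ℝ, 0 ≤ L ∧ ∀ s ∈ Icc a b, ∀ t ∈ Icc a b, |F s - F t| ≤ L * |s - t| := by
  obtain ⟨K, hK⟩ := LocallyLipschitzOn.exists_lipschitzOnWith_of_compact isCompact_Icc
    (hF.locallyLipschitz.locallyLipschitzOn (s := Icc a b))
  refine ⟨K, K.2, fun s hs t ht => ?_⟩
  simpa [Real.dist_eq] using hK.dist_le_mul s hs t ht

/-- Local form of the strong maximum principle at a contact point. -/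
theorem eventually_eq_of_contact {p q L : ℝ} {F u w : ℝ → ℝ} {a x : ℝ} (hp : 0 ≤ p) (hq : 0 < q)
    (ha : 0 ≤ a) (hL : 0 ≤ L) (hu : IsSuperSolutionOn p q F (Ioi a) u)
    (hw : IsSubSolutionOn p q F (Ioi a) w) (hle : ∀ r ∈ Ioi a, w r ≤ u r)
    (hF : ∀ r ∈ Ioi a, F (u r) - F (w r) ≤ L * (u r - w r))
    (hx : a < x) (hux : u x = w x) : ∀ᶠ y in 𝓝 x, u y = w y := by
  have hx0 : 0 < x := ha.trans_lt hx
  have hmin : IsLocalMin (fun r => u r - w r) x := by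
    filter_upwards [Ioi_mem_nhds hx] with y hy
    simpa [hux] using hle y hy
  obtain ⟨ε, hε, hball⟩ := Metric.eventually_nhds_iff.1
    ((eventually_contDiffAt_of_isLocalMin_sub hu hw hx hmin).and
      ((eventually_gt_nhds hx).and ((eventually_gt_nhds (show x / 2 < x by linarith)).and
        (eventually_lt_nhds (show x < 2 * x by linarith)))))
  set D : ℝ → ℝ := fun r => u r - w r
  set g : ℝ → ℝ := fun r => deriv u r - deriv w r
  set g' : ℝ → ℝ := fun r => deriv (deriv u) r - deriv (deriv w) r
  set G : ℝ → ℝ := fun r => r ^ p * g r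
  set G' : ℝ → ℝ := fun r => p * r ^ (p - 1) * g r + r ^ p * g' r
  set c : ℝ → ℝ := fun r => (r ^ p)⁻¹
  set C : ℝ := ((x / 2) ^ p)⁻¹
  set K : ℝ := (2 * x) ^ p * (L + q / (x / 2) ^ 2)
  have hC : 0 ≤ C := by positivity
  have hK : 0 ≤ K := by positivity
  set h : ℝ := min (ε / 2) (1 / (C * K + 1))
  have hCK0 : 0 ≤ C * K := mul_nonneg hC hK
  have hh : 0 < h := by positivity
  have hh1 : C * K * h ^ 2 < 1 := by
    have h1 : h * (C * K + 1) ≤ 1 := (le_div_iff₀ (by positivity)).1 (min_le_right _ _)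
    have h2 : h ≤ 1 := by nlinarith
    nlinarith
  have main : ∀ r, |r - x| ≤ h → HasDerivAt D (c r * G r) r ∧ HasDerivAt G (G' r) r ∧
      (0 ≤ c r ∧ c r ≤ C) ∧ G' r ≤ K * D r ∧ 0 ≤ D r := by
    intro r hr
    obtain ⟨⟨⟨hur, hur'⟩, hwr, hwr'⟩, har, hxr, hrx⟩ := hball (y := r) (by
      rw [Real.dist_eq]; linarith [min_le_left (ε / 2) (1 / (C * K + 1))])
    have hr0 : 0 < r := by linarith
    have hrp : 0 < r ^ p := Real.rpow_pos_of_pos hr0 p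
    have hD0 : 0 ≤ D r := sub_nonneg.2 (hle r har)
    have hxp : 0 < (x / 2) ^ p := by positivity
    refine ⟨?_, ?_, ⟨by positivity, ?_⟩, ?_, hD0⟩
    · have : c r * G r = g r := by simp only [c, G]; field_simp
      rw [this]
      exact hur.hasDerivAt_and_deriv.1.fun_sub hwr.hasDerivAt_and_deriv.1
    · exact (Real.hasDerivAt_rpow_const (Or.inl hr0.ne')).fun_mul
        (hur.hasDerivAt_and_deriv.2.fun_sub hwr.hasDerivAt_and_deriv.2)
    · exact inv_anti₀ hxp (Real.rpow_le_rpow (by positivity) hxr.le hp)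
    · have e1 : G' r = r ^ p * (g' r + p / r * g r) := by
        simp only [G', Real.rpow_sub_one hr0.ne']; field_simp; ring
      have e2 : g' r + p / r * g r ≤ (L + q / r ^ 2) * D r := by
        have := hF r har
        simp only [g', g, D]
        linarith
      have e3 : q / r ^ 2 ≤ q / (x / 2) ^ 2 :=
        div_le_div_of_nonneg_left hq.le (by positivity) (by gcongr)
      rw [e1]
      calc r ^ p * (g' r + p / r * g r) ≤ r ^ p * ((L + q / r ^ 2) * D r) := by gcongr
        _ ≤ (2 * x) ^ p * ((L + q / (x / 2) ^ 2) * D r) := by gcongr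
        _ = K * D r := by simp only [K]; ring
  have hDx : D x = 0 := by simp [D, hux]
  have hGx : G x = 0 := by
    have h1 := (main x (by simpa using hh.le)).1
    have h2 := hmin.hasDerivAt_eq_zero h1
    have h3 : 0 < c x := by simp only [c]; positivity
    exact (mul_eq_zero.1 h2).resolve_left h3.ne'
  have right : ∀ r ∈ Icc x (x + h), D r = 0 := by
    have hI : ∀ r ∈ Icc x (x + h), |r - x| ≤ h := fun r hr =>
      abs_le.2 ⟨by linarith [hr.1], by linarith [hr.2]⟩
    exact eq_zero_of_deriv_mul_le (fun r hr => (main r (hI r hr)).1)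
      (fun r hr => (main r (hI r hr)).2.1) (fun r hr => (main r (hI r hr)).2.2.1)
      (fun r hr => (main r (hI r hr)).2.2.2.1) (fun r hr => (main r (hI r hr)).2.2.2.2) hDx hGx hK
      (by simpa using hh1)
  have left : ∀ r ∈ Icc (-x) (-x + h), D (-r) = 0 := by
    have hI : ∀ r ∈ Icc (-x) (-x + h), |-r - x| ≤ h := fun r hr =>
      abs_le.2 ⟨by linarith [hr.2], by linarith [hr.1]⟩
    refine eq_zero_of_deriv_mul_le (D := fun r => D (-r)) (G := fun r => -G (-r))
      (G' := fun r => G' (-r)) (c := fun r => c (-r)) (fun r hr => ?_) (fun r hr => ?_)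
      (fun r hr => (main _ (hI r hr)).2.2.1) (fun r hr => (main _ (hI r hr)).2.2.2.1)
      (fun r hr => (main _ (hI r hr)).2.2.2.2) (by simpa using hDx) (by simpa using hGx) hK
      (by simpa using hh1)
    · simpa [Function.comp_def] using (main _ (hI r hr)).1.scomp r (hasDerivAt_neg r)
    · simpa [Function.comp_def] using ((main _ (hI r hr)).2.1.scomp r (hasDerivAt_neg r)).fun_neg
  filter_upwards [Icc_mem_nhds (show x - h < x by linarith) (show x < x + h by linarith)] with r hr
  apply sub_eq_zero.1
  rcases le_total x r with h1 | h1
  · exact right r ⟨h1, hr.2⟩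
  · simpa using left (-r) ⟨by linarith, by linarith [hr.1]⟩

theorem eq_of_contact {p q sp : ℝ} {F u w : ℝ → ℝ} {a x : ℝ} (hp : 0 ≤ p) (hq : 0 < q)
    (ha : 0 ≤ a) (hFC : ContDiff ℝ 1 F) (hu : IsSuperSolutionOn p q F (Ioi a) u)
    (hw : IsSubSolutionOn p q F (Ioi a) w) (hub : ∀ r ∈ Ioi a, 0 ≤ u r ∧ u r ≤ sp)
    (hwb : ∀ r ∈ Ioi a, 0 ≤ w r ∧ w r ≤ sp) (hle : ∀ r ∈ Ioi a, w r ≤ u r)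
    (hx : a < x) (hux : u x = w x) : ∀ r ∈ Ioi a, u r = w r := by
  obtain ⟨L, hL, hLip⟩ := hFC.exists_abs_sub_le_mul 0 sp
  have hFL : ∀ r ∈ Ioi a, F (u r) - F (w r) ≤ L * (u r - w r) := fun r hr => by
    have := hLip _ (hub r hr) _ (hwb r hr)
    rw [abs_of_nonneg (sub_nonneg.2 (hle r hr))] at this
    exact (le_abs_self _).trans this
  have hloc : ∀ r ∈ Ioi a, u r = w r → ∀ᶠ y in 𝓝 r, u y = w y := fun r hr h =>
    eventually_eq_of_contact hp hq ha hL hu hw hle hFL hr h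
  set Z : Set ℝ := {r | a < r ∧ u r = w r}
  have hZo : IsOpen Z := isOpen_iff_mem_nhds.2 fun r hr => by
    filter_upwards [Ioi_mem_nhds hr.1, hloc r hr.1 hr.2] with y h1 h2 using ⟨h1, h2⟩
  have hsub : Ioi a ⊆ Z := by
    refine isPreconnected_Ioi.subset_of_closure_inter_subset hZo ⟨x, hx, hx, hux⟩ ?_
    rintro r ⟨hrZ, hr⟩
    refine ⟨hr, ?_⟩
    have hcont : ContinuousAt (fun r => u r - w r) r :=
      ((hu.1.continuousOn.sub hw.1.continuousOn).continuousAt (Ioi_mem_nhds hr))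
    by_contra hne
    have h1 : ∀ᶠ y in 𝓝 r, u y - w y ≠ 0 := hcont.eventually_ne (sub_ne_zero.2 hne)
    obtain ⟨y, hy, hyZ⟩ := mem_closure_iff_nhds.1 hrZ _ h1
    exact hy (sub_eq_zero.2 hyZ.2)
  exact fun r hr => (hsub hr).2

theorem LocLipOn.comp_mul_left {ψ : ℝ → ℝ} {a μ : ℝ} (hμ : 0 < μ) (h : LocLipOn (Ioi a) ψ) :
    LocLipOn (Ioi (a / μ)) (fun r => ψ (μ * r)) := by
  intro x hx
  have hx' : a < μ * x := (div_lt_iff₀' hμ).1 hx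
  obtain ⟨K, t, ht, hK⟩ := h (μ * x) hx'
  have hlip : LipschitzWith ‖μ‖₊ (fun r : ℝ => μ * r) := by
    simpa [smul_eq_mul] using lipschitzWith_smul (β := ℝ) μ
  refine ⟨K * ‖μ‖₊, (fun r => μ * r) ⁻¹' t, ?_,
    hK.comp (hlip.lipschitzOnWith) (mapsTo_preimage _ _)⟩
  refine (tendsto_nhdsWithin_iff.2 ⟨?_, ?_⟩ :
    Tendsto (fun r => μ * r) (𝓝[Ioi (a / μ)] x) (𝓝[Ioi a] (μ * x))) ht
  · exact (continuous_const_mul μ).continuousWithinAt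
  · filter_upwards [self_mem_nhdsWithin] with y hy using (div_lt_iff₀' hμ).1 hy

/-- Dilating a sub-solution whose values lie where `F ≤ 0` gives a sub-solution. -/
theorem IsSubSolutionOn.comp_mul_left {p q : ℝ} {F ψ : ℝ → ℝ} {a μ : ℝ} (ha : 0 ≤ a) (hμ : 0 < μ)
    (hμ1 : μ ≤ 1) (h : IsSubSolutionOn p q F (Ioi a) ψ) (hF : ∀ r ∈ Ioi a, F (ψ r) ≤ 0) :
    IsSubSolutionOn p q F (Ioi (a / μ)) (fun r => ψ (μ * r)) := by
  obtain ⟨hlip, S, hS, hC, hJ⟩ := h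
  have hmem : ∀ {x}, x ∈ Ioi (a / μ) → μ * x ∈ Ioi a := fun hx => (div_lt_iff₀' hμ).1 hx
  refine ⟨hlip.comp_mul_left hμ, (fun r => μ * r) ⁻¹' S, ?_, ?_, ?_⟩
  · intro x hx
    obtain ⟨ε, hε, hfin⟩ := hS _ (hmem hx)
    refine ⟨ε / μ, by positivity, ?_⟩
    refine (hfin.preimage (mul_right_injective₀ hμ.ne').injOn).subset ?_
    rintro y ⟨hy, hy1, hy2⟩
    refine ⟨hy, ?_, ?_⟩
    · have := mul_lt_mul_of_pos_left hy1 hμ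
      rwa [mul_sub, mul_div_cancel₀ _ hμ.ne'] at this
    · have := mul_lt_mul_of_pos_left hy2 hμ
      rwa [mul_add, mul_div_cancel₀ _ hμ.ne'] at this
  · rintro x ⟨hx, hxS⟩
    obtain ⟨h1, h2⟩ := hC (μ * x) ⟨hmem hx, hxS⟩
    have hx0 : 0 < x := (div_nonneg ha hμ.le).trans_lt hx
    refine ⟨h1.comp x (by fun_prop), ?_⟩
    have e1 : deriv (fun r => ψ (μ * r)) = fun r => μ * deriv ψ (μ * r) := by
      ext r; simpa using deriv_comp_mul_left μ ψ r
    have e2 : deriv (deriv (fun r => ψ (μ * r))) x = μ * (μ * deriv (deriv ψ) (μ * x)) := by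
      rw [e1, deriv_const_mul_field]
      congr 1
      simpa using deriv_comp_mul_left μ (deriv ψ) x
    rw [e2, e1]
    have h3 := hF _ (hmem hx)
    have e3 : μ * (μ * deriv (deriv ψ) (μ * x)) + p / x * (μ * deriv ψ (μ * x)) -
        q / x ^ 2 * ψ (μ * x) = μ ^ 2 * (deriv (deriv ψ) (μ * x) +
          p / (μ * x) * deriv ψ (μ * x) - q / (μ * x) ^ 2 * ψ (μ * x)) := by
      field_simp
    simp only [e3]
    have h4 : μ ^ 2 ≤ 1 := pow_le_one₀ hμ.le hμ1
    calc F (ψ (μ * x)) ≤ μ ^ 2 * F (ψ (μ * x)) := by nlinarith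
      _ ≤ _ := mul_le_mul_of_nonneg_left h2 (sq_nonneg μ)
  · rintro x ⟨hx, hxS⟩
    obtain ⟨dl, dr, hl, hr, hlt⟩ := hJ (μ * x) ⟨hmem hx, hxS⟩
    have hd : ∀ s : Set ℝ, HasDerivWithinAt (fun r => μ * r) μ s x := fun s => by
      simpa using ((hasDerivAt_id x).const_mul μ).hasDerivWithinAt
    refine ⟨dl * μ, dr * μ, HasDerivWithinAt.comp x hl (hd _) fun y hy => ?_,
      HasDerivWithinAt.comp x hr (hd _) fun y hy => ?_, mul_lt_mul_of_pos_right hlt hμ⟩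
    · exact mul_lt_mul_of_pos_left hy hμ
    · exact mul_lt_mul_of_pos_left hy hμ

theorem isSubSolutionOn_zero {p q : ℝ} {F : ℝ → ℝ} (I : Set ℝ) (hF : F 0 = 0) :
    IsSubSolutionOn p q F I (fun _ => 0) := by
  refine ⟨fun x _ => ⟨0, univ, univ_mem, (LipschitzWith.const 0).lipschitzOnWith⟩, ∅,
    fun x _ => ⟨1, one_pos, by simp⟩, fun x _ => ⟨contDiffAt_const, by simp [hF]⟩, by simp⟩

theorem isSuperSolutionOn_const {p q sp : ℝ} {F : ℝ → ℝ} (I : Set ℝ) (hq : 0 ≤ q) (hsp : 0 ≤ sp)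
    (hF : F sp = 0) : IsSuperSolutionOn p q F I (fun _ => sp) := by
  refine ⟨fun x _ => ⟨0, univ, univ_mem, (LipschitzWith.const sp).lipschitzOnWith⟩, ∅,
    fun x _ => ⟨1, one_pos, by simp⟩, fun x _ => ⟨contDiffAt_const, ?_⟩, by simp⟩
  have : 0 ≤ q / x ^ 2 * sp := by positivity
  simp only [deriv_const', mul_zero, hF]
  linarith

/-- Weak maximum principle near the origin, where the term `q / r ^ 2` dominates. -/
theorem le_of_le_right_of_small {p q L δ sp : ℝ} {F u w : ℝ → ℝ} (hL : 0 ≤ L) (hδ : 0 < δ)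
    (hδL : L * δ ^ 2 < q)
    (hLip : ∀ s ∈ Icc 0 sp, ∀ t ∈ Icc 0 sp, |F s - F t| ≤ L * |s - t|)
    (hu : IsSuperSolutionOn p q F (Ioi 0) u) (hw : IsSubSolutionOn p q F (Ioi 0) w)
    (hub : ∀ r ∈ Ioi 0, 0 ≤ u r ∧ u r ≤ sp) (hwb : ∀ r ∈ Ioi 0, 0 ≤ w r ∧ w r ≤ sp)
    (huc : ContinuousOn u (Ici 0)) (hwc : ContinuousOn w (Ici 0))
    (h0 : w 0 ≤ u 0) (hδle : w δ ≤ u δ) : ∀ r ∈ Icc 0 δ, w r ≤ u r := by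
  obtain ⟨x, hx, hmin⟩ := isCompact_Icc.exists_isMinOn ⟨0, left_mem_Icc.2 hδ.le⟩
    ((huc.sub hwc).mono (Icc_subset_Ici_self : Icc 0 δ ⊆ Ici 0))
  suffices h : w x ≤ u x from fun r hr => by
    have : u x - w x ≤ u r - w r := hmin hr
    linarith
  by_contra! hlt
  have hx0 : 0 < x := hx.1.lt_of_ne (by rintro rfl; exact hlt.not_ge h0)
  have hxδ : x < δ := hx.2.lt_of_ne (by rintro rfl; exact hlt.not_ge hδle)
  have hloc : IsLocalMin (fun r => u r - w r) x := hmin.isLocalMin (Icc_mem_nhds hx0 hxδ)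
  have hev := eventually_contDiffAt_of_isLocalMin_sub hu hw hx0 hloc
  obtain ⟨⟨hux, hux'⟩, hwx, hwx'⟩ := hev.self_of_nhds
  have h1 : deriv u x - deriv w x = 0 := hloc.hasDerivAt_eq_zero
    (hux.hasDerivAt_and_deriv.1.fun_sub hwx.hasDerivAt_and_deriv.1)
  have h2 : 0 ≤ deriv (deriv u) x - deriv (deriv w) x := by
    have e : deriv (fun r => u r - w r) =ᶠ[𝓝 x] fun r => deriv u r - deriv w r := by
      filter_upwards [hev] with y hy
      exact (hy.1.1.hasDerivAt_and_deriv.1.fun_sub hy.2.1.hasDerivAt_and_deriv.1).deriv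
    have := hloc.deriv_deriv_nonneg (hux.continuousAt.sub hwx.continuousAt)
    rwa [e.deriv_eq,
      (hux.hasDerivAt_and_deriv.2.fun_sub hwx.hasDerivAt_and_deriv.2).deriv] at this
  have h3 := (le_abs_self _).trans (hLip _ (hub x hx0) _ (hwb x hx0))
  rw [abs_of_neg (sub_neg.2 hlt)] at h3
  have h4 : L < q / x ^ 2 := by
    rw [lt_div_iff₀ (by positivity)]
    nlinarith [mul_le_mul_of_nonneg_left (pow_le_pow_left₀ hx0.le hxδ.le 2) hL]
  have h5 : p / x * deriv u x = p / x * deriv w x := by rw [sub_eq_zero.1 h1]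
  nlinarith [mul_pos (sub_pos.2 h4) (sub_pos.2 hlt)]

theorem IsSuperSolutionOn.mono {p q : ℝ} {F ψ : ℝ → ℝ} {I J : Set ℝ}
    (h : IsSuperSolutionOn p q F I ψ) (hJI : J ⊆ I) : IsSuperSolutionOn p q F J ψ := by
  obtain ⟨hlip, S, h1, h2, h3⟩ := h
  refine ⟨fun x hx => ?_, S, fun x hx => h1 x (hJI hx), fun x hx => h2 x ⟨hJI hx.1, hx.2⟩,
    fun x hx => h3 x ⟨hJI hx.1, hx.2⟩⟩
  obtain ⟨K, t, ht, hK⟩ := hlip x (hJI hx)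
  exact ⟨K, t, nhdsWithin_mono x hJI ht, hK⟩

theorem AsympInfty.tendsto {u : ℝ → ℝ} {sp β : ℝ} (h : AsympInfty u sp β) :
    Tendsto u atTop (𝓝 sp) := by
  have hinv : Tendsto (fun r : ℝ => (r ^ 2)⁻¹) atTop (𝓝 0) :=
    tendsto_inv_atTop_zero.comp (tendsto_pow_atTop two_ne_zero)
  have h1 := ((h.mul hinv).add_const sp).sub (hinv.const_mul β)
  simp only [mul_zero, zero_add, sub_zero] at h1
  refine h1.congr' ?_
  filter_upwards [eventually_gt_atTop 0] with r hr
  field_simp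
  ring

/-- Dilations by factors bounded away from `1` are ordered near infinity, uniformly. -/
theorem exists_forall_ge_comp_mul_lt {u ℓ : ℝ → ℝ} {sp βb βl m : ℝ} (hℓc : Continuous ℓ)
    (hℓ : ∀ s, ℓ s < sp) (hu : AsympInfty u sp βb) (hℓa : AsympInfty ℓ sp βl)
    (hβl : 0 < βl) (hβ : βb ≤ βl) (hm : 0 < m) (hm1 : m < 1) :
    ∃ R, ∀ r, R ≤ r → ∀ μ ∈ Icc 0 m, ℓ (μ * r) < u r := by
  have hm2 : m ^ 2 < 1 := pow_lt_one₀ hm.le hm1 two_ne_zero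
  set ε : ℝ := βl * (1 - m ^ 2) / 4 with hεdef
  have hε : 0 < ε := by have := sub_pos.2 hm2; positivity
  obtain ⟨S, hS⟩ := eventually_atTop.1
    ((hℓa.eventually (gt_mem_nhds hε)).and (eventually_gt_atTop 0))
  obtain ⟨hSa, hS0⟩ := hS S le_rfl
  obtain ⟨z, -, hz⟩ := isCompact_Icc.exists_isMaxOn ⟨0, left_mem_Icc.2 hS0.le⟩
    (hℓc.continuousOn (s := Icc 0 S))
  obtain ⟨R, hR⟩ := eventually_atTop.1
    ((hu.eventually (lt_mem_nhds (neg_lt_zero.2 hε))).and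
      ((hu.tendsto.eventually (lt_mem_nhds (hℓ z))).and (eventually_gt_atTop 0)))
  refine ⟨R, fun r hr μ hμ => ?_⟩
  obtain ⟨h1, h2, hr0⟩ := hR r hr
  rcases le_total (μ * r) S with h | h
  · exact (hz ⟨mul_nonneg hμ.1 hr0.le, h⟩).trans_lt h2
  · obtain ⟨h3, hs0⟩ := hS _ h
    have hs : 0 < (μ * r) ^ 2 := by positivity
    have hrr : 0 < r ^ 2 := by positivity
    have e1 : (u r - (sp - βb / r ^ 2)) * r ^ 2 = βb - (sp - u r) * r ^ 2 := by field_simp; ring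
    have e2 : (ℓ (μ * r) - (sp - βl / (μ * r) ^ 2)) * (μ * r) ^ 2 =
        βl - (sp - ℓ (μ * r)) * (μ * r) ^ 2 := by
      have := hs.ne'
      rw [sub_mul, sub_mul, div_mul_cancel₀ _ this]; ring
    rw [e1] at h1
    rw [e2] at h3
    have h4 : (μ * r) ^ 2 ≤ m ^ 2 * r ^ 2 := by
      rw [mul_pow]; gcongr
      exacts [hμ.1, hμ.2]
    have h5 : (sp - ℓ (μ * r)) * (μ * r) ^ 2 ≤ (sp - ℓ (μ * r)) * (m ^ 2 * r ^ 2) :=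
      mul_le_mul_of_nonneg_left h4 (sub_pos.2 (hℓ _)).le
    have hm0 : 0 < m ^ 2 := by positivity
    have h6 : m ^ 2 * (βl + ε) < βl - ε := by
      rw [hεdef]; nlinarith [mul_pos hβl (sub_pos.2 hm2)]
    have h7 : m ^ 2 * ((sp - u r) * r ^ 2) ≤ m ^ 2 * (βl + ε) :=
      mul_le_mul_of_nonneg_left (by linarith) hm0.le
    by_contra! hle
    have h8 : (sp - ℓ (μ * r)) * (m ^ 2 * r ^ 2) ≤ (sp - u r) * (m ^ 2 * r ^ 2) :=
      mul_le_mul_of_nonneg_right (by linarith) (by positivity)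
    linarith

theorem continuousOn_Ici_of_Ioi {f : ℝ → ℝ} {a : ℝ} (h : ContinuousOn f (Ioi a))
    (ha : ContinuousWithinAt f (Ioi a) a) : ContinuousOn f (Ici a) := by
  intro x hx
  rcases (show a ≤ x from hx).eq_or_lt with rfl | hlt
  · exact continuousWithinAt_Ioi_iff_Ici.1 ha
  · exact (h.continuousAt (Ioi_mem_nhds hlt)).continuousWithinAt

theorem comp_mul_max_le {p q sp : ℝ} (hp : 0 ≤ p) (hq : 0 < q) (hsp : 0 < sp)
    {F : ℝ → ℝ} (hF : CondF F sp) {r₁ : ℝ} (hr₁ : 0 ≤ r₁) {ub lb : ℝ → ℝ} {βb βl : ℝ}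
    (hsuper : IsSuperSolutionOn p q F (Ioi r₁) ub)
    (hsub : IsSubSolutionOn p q F (Ioi r₁) lb)
    (hubc : ContinuousWithinAt ub (Ioi r₁) r₁)
    (hlbc : ContinuousWithinAt lb (Ioi r₁) r₁)
    (hubnd : ∀ r ∈ Ioi r₁, 0 ≤ ub r ∧ ub r ≤ sp)
    (hlbnd : ∀ r ∈ Ioi r₁, 0 ≤ lb r ∧ lb r ≤ sp)
    (hub1 : 0 ≤ ub r₁) (hlb1 : lb r₁ = 0) (hβl : 0 < βl) (hβ : βb ≤ βl)
    (hiub : AsympInfty ub sp βb) (hilb : AsympInfty lb sp βl)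
    {m : ℝ} (hm : 0 < m) (hm1 : m < 1) : ∀ r ∈ Ioi r₁, lb (max (m * r) r₁) ≤ ub r := by
  obtain ⟨hFC, hF0, hFsp, hFneg, -, -⟩ := hF
  have hFnp : ∀ t, 0 ≤ t ∧ t ≤ sp → F t ≤ 0 := by
    rintro t ⟨h0, h1⟩
    rcases h0.eq_or_lt with rfl | h0
    · exact hF0.le
    rcases h1.eq_or_lt with rfl | h1
    · exact hFsp.le
    · exact (hFneg t ⟨h0, h1⟩).le
  have hubC := hsuper.1.continuousOn
  have hlbC := continuousOn_Ici_of_Ioi hsub.1.continuousOn hlbc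
  have hub_pos : ∀ r ∈ Ioi r₁, 0 < ub r := by
    intro r hr
    refine (hubnd r hr).1.lt_of_ne fun h => ?_
    have h1 := eq_of_contact hp hq hr₁ hFC hsuper (isSubSolutionOn_zero _ hF0) hubnd
      (fun _ _ => ⟨le_rfl, hsp.le⟩) (fun r hr => (hubnd r hr).1) hr h.symm
    obtain ⟨y, hy, hy'⟩ := ((hiub.tendsto.eventually (lt_mem_nhds hsp)).and
      (eventually_gt_atTop r₁)).exists
    exact hy.ne' (h1 y hy')
  have hlb_lt : ∀ r ∈ Ioi r₁, lb r < sp := by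
    intro r hr
    refine (hlbnd r hr).2.lt_of_ne fun h => ?_
    have h1 := eq_of_contact hp hq hr₁ hFC (isSuperSolutionOn_const _ hq.le hsp.le hFsp) hsub
      (fun _ _ => ⟨hsp.le, le_rfl⟩) hlbnd (fun r hr => (hlbnd r hr).2) hr h.symm
    obtain ⟨y, ⟨hy, hy0⟩, hy'⟩ := ((((hilb.eventually (gt_mem_nhds hβl)).and
      (eventually_gt_atTop 0))).and (eventually_gt_atTop r₁)).exists
    rw [← h1 y hy', sub_sub_cancel, div_mul_cancel₀ _ (by positivity)] at hy
    exact lt_irrefl _ hy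
  set ℓ : ℝ → ℝ := fun s => lb (max s r₁)
  have hℓ_left : ∀ s, s ≤ r₁ → ℓ s = 0 := fun s hs => by simp [ℓ, hs, hlb1]
  have hℓ_right : ∀ s, r₁ ≤ s → ℓ s = lb s := fun s hs => by simp [ℓ, hs]
  have hℓc : Continuous ℓ := continuousOn_univ.1
    (hlbC.comp (by fun_prop : Continuous fun s : ℝ => max s r₁).continuousOn
      fun s _ => le_max_right s r₁)
  have hℓ_lt : ∀ s, ℓ s < sp := fun s => by
    rcases le_or_gt s r₁ with hs | hs
    · rwa [hℓ_left s hs]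
    · rw [hℓ_right s hs.le]; exact hlb_lt s hs
  have hℓa : AsympInfty ℓ sp βl := Tendsto.congr' (by
    filter_upwards [eventually_ge_atTop r₁] with s hs
    rw [hℓ_right s hs]) hilb
  obtain ⟨R, hR⟩ := exists_forall_ge_comp_mul_lt hℓc hℓ_lt hiub hℓa hβl hβ hm hm1
  have hdil : ∀ μ, 0 < μ → μ ≤ 1 →
      IsSubSolutionOn p q F (Ioi (r₁ / μ)) (fun r => lb (μ * r)) := fun μ h0 h1 =>
    hsub.comp_mul_left hr₁ h0 h1 fun r hr => hFnp _ (hlbnd r hr)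
  have hmem : ∀ {μ r : ℝ}, 0 < μ → r ∈ Ioi (r₁ / μ) → μ * r ∈ Ioi r₁ := fun h hr =>
    (div_lt_iff₀' h).1 hr
  obtain ⟨δ, hδ, hnear⟩ : ∃ δ, r₁ < δ ∧ ∀ μ ∈ Icc 0 m, ℓ (μ * δ) ≤ ub δ →
      ∀ r ∈ Ioo r₁ δ, ℓ (μ * r) ≤ ub r := by
    rcases hr₁.eq_or_lt with rfl | hr₁0
    · obtain ⟨L, hL, hLip⟩ := hFC.exists_abs_sub_le_mul 0 sp
      have hδ0 : 0 < min 1 (q / (L + 1)) := lt_min one_pos (by positivity)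
      refine ⟨min 1 (q / (L + 1)), hδ0, fun μ hμ hle r hr => ?_⟩
      rcases hμ.1.eq_or_lt with rfl | hμ0
      · rw [zero_mul, hℓ_left 0 le_rfl]; exact (hub_pos r hr.1).le
      have hsm : L * (min 1 (q / (L + 1))) ^ 2 < q := by
        have h1 := min_le_left 1 (q / (L + 1))
        have h2 := (le_div_iff₀ (by positivity)).1 (min_le_right 1 (q / (L + 1)))
        have h3 : L * (min 1 (q / (L + 1))) ^ 2 ≤ L * min 1 (q / (L + 1)) :=
          mul_le_mul_of_nonneg_left (by nlinarith) hL
        linarith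
      have hw := hdil μ hμ0 (hμ.2.trans hm1.le)
      rw [zero_div] at hw
      rw [hℓ_right _ (by positivity)] at hle
      rw [hℓ_right _ (mul_nonneg hμ.1 hr.1.le)]
      exact le_of_le_right_of_small hL hδ0 hsm hLip hsuper hw hubnd
        (fun s hs => hlbnd _ (mul_pos hμ0 hs)) (continuousOn_Ici_of_Ioi hubC hubc)
        (hlbC.comp (continuous_const_mul μ).continuousOn fun s hs => mul_nonneg hμ.1 hs)
        (by simpa [hlb1] using hub1) hle r (Ioo_subset_Icc_self hr)
    · refine ⟨r₁ / m, (lt_div_iff₀ hm).2 (by nlinarith), fun μ hμ _ r hr => ?_⟩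
      rw [hℓ_left]
      · exact (hub_pos r hr.1).le
      · have h1 := (lt_div_iff₀' hm).1 hr.2
        exact (mul_le_mul_of_nonneg_right hμ.2 (hr₁0.trans hr.1).le).trans h1.le
  set A : Set ℝ := {μ | ∀ r ∈ Ioi r₁, ℓ (μ * r) ≤ ub r}
  have hAcl : IsClosed A := by
    simp only [A, ofPred_forall]
    exact isClosed_biInter fun r _ => isClosed_le (by fun_prop) continuous_const
  have hA0 : (0 : ℝ) ∈ A := fun r hr => by
    rw [zero_mul, hℓ_left 0 hr₁]; exact (hub_pos r hr).le
  have hstrict : ∀ μ ∈ A ∩ Ico 0 m, ∀ r ∈ Ioi r₁, ℓ (μ * r) < ub r := by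
    rintro μ ⟨hμA, hμ⟩ r hr
    rcases le_or_gt (μ * r) r₁ with h | h
    · rw [hℓ_left _ h]; exact hub_pos r hr
    have hr0 : 0 < r := hr₁.trans_lt hr
    have hμ0 : 0 < μ := pos_of_mul_pos_left (hr₁.trans_lt h) hr0.le
    refine (hμA r hr).lt_of_ne fun heq => ?_
    have hle : r₁ ≤ r₁ / μ := (le_div_iff₀ hμ0).2 (by nlinarith [hμ.2])
    have hsup := hsuper.mono (Ioi_subset_Ioi hle)
    have hall := eq_of_contact hp hq (div_nonneg hr₁ hμ0.le) hFC hsup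
      (hdil μ hμ0 (hμ.2.le.trans hm1.le)) (fun s hs => hubnd s (hle.trans_lt hs))
      (fun s hs => hlbnd _ (hmem hμ0 hs))
      (fun s hs => by
        have := hμA s (hle.trans_lt hs)
        rwa [hℓ_right _ (hmem hμ0 hs).le] at this)
      ((div_lt_iff₀' hμ0).2 h) (by rw [← heq, hℓ_right _ h.le])
    have hs : max R (r₁ / μ + 1) ∈ Ioi (r₁ / μ) :=
      mem_Ioi.2 ((lt_add_one _).trans_le (le_max_right _ _))
    have h1 := hR _ (le_max_left R (r₁ / μ + 1)) μ (Ico_subset_Icc_self hμ)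
    rw [hℓ_right _ (hmem hμ0 hs).le, hall _ hs] at h1
    exact lt_irrefl _ h1
  have hsubset : Icc 0 m ⊆ A := by
    refine (hAcl.inter isClosed_Icc).Icc_subset_of_forall_mem_nhdsWithin hA0 fun μ hμ => ?_
    have hmid : ∀ᶠ ν in 𝓝 μ, ∀ r ∈ Icc δ R, ℓ (ν * r) < ub r := by
      refine isCompact_Icc.eventually_forall_of_forall_eventually
        (P := fun ν r => ℓ (ν * r) < ub r) fun r hr => ?_
      have hr' : r ∈ Ioi r₁ := hδ.trans_le hr.1
      have c1 : ContinuousAt (fun z : ℝ × ℝ => ℓ (z.1 * z.2)) (μ, r) := by fun_prop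
      have c2 : ContinuousAt (fun z : ℝ × ℝ => ub z.2) (μ, r) :=
        ContinuousAt.comp (f := Prod.snd) (hubC.continuousAt (Ioi_mem_nhds hr')) continuousAt_snd
      exact c1.eventually_lt c2 (hstrict μ hμ r hr')
    filter_upwards [nhdsWithin_le_nhds hmid, Ioo_mem_nhdsGT hμ.2.2] with ν hν hνm
    have hνI : ν ∈ Icc 0 m := ⟨hμ.2.1.trans hνm.1.le, hνm.2.le⟩
    have hfar : ∀ r, δ ≤ r → ℓ (ν * r) ≤ ub r := fun r hr => by
      rcases le_total r R with h | h
      · exact (hν r ⟨hr, h⟩).le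
      · exact (hR r h ν hνI).le
    intro r hr
    rcases lt_or_ge r δ with h | h
    · exact hnear ν hνI (hfar δ le_rfl) r ⟨hr, h⟩
    · exact hfar r h
  exact hsubset ⟨hm.le, le_rfl⟩

/-- comparison principle on an exterior interval `(r₁,∞)`. -/
theorem stmt9 (p q sp : ℝ) (hp : 0 ≤ p) (hq : 0 < q) (hsp : 0 < sp)
    (F : ℝ → ℝ) (hF : CondF F sp)
    (r₁ : ℝ) (hr₁ : 0 ≤ r₁)
    (ub lb : ℝ → ℝ) (βb βl : ℝ)
    (hsuper : IsSuperSolutionOn p q F (Set.Ioi r₁) ub)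
    (hsub : IsSubSolutionOn p q F (Set.Ioi r₁) lb)
    (hubc : ContinuousWithinAt ub (Set.Ioi r₁) r₁)
    (hlbc : ContinuousWithinAt lb (Set.Ioi r₁) r₁)
    (hubnd : ∀ r ∈ Set.Ioi r₁, 0 ≤ ub r ∧ ub r ≤ sp)
    (hlbnd : ∀ r ∈ Set.Ioi r₁, 0 ≤ lb r ∧ lb r ≤ sp)
    (hub1 : 0 ≤ ub r₁) (hlb1 : lb r₁ = 0)
    (hβl : 0 < βl) (hβ : βb ≤ βl)
    (hiub : AsympInfty ub sp βb)
    (hilb : AsympInfty lb sp βl) :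
    (∀ r ∈ Set.Ioi r₁, lb r ≤ ub r) ∧
      (∀ r₀ ∈ Set.Ioi r₁, ub r₀ = lb r₀ → ∀ r ∈ Set.Ioi r₁, ub r = lb r) := by
  have hle : ∀ r ∈ Set.Ioi r₁, lb r ≤ ub r := by
    intro r hr
    have hcont : ContinuousAt (fun m : ℝ => lb (max (m * r) r₁)) 1 := by
      refine ContinuousAt.comp (g := lb) (f := fun m : ℝ => max (m * r) r₁) ?_ (by fun_prop)
      simpa [le_of_lt (show r₁ < r from hr)] using
        hsub.1.continuousOn.continuousAt (Ioi_mem_nhds hr)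
    have hlim : Tendsto (fun m : ℝ => lb (max (m * r) r₁)) (𝓝[<] 1) (𝓝 (lb r)) := by
      have := hcont.tendsto.mono_left (nhdsWithin_le_nhds (s := Set.Iio 1))
      simpa [le_of_lt (show r₁ < r from hr)] using this
    refine le_of_tendsto hlim ?_
    filter_upwards [Ioo_mem_nhdsLT (show (0 : ℝ) < 1 by norm_num)] with m hm
    exact comp_mul_max_le hp hq hsp hF hr₁ hsuper hsub hubc hlbc hubnd hlbnd hub1 hlb1 hβl hβ
      hiub hilb hm.1 hm.2 r hr
  exact ⟨hle, fun r₀ hr₀ h => eq_of_contact hp hq hr₁ hF.1 hsuper hsub hubnd hlbnd hle hr₀ h⟩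
end

section
/- For any 0 < R ≤ ∞, the boundary-value problem (⋆)&(BC) on (0,R) has at most one solution u satisfying u ≥ 0 on (0,R): if u₁ and u₂ are two solutions of (⋆)&(BC) on (0,R) with u₁ ≥ 0 and u₂ ≥ 0 on (0,R), then u₁ ≡ u₂. -/
open Set Filter Topology MeasureTheory
open scoped ENNReal NNReal

/-- `u` is a solution of the boundary-value problem (⋆)&(BC) on `(0,R)` with `R ∈ (0,∞]`:
`u` is continuous on `[0,R)`, `C²` on `(0,R)`, satisfies (⋆) pointwise on `(0,R)`,
`u(0) = 0`, and `u(r) → s₊` as `r → R⁻` (for `R < ∞`) resp. `r → ∞` (for `R = ∞`). -/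
def IsBVPSolution (p q : ℝ) (F : ℝ → ℝ) (sp : ℝ) (R : ℝ≥0∞) (u : ℝ → ℝ) : Prop :=
  ContinuousOn u {r : ℝ | 0 ≤ r ∧ ENNReal.ofReal r < R} ∧
    (∀ r : ℝ, 0 < r → ENNReal.ofReal r < R → ContDiffAt ℝ 2 u r) ∧
    (∀ r : ℝ, 0 < r → ENNReal.ofReal r < R → ODEAt p q F u r) ∧
    u 0 = 0 ∧
    (∀ R' : ℝ, 0 < R' → R = ENNReal.ofReal R' →
      Filter.Tendsto u (nhdsWithin R' (Set.Iio R')) (nhds sp)) ∧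
    (R = ⊤ → Filter.Tendsto u Filter.atTop (nhds sp))

/-- Second-order necessary condition at a local maximum. -/
theorem IsLocalMax.deriv_deriv_nonpos {f : ℝ → ℝ} {x : ℝ} (h : IsLocalMax f x)
    (hc : ContinuousAt f x) : deriv (deriv f) x ≤ 0 := by
  by_contra! hpos
  have hmin := isLocalMin_of_deriv_deriv_pos hpos h.deriv_eq_zero hc
  have hconst : f =ᶠ[𝓝 x] fun _ => f x := by
    filter_upwards [h, hmin] with y h₁ h₂ using le_antisymm h₁ h₂
  have hderiv : deriv (deriv f) x = 0 := by
    rw [hconst.deriv.deriv_eq]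
    simp
  exact hpos.ne' hderiv

/-- A continuous function on the line which somewhere exceeds its values on `(-∞, 0]` and its
limit at `+∞` attains its maximum at a positive point. -/
theorem exists_pos_forall_le_of_tendsto {f : ℝ → ℝ} (hf : Continuous f) {l x₀ : ℝ}
    (hneg : ∀ x ≤ 0, f x < f x₀) (hlim : Tendsto f atTop (𝓝 l)) (hl : l < f x₀) :
    ∃ x, 0 < x ∧ ∀ y, f y ≤ f x := by
  obtain ⟨x, hx⟩ := hf.exists_forall_ge' x₀ (by
    rw [cocompact_eq_atBot_atTop, eventually_sup]
    refine ⟨?_, (hlim.eventually_lt_const hl).mono fun y hy => hy.le⟩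
    filter_upwards [eventually_le_atBot (0 : ℝ)] with y hy using (hneg y hy).le)
  refine ⟨x, ?_, hx⟩
  by_contra! hx0
  exact absurd (hx x₀) (not_le.2 (hneg x hx0))

namespace CondF

variable {F : ℝ → ℝ} {sp : ℝ}

theorem exists_lipschitz (hF : CondF F sp) :
    ∃ K, 0 < K ∧ ∀ x ∈ Icc 0 sp, ∀ y ∈ Icc 0 sp, |F x - F y| ≤ K * |x - y| := by
  obtain ⟨K, hK⟩ := hF.1.contDiffOn.exists_lipschitzOnWith one_ne_zero
    (convex_Icc 0 sp) isCompact_Icc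
  refine ⟨K + 1, by positivity, fun x hx y hy => ?_⟩
  have h := hK.dist_le_mul x hx y hy
  rw [Real.dist_eq, Real.dist_eq] at h
  nlinarith [abs_nonneg (x - y)]

theorem exists_strictMonoOn (hF : CondF F sp) :
    ∃ a < sp, StrictMonoOn F (Icc a sp) := by
  have hev : ∀ᶠ t in 𝓝 sp, 0 < deriv F t :=
    (hF.1.continuous_deriv le_rfl).continuousAt.eventually_const_lt hF.2.2.2.2.2
  obtain ⟨ε, hε, hball⟩ := Metric.eventually_nhds_iff.1 hev
  refine ⟨sp - ε, by linarith, strictMonoOn_of_deriv_pos (convex_Icc _ _)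
    hF.1.continuous.continuousOn fun t ht => hball ?_⟩
  rw [interior_Icc] at ht
  rw [Real.dist_eq, abs_lt]
  constructor <;> linarith [ht.1, ht.2]

end CondF

/-- A non-negative solution on `(0, R)`, extended to the whole line by `0` on `(-∞, 0]` and by
`sp` on `[R, ∞)`. -/
structure IsExtendedSolution (p q : ℝ) (F : ℝ → ℝ) (sp : ℝ) (R : ℝ≥0∞) (U : ℝ → ℝ) : Prop where
  continuous : Continuous U
  eq_zero : ∀ r ≤ 0, U r = 0
  eq_sp : ∀ r, 0 < r → R ≤ ENNReal.ofReal r → U r = sp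
  tendsto : Tendsto U atTop (𝓝 sp)
  contDiffAt : ∀ r, 0 < r → ENNReal.ofReal r < R → ContDiffAt ℝ 2 U r
  ode : ∀ r, 0 < r → ENNReal.ofReal r < R → ODEAt p q F U r
  nonneg : ∀ r, 0 ≤ U r

theorem IsBVPSolution.exists_isExtendedSolution {p q sp : ℝ} {F : ℝ → ℝ} {R : ℝ≥0∞}
    {u : ℝ → ℝ} (hR : 0 < R) (hsp : 0 < sp) (hu : IsBVPSolution p q F sp R u)
    (hnn : ∀ r : ℝ, 0 < r → ENNReal.ofReal r < R → 0 ≤ u r) :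
    ∃ U, IsExtendedSolution p q F sp R U ∧
      ∀ r, 0 ≤ r → ENNReal.ofReal r < R → U r = u r := by
  obtain ⟨hcont, hC2, hode, h0, hlim, hlimtop⟩ := hu
  classical
  set V : ℝ → ℝ := fun r => if ENNReal.ofReal r < R then u r else sp with hV
  have hopen : IsOpen {r : ℝ | ENNReal.ofReal r < R} :=
    isOpen_Iio.preimage ENNReal.continuous_ofReal
  have hVu : ∀ r, ENNReal.ofReal r < R → V =ᶠ[𝓝 r] u := fun r hr => by
    filter_upwards [hopen.mem_nhds hr] with y hy
    exact if_pos hy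
  have hVcont : ContinuousOn V (Ici 0) := by
    intro r hr
    rcases lt_trichotomy (ENNReal.ofReal r) R with h | h | h
    · have hw : ContinuousWithinAt u (Ici 0) r :=
        (hcont r ⟨hr, h⟩).mono_of_mem_nhdsWithin
          (inter_mem_nhdsWithin _ (hopen.mem_nhds h))
      exact hw.congr_of_eventuallyEq ((hVu r h).filter_mono nhdsWithin_le_nhds)
        ((hVu r h).self_of_nhds)
    · have hrpos : 0 < r := ENNReal.ofReal_pos.1 (h ▸ hR)
      refine (continuousAt_iff_continuous_left'_right'.2 ⟨?_, ?_⟩).continuousWithinAt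
      · have hVr : V r = sp := if_neg (by simp [h])
        rw [ContinuousWithinAt, hVr]
        refine (hlim r hrpos h.symm).congr' ?_
        filter_upwards [self_mem_nhdsWithin] with y hy
        refine (if_pos ?_).symm
        rw [← h]
        exact (ENNReal.ofReal_lt_ofReal_iff hrpos).2 hy
      · have hVr : V r = sp := if_neg (by simp [h])
        rw [ContinuousWithinAt, hVr]
        refine tendsto_const_nhds.congr' ?_
        filter_upwards [self_mem_nhdsWithin] with y hy
        refine (if_neg ?_).symm
        rw [← h, not_lt]
        exact ENNReal.ofReal_le_ofReal (le_of_lt hy)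
    · have hev : V =ᶠ[𝓝 r] fun _ => sp := by
        filter_upwards [ENNReal.continuous_ofReal.continuousAt.eventually_const_lt h] with y hy
        exact if_neg hy.le.not_gt
      exact (continuousAt_const.congr hev.symm).continuousWithinAt
  have hUV : ∀ r, 0 < r → (fun r => V (max r 0)) =ᶠ[𝓝 r] V := fun r hr => by
    filter_upwards [lt_mem_nhds hr] with y hy
    rw [max_eq_left hy.le]
  have hUu : ∀ r, 0 < r → ENNReal.ofReal r < R → (fun r => V (max r 0)) =ᶠ[𝓝 r] u :=
    fun r hr h => (hUV r hr).trans (hVu r h)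
  have hV0 : V 0 = 0 := by
    exact (if_pos (by simpa using hR)).trans h0
  refine ⟨fun r => V (max r 0), ⟨?_, ?_, ?_, ?_, ?_, ?_, ?_⟩, ?_⟩
  · exact hVcont.comp_continuous (by fun_prop) fun x => le_max_right x 0
  · intro r hr
    simp only [max_eq_right hr, hV0]
  · intro r hr h
    simp only [max_eq_left hr.le]
    exact if_neg h.not_gt
  · rcases eq_or_ne R ⊤ with h | h
    · refine (hlimtop h).congr' ?_
      filter_upwards [eventually_gt_atTop (0 : ℝ)] with y hy
      exact ((hUu y hy (by simp [h])).self_of_nhds).symm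
    · refine tendsto_const_nhds.congr' ?_
      filter_upwards [eventually_gt_atTop (0 : ℝ), eventually_ge_atTop R.toReal] with y hy hy'
      rw [max_eq_left hy.le]
      exact (if_neg (not_lt.2 ((ENNReal.le_ofReal_iff_toReal_le h hy.le).2 hy'))).symm
  · intro r hr h
    exact (hC2 r hr h).congr_of_eventuallyEq (hUu r hr h)
  · intro r hr h
    have := hode r hr h
    rw [ODEAt] at this ⊢
    rw [(hUu r hr h).deriv.deriv_eq, (hUu r hr h).deriv_eq]
    simpa only [(hUu r hr h).self_of_nhds] using this
  · intro r
    rcases le_or_gt r 0 with hr | hr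
    · simp only [max_eq_right hr, hV0, le_refl]
    · simp only [max_eq_left hr.le, hV]
      split_ifs with h
      · exact hnn r hr h
      · exact hsp.le
  · intro r hr h
    simp only [max_eq_left hr]
    exact if_pos h

namespace IsExtendedSolution

variable {p q sp : ℝ} {F : ℝ → ℝ} {R : ℝ≥0∞} {U U₁ U₂ : ℝ → ℝ}

theorem hasDerivAt (hU : IsExtendedSolution p q F sp R U) {r : ℝ} (hr : 0 < r)
    (hrR : ENNReal.ofReal r < R) : HasDerivAt U (deriv U r) r :=
  ((hU.contDiffAt r hr hrR).differentiableAt two_ne_zero).hasDerivAt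

theorem hasDerivAt_deriv (hU : IsExtendedSolution p q F sp R U) {r : ℝ} (hr : 0 < r)
    (hrR : ENNReal.ofReal r < R) : HasDerivAt (deriv U) (deriv (deriv U) r) r := by
  have h : ContDiffAt ℝ 1 (deriv U) r := (hU.contDiffAt r hr hrR).derivWithin (by norm_num)
  exact (h.differentiableAt one_ne_zero).hasDerivAt

theorem lt_of_lt_sp (hU : IsExtendedSolution p q F sp R U) {r : ℝ} (hr : 0 < r)
    (h : U r < sp) : ENNReal.ofReal r < R := by
  by_contra! hR
  exact h.ne (hU.eq_sp r hr hR)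

/-- A positive value at a local maximum forces `F` to be negative there. -/
theorem nonlinearity_neg_of_isLocalMax (hU : IsExtendedSolution p q F sp R U) (hq : 0 < q)
    {r : ℝ} (hr : 0 < r) (hrR : ENNReal.ofReal r < R) (hmax : IsLocalMax U r)
    (hpos : 0 < U r) : F (U r) < 0 := by
  have hode := hU.ode r hr hrR
  have hdd := hmax.deriv_deriv_nonpos hU.continuous.continuousAt
  rw [ODEAt, hmax.deriv_eq_zero] at hode
  have : 0 < q / r ^ 2 * U r := by positivity
  linarith

theorem le_sp (hU : IsExtendedSolution p q F sp R U) (hq : 0 < q) (hsp : 0 < sp)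
    (hF : CondF F sp) (r : ℝ) : U r ≤ sp := by
  by_contra! h
  obtain ⟨x, hx, hmax⟩ := exists_pos_forall_le_of_tendsto hU.continuous (x₀ := r)
    (fun y hy => by rw [hU.eq_zero y hy]; linarith) hU.tendsto h
  have hxsp : sp < U x := h.trans_le (hmax r)
  have hxR : ENNReal.ofReal x < R := by
    by_contra! hR
    exact hxsp.ne' (hU.eq_sp x hx hR)
  have hneg := hU.nonlinearity_neg_of_isLocalMax hq hx hxR (Eventually.of_forall hmax)
    (hsp.trans hxsp)
  exact lt_asymm hneg (hF.2.2.2.2.1 _ hxsp)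

theorem lt_sp (hU : IsExtendedSolution p q F sp R U) (hq : 0 < q) (hsp : 0 < sp)
    (hF : CondF F sp) {r : ℝ} (hr : 0 < r) (hrR : ENNReal.ofReal r < R) : U r < sp := by
  refine (hU.le_sp hq hsp hF r).lt_of_ne fun h => ?_
  have hneg := hU.nonlinearity_neg_of_isLocalMax hq hr hrR
    (Eventually.of_forall fun y => h ▸ hU.le_sp hq hsp hF y) (h ▸ hsp)
  rw [h, hF.2.2.1] at hneg
  exact lt_irrefl _ hneg

/-- Forward uniqueness for the zero solution. -/
theorem eq_zero_of_eq_zero_of_deriv_eq_zero (hU : IsExtendedSolution p q F sp R U)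
    (hp : 0 ≤ p) (hq : 0 < q) (hsp : 0 < sp) (hF : CondF F sp) {a b : ℝ} (ha : 0 < a)
    (hab : a ≤ b) (hbR : ENNReal.ofReal b < R) (h0 : U a = 0) (h1 : deriv U a = 0) :
    U b = 0 := by
  obtain ⟨K, hK, hlip⟩ := hF.exists_lipschitz
  have hdom : ∀ x ∈ Icc a b, 0 < x ∧ ENNReal.ofReal x < R := fun x hx =>
    ⟨ha.trans_le hx.1, (ENNReal.ofReal_le_ofReal hx.2).trans_lt hbR⟩
  set C := 1 + q / a ^ 2 + K with hC
  have hderiv : ∀ x ∈ Icc a b,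
      HasDerivAt (fun x => Real.exp (-(C * x)) * (U x ^ 2 + deriv U x ^ 2))
        (Real.exp (-(C * x)) * (2 * U x * deriv U x + 2 * deriv U x * deriv (deriv U) x
          - C * (U x ^ 2 + deriv U x ^ 2))) x := fun x hx => by
    obtain ⟨hx0, hxR⟩ := hdom x hx
    have he : HasDerivAt (fun x => Real.exp (-(C * x))) (Real.exp (-(C * x)) * -(C * 1)) x :=
      (((hasDerivAt_id x).const_mul C).neg).exp
    refine (he.mul (((hU.hasDerivAt hx0 hxR).pow 2).add
      ((hU.hasDerivAt_deriv hx0 hxR).pow 2))).congr_deriv ?_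
    simp
    ring
  have hanti : AntitoneOn (fun x => Real.exp (-(C * x)) * (U x ^ 2 + deriv U x ^ 2))
      (Icc a b) := by
    refine antitoneOn_of_deriv_nonpos (convex_Icc a b)
      (fun x hx => (hderiv x hx).continuousAt.continuousWithinAt)
      (fun x hx => (hderiv x (interior_subset hx)).differentiableAt.differentiableWithinAt)
      fun x hx => ?_
    replace hx := interior_subset hx
    rw [(hderiv x hx).deriv]
    refine mul_nonpos_of_nonneg_of_nonpos (Real.exp_pos _).le ?_
    obtain ⟨hx0, hxR⟩ := hdom x hx
    have hode := hU.ode x hx0 hxR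
    rw [ODEAt] at hode
    have hFU : |F (U x)| ≤ K * |U x| := by
      simpa [hF.2.1] using hlip (U x) ⟨hU.nonneg x, hU.le_sp hq hsp hF x⟩ 0 ⟨le_rfl, hsp.le⟩
    have hqx : q / x ^ 2 ≤ q / a ^ 2 := by
      have := hx.1
      gcongr
    have hq0 : 0 ≤ q / x ^ 2 := by positivity
    have hpx : 0 ≤ p / x * deriv U x ^ 2 := by positivity
    have hcross : 2 * deriv U x * F (U x) ≤ K * (U x ^ 2 + deriv U x ^ 2) := by
      calc 2 * deriv U x * F (U x) ≤ |2 * deriv U x * F (U x)| := le_abs_self _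
        _ = 2 * |deriv U x| * |F (U x)| := by rw [abs_mul, abs_mul, abs_two]
        _ ≤ 2 * |deriv U x| * (K * |U x|) := by gcongr
        _ = K * (2 * |U x| * |deriv U x|) := by ring
        _ ≤ K * (|U x| ^ 2 + |deriv U x| ^ 2) := by
          gcongr
          exact two_mul_le_add_sq _ _
        _ = K * (U x ^ 2 + deriv U x ^ 2) := by rw [sq_abs, sq_abs]
    have hlin : (1 + q / x ^ 2) * (2 * U x * deriv U x)
        ≤ (1 + q / a ^ 2) * (U x ^ 2 + deriv U x ^ 2) :=
      (mul_le_mul_of_nonneg_left (two_mul_le_add_sq _ _) (by positivity)).trans (by gcongr)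
    have hdd : deriv (deriv U) x
        = F (U x) - p / x * deriv U x + q / x ^ 2 * U x := by linarith
    rw [hdd, hC]
    linarith
  have hle := hanti (left_mem_Icc.2 hab) (right_mem_Icc.2 hab) hab
  simp only [h0, h1] at hle
  have hsum : U b ^ 2 + deriv U b ^ 2 ≤ 0 := by
    have := Real.exp_pos (-(C * b))
    by_contra! hpos
    have := mul_pos this hpos
    norm_num at hle
    linarith
  nlinarith [sq_nonneg (U b), sq_nonneg (deriv U b)]

theorem pos (hU : IsExtendedSolution p q F sp R U) (hp : 0 ≤ p) (hq : 0 < q) (hsp : 0 < sp)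
    (hF : CondF F sp) {r : ℝ} (hr : 0 < r) : 0 < U r := by
  refine (hU.nonneg r).lt_of_ne' fun h => ?_
  have hmin : IsLocalMin U r := Eventually.of_forall fun y => h ▸ hU.nonneg y
  obtain ⟨y, hy, hry⟩ := ((hU.tendsto.eventually_const_lt (half_lt_self hsp)).and
    (eventually_ge_atTop r)).exists
  obtain ⟨b, hb, hbU⟩ := intermediate_value_Icc hry hU.continuous.continuousOn
    (show sp / 2 ∈ Icc (U r) (U y) from ⟨by rw [h]; positivity, hy.le⟩)
  have hbR := hU.lt_of_lt_sp (hr.trans_le hb.1) (by linarith)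
  have := hU.eq_zero_of_eq_zero_of_deriv_eq_zero hp hq hsp hF hr hb.1 hbR h hmin.deriv_eq_zero
  linarith

/-- The second-order condition at a local maximum of the difference between a solution and a
dilated solution. -/
theorem isLocalMax_sub_dilation (hU₁ : IsExtendedSolution p q F sp R U₁)
    (hU₂ : IsExtendedSolution p q F sp R U₂) {c r : ℝ} (hc : 0 < c) (hr : 0 < r)
    (hrR : ENNReal.ofReal r < R) (hcrR : ENNReal.ofReal (c * r) < R)
    (hmax : IsLocalMax (fun x => U₂ x - U₁ (c * x)) r) :
    q / r ^ 2 * (U₂ r - U₁ (c * r)) + F (U₂ r) - c ^ 2 * F (U₁ (c * r)) ≤ 0 := by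
  have hcr : 0 < c * r := mul_pos hc hr
  have hdd := hmax.deriv_deriv_nonpos
    (hU₂.continuous.sub (hU₁.continuous.comp (by fun_prop))).continuousAt
  have hd0 := hmax.deriv_eq_zero
  have hdom : IsOpen {x : ℝ | ENNReal.ofReal x < R} :=
    isOpen_Iio.preimage ENNReal.continuous_ofReal
  have hderiv : ∀ x, 0 < x → ENNReal.ofReal x < R → ENNReal.ofReal (c * x) < R →
      deriv (fun x => U₂ x - U₁ (c * x)) x = deriv U₂ x - c * deriv U₁ (c * x) :=
    fun x hx hxR hcxR => by
      have h₁ := (hU₁.hasDerivAt (mul_pos hc hx) hcxR).comp x ((hasDerivAt_id x).const_mul c)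
      have := ((hU₂.hasDerivAt hx hxR).sub h₁).deriv
      simp only [mul_one] at this
      rw [mul_comm c]
      exact this
  have hev : deriv (fun x => U₂ x - U₁ (c * x))
      =ᶠ[𝓝 r] fun x => deriv U₂ x - c * deriv U₁ (c * x) := by
    have hcdom : ∀ᶠ x in 𝓝 r, ENNReal.ofReal (c * x) < R :=
      (continuous_const_mul c).continuousAt.eventually (hdom.mem_nhds hcrR)
    filter_upwards [lt_mem_nhds hr, hdom.mem_nhds hrR, hcdom] with x hx hxR hcxR
      using hderiv x hx hxR hcxR
  have h₁ := ((hU₁.hasDerivAt_deriv hcr hcrR).comp r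
    ((hasDerivAt_id r).const_mul c)).const_mul c
  have h₂ := ((hU₂.hasDerivAt_deriv hr hrR).sub h₁).deriv
  rw [hev.deriv_eq] at hdd
  replace hdd : deriv (deriv U₂) r - c * (deriv (deriv U₁) (c * r) * (c * 1)) ≤ 0 :=
    h₂.symm.trans_le hdd
  rw [hderiv r hr hrR hcrR] at hd0
  have ode₁ := hU₁.ode (c * r) hcr hcrR
  have ode₂ := hU₂.ode r hr hrR
  rw [ODEAt] at ode₁ ode₂
  have ode₁' : c ^ 2 * deriv (deriv U₁) (c * r) + p / r * (c * deriv U₁ (c * r))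
      - q / r ^ 2 * U₁ (c * r) = c ^ 2 * F (U₁ (c * r)) := by
    rw [← ode₁]
    field_simp
  have hp : p / r * deriv U₂ r = p / r * (c * deriv U₁ (c * r)) := by
    rw [sub_eq_zero.1 hd0]
  linarith

/-- If a solution exceeds a dilated solution anywhere, it does so inside a compact region of radii
which does not depend on the dilation factor. -/
theorem exists_radii_of_dilation_lt (hU₁ : IsExtendedSolution p q F sp R U₁)
    (hU₂ : IsExtendedSolution p q F sp R U₂) (hp : 0 ≤ p) (hq : 0 < q) (hsp : 0 < sp)
    (hF : CondF F sp) :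
    ∃ a < sp, ∃ r₀ > 0, ∃ r₁, ∀ c > 1, (∃ x, U₁ (c * x) < U₂ x) →
      ∃ r, r₀ ≤ r ∧ c * r ≤ r₁ ∧ U₁ (c * r) ≤ a ∧ U₁ (c * r) ≤ U₂ r := by
  obtain ⟨K, hK, hlip⟩ := hF.exists_lipschitz
  obtain ⟨a, ha, hmono⟩ := hF.exists_strictMonoOn
  obtain ⟨r₁, hr₁⟩ := eventually_atTop.1 (hU₁.tendsto.eventually_const_lt ha)
  refine ⟨a, ha, Real.sqrt (q / K), Real.sqrt_pos.2 (by positivity), r₁, ?_⟩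
  rintro c hc ⟨x₀, hx₀⟩
  have hc0 : 0 < c := one_pos.trans hc
  have hcont : Continuous fun x => U₂ x - U₁ (c * x) :=
    hU₂.continuous.sub (hU₁.continuous.comp (by fun_prop))
  have hlim : Tendsto (fun x => U₂ x - U₁ (c * x)) atTop (𝓝 (sp - sp)) :=
    hU₂.tendsto.sub (hU₁.tendsto.comp (tendsto_id.const_mul_atTop hc0))
  obtain ⟨r, hr, hmax⟩ := exists_pos_forall_le_of_tendsto hcont (x₀ := x₀)
    (fun y hy => by
      rw [hU₂.eq_zero y hy, hU₁.eq_zero _ (mul_nonpos_of_nonneg_of_nonpos hc0.le hy)]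
      linarith)
    hlim (by linarith)
  have hlt : U₁ (c * r) < U₂ r := by
    have : U₂ x₀ - U₁ (c * x₀) ≤ U₂ r - U₁ (c * r) := hmax x₀
    linarith
  have hcr : 0 < c * r := mul_pos hc0 hr
  have hle₂ := hU₂.le_sp hq hsp hF r
  have hcrR := hU₁.lt_of_lt_sp hcr (hlt.trans_le hle₂)
  have hrR : ENNReal.ofReal r < R :=
    (ENNReal.ofReal_le_ofReal (by nlinarith)).trans_lt hcrR
  have hkey := isLocalMax_sub_dilation hU₁ hU₂ hc0 hr hrR hcrR (Eventually.of_forall hmax)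
  have hF₁ : F (U₁ (c * r)) < 0 :=
    hF.2.2.2.1 _ ⟨hU₁.pos hp hq hsp hF hcr, hlt.trans_le hle₂⟩
  have hgap : q / r ^ 2 * (U₂ r - U₁ (c * r)) ≤ F (U₁ (c * r)) - F (U₂ r) := by
    have : c ^ 2 * F (U₁ (c * r)) ≤ 1 * F (U₁ (c * r)) :=
      mul_le_mul_of_nonpos_right (one_le_pow₀ hc.le) hF₁.le
    linarith
  have hd : 0 < U₂ r - U₁ (c * r) := sub_pos.2 hlt
  have hgap0 : 0 < q / r ^ 2 * (U₂ r - U₁ (c * r)) := by positivity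
  have ha₁ : U₁ (c * r) ≤ a := by
    by_contra! h
    have := hmono ⟨h.le, (hlt.trans_le hle₂).le⟩ ⟨(h.trans hlt).le, hle₂⟩ hlt
    linarith
  refine ⟨r, ?_, ?_, ha₁, hlt.le⟩
  · have h := hlip (U₁ (c * r)) ⟨hU₁.nonneg _, hU₁.le_sp hq hsp hF _⟩ (U₂ r)
      ⟨hU₂.nonneg _, hle₂⟩
    rw [abs_sub_comm (U₁ _), abs_of_pos hd] at h
    have hqK : q / r ^ 2 ≤ K :=
      le_of_mul_le_mul_right (hgap.trans ((le_abs_self _).trans h)) hd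
    refine Real.sqrt_le_iff.2 ⟨hr.le, ?_⟩
    rw [div_le_iff₀ (by positivity)] at hqK ⊢
    linarith
  · by_contra! h
    exact absurd (hr₁ _ h.le) (not_lt.2 ha₁)

theorem le_dilation (hU₁ : IsExtendedSolution p q F sp R U₁)
    (hU₂ : IsExtendedSolution p q F sp R U₂) (hp : 0 ≤ p) (hq : 0 < q) (hsp : 0 < sp)
    (hF : CondF F sp) {c : ℝ} (hc : 1 < c) (x : ℝ) : U₂ x ≤ U₁ (c * x) := by
  obtain ⟨a, ha, r₀, hr₀, r₁, hradii⟩ := exists_radii_of_dilation_lt hU₁ hU₂ hp hq hsp hF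
  by_contra! hlt
  let S : Set (ℝ × ℝ) := (Icc c (r₁ / r₀) ×ˢ Icc r₀ r₁) ∩
    {z | U₁ (z.1 * z.2) ≤ a ∧ U₁ (z.1 * z.2) ≤ U₂ z.2}
  have hmem : ∀ c' ≥ c, (∃ x, U₁ (c' * x) < U₂ x) → ∃ r, (c', r) ∈ S := by
    intro c' hc' hx
    obtain ⟨r, hr, hcr, h₁, h₂⟩ := hradii c' (hc.trans_le hc') hx
    refine ⟨r, ⟨⟨⟨hc', ?_⟩, hr, ?_⟩, h₁, h₂⟩⟩
    · rw [le_div_iff₀ hr₀]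
      exact (mul_le_mul_of_nonneg_left hr (by linarith)).trans hcr
    · exact le_trans (le_mul_of_one_le_left (by linarith) (by linarith)) hcr
  have hcompact : IsCompact S := by
    refine (isCompact_Icc.prod isCompact_Icc).inter_right ?_
    have h₁ : Continuous fun z : ℝ × ℝ => U₁ (z.1 * z.2) := hU₁.continuous.comp (by fun_prop)
    exact (isClosed_le h₁ continuous_const).inter
      (isClosed_le h₁ (hU₂.continuous.comp continuous_snd))
  obtain ⟨r', hr'⟩ := hmem c le_rfl ⟨x, hlt⟩
  obtain ⟨⟨m, r⟩, hmr, hmax⟩ := hcompact.exists_isMaxOn ⟨_, hr'⟩ continuous_fst.continuousOn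
  obtain ⟨⟨hm, hr⟩, hma, hmU⟩ := hmr
  replace hm : c ≤ m := hm.1
  replace hr : r₀ ≤ r := hr.1
  replace hma : U₁ (m * r) ≤ a := hma
  replace hmU : U₁ (m * r) ≤ U₂ r := hmU
  have habove : ∀ c' > m, ∀ y, U₂ y ≤ U₁ (c' * y) := by
    intro c' hc' y
    by_contra! hy
    obtain ⟨s, hs⟩ := hmem c' (hm.trans hc'.le) ⟨y, hy⟩
    exact absurd (hmax hs) (not_le.2 hc')
  have hle : ∀ y, U₂ y ≤ U₁ (m * y) := fun y => by
    have hcont : Continuous fun c' => U₁ (c' * y) := hU₁.continuous.comp (by fun_prop)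
    have hlim : Tendsto (fun c' => U₁ (c' * y)) (𝓝[>] m) (𝓝 (U₁ (m * y))) :=
      (hcont.tendsto m).mono_left nhdsWithin_le_nhds
    exact ge_of_tendsto hlim (eventually_mem_nhdsWithin.mono fun c' hc' => habove c' hc' y)
  have heq : U₂ r = U₁ (m * r) := le_antisymm (hle r) hmU
  have hm1 : 1 < m := hc.trans_le hm
  have hr0 : 0 < r := hr₀.trans_le hr
  have hmr0 : 0 < m * r := by positivity
  have hmrR := hU₁.lt_of_lt_sp hmr0 (hma.trans_lt ha)
  have hrR := hU₂.lt_of_lt_sp hr0 (heq ▸ hma.trans_lt ha)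
  have hkey := isLocalMax_sub_dilation hU₁ hU₂ (one_pos.trans hm1) hr0 hrR hmrR
    (Eventually.of_forall fun y => by
      have := hle y
      simp only [heq]
      linarith)
  have hneg : F (U₁ (m * r)) < 0 :=
    hF.2.2.2.1 _ ⟨hU₁.pos hp hq hsp hF hmr0, hma.trans_lt ha⟩
  have : m ^ 2 * F (U₁ (m * r)) < 1 * F (U₁ (m * r)) :=
    mul_lt_mul_of_neg_right (one_lt_pow₀ hm1 two_ne_zero) hneg
  rw [heq, sub_self, mul_zero, zero_add] at hkey
  linarith

theorem le (hU₁ : IsExtendedSolution p q F sp R U₁) (hU₂ : IsExtendedSolution p q F sp R U₂)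
    (hp : 0 ≤ p) (hq : 0 < q) (hsp : 0 < sp) (hF : CondF F sp) (x : ℝ) : U₂ x ≤ U₁ x := by
  have hcont : Continuous fun c => U₁ (c * x) := hU₁.continuous.comp (by fun_prop)
  have hlim : Tendsto (fun c => U₁ (c * x)) (𝓝[>] 1) (𝓝 (U₁ x)) := by
    simpa using (hcont.tendsto 1).mono_left nhdsWithin_le_nhds
  exact ge_of_tendsto hlim (eventually_mem_nhdsWithin.mono fun c hc =>
    le_dilation hU₁ hU₂ hp hq hsp hF hc x)

end IsExtendedSolution

/-- the BVP (⋆)&(BC) on `(0,R)` has at most one non-negative solution. -/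
theorem stmt10 (p q sp : ℝ) (hp : 0 ≤ p) (hq : 0 < q) (hsp : 0 < sp)
    (F : ℝ → ℝ) (hF : CondF F sp)
    (R : ℝ≥0∞) (hR : 0 < R) (u₁ u₂ : ℝ → ℝ)
    (hu₁ : IsBVPSolution p q F sp R u₁) (hu₂ : IsBVPSolution p q F sp R u₂)
    (hnn₁ : ∀ r : ℝ, 0 < r → ENNReal.ofReal r < R → 0 ≤ u₁ r)
    (hnn₂ : ∀ r : ℝ, 0 < r → ENNReal.ofReal r < R → 0 ≤ u₂ r) :
    ∀ r : ℝ, 0 ≤ r → ENNReal.ofReal r < R → u₁ r = u₂ r := by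
  obtain ⟨U₁, hU₁, h₁⟩ := hu₁.exists_isExtendedSolution hR hsp hnn₁
  obtain ⟨U₂, hU₂, h₂⟩ := hu₂.exists_isExtendedSolution hR hsp hnn₂
  intro r hr hrR
  rw [← h₁ r hr hrR, ← h₂ r hr hrR]
  exact le_antisymm (hU₂.le hU₁ hp hq hsp hF r) (hU₁.le hU₂ hp hq hsp hF r)
end

section
/- Main theorem (existence and uniqueness): For every 0 < R ≤ ∞, the boundary-value problem (⋆)&(BC) on (0,R) admits exactly one solution u with u ≥ 0 on (0,R); moreover this solution satisfies 0 < u(r) < s_+ for all r ∈ (0,R) and u is strictly increasing on (0,R). -/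
open Set Filter Topology MeasureTheory
open scoped ENNReal NNReal

section Calculus

lemma IsLocalMin.deriv_deriv_nonneg_s12 {w : ℝ → ℝ} {t c : ℝ} (hmin : IsLocalMin w t)
    (hc : ContinuousAt w t) (h2 : HasDerivAt (deriv w) c t) : deriv w t = 0 ∧ 0 ≤ c := by
  refine ⟨hmin.deriv_eq_zero, ?_⟩
  by_contra! hneg
  have hmax : IsLocalMax w t :=
    isLocalMax_of_deriv_deriv_neg (by rwa [h2.deriv]) hmin.deriv_eq_zero hc
  have hconst : w =ᶠ[𝓝 t] fun _ => w t := by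
    filter_upwards [hmin, hmax] with x h₁ h₂ using le_antisymm h₂ h₁
  have h0 : HasDerivAt (deriv w) 0 t :=
    (hasDerivAt_const t (0 : ℝ)).congr_of_eventuallyEq (by simpa using hconst.deriv)
  exact hneg.ne (h2.unique h0)

lemma deriv_eq_and_le_of_isLocalMin_sub {f g : ℝ → ℝ} {t A B : ℝ}
    (hf : ∀ᶠ x in 𝓝 t, DifferentiableAt ℝ f x) (hg : ∀ᶠ x in 𝓝 t, DifferentiableAt ℝ g x)
    (hf2 : HasDerivAt (deriv f) A t) (hg2 : HasDerivAt (deriv g) B t)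
    (hmin : IsLocalMin (fun x => f x - g x) t) : deriv f t = deriv g t ∧ B ≤ A := by
  have hd : deriv (fun x => f x - g x) =ᶠ[𝓝 t] fun x => deriv f x - deriv g x := by
    filter_upwards [hf, hg] with x h₁ h₂ using deriv_fun_sub h₁ h₂
  have h := IsLocalMin.deriv_deriv_nonneg_s12 hmin
    (hf.self_of_nhds.continuousAt.sub hg.self_of_nhds.continuousAt)
    ((hf2.fun_sub hg2).congr_of_eventuallyEq hd)
  rw [hd.self_of_nhds] at h
  exact ⟨sub_eq_zero.1 h.1, sub_nonneg.1 h.2⟩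

lemma exists_isLocalMin_of_lt {w : ℝ → ℝ} {c t d : ℝ} (hw : ContinuousOn w (Icc c d))
    (hct : c < t) (htd : t < d) (hc : w t < w c) (hd : w t < w d) :
    ∃ x ∈ Ioo c d, w x ≤ w t ∧ IsLocalMin w x := by
  obtain ⟨x, hx, hmin⟩ := isCompact_Icc.exists_isMinOn ⟨t, hct.le, htd.le⟩ hw
  have hxt : w x ≤ w t := hmin ⟨hct.le, htd.le⟩
  have hxc : c ≠ x := by rintro rfl; linarith
  have hxd : x ≠ d := by rintro rfl; linarith
  have hxI : x ∈ Ioo c d := ⟨lt_of_le_of_ne hx.1 hxc, lt_of_le_of_ne hx.2 hxd⟩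
  exact ⟨x, hxI, hxt, hmin.isLocalMin (Icc_mem_nhds hxI.1 hxI.2)⟩

lemma CondF.lipschitz {F : ℝ → ℝ} {sp : ℝ} (hF : CondF F sp) :
    ∃ K > 0, ∀ x ∈ Icc 0 sp, ∀ y ∈ Icc 0 sp, |F x - F y| ≤ K * |x - y| := by
  have hd : Continuous (deriv F) := hF.1.continuous_deriv le_rfl
  obtain ⟨K, hK⟩ := isCompact_Icc.exists_bound_of_continuousOn (s := Icc 0 sp) hd.continuousOn
  refine ⟨max K 1, by positivity, fun x hx y hy => ?_⟩
  simpa using Convex.norm_image_sub_le_of_norm_deriv_le (C := max K 1)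
    (fun z _ => (hF.1.differentiable one_ne_zero) z)
    (fun z hz => (hK z hz).trans (le_max_left _ _)) (convex_Icc 0 sp) hy hx

lemma CondF.exists_monotoneOn {F : ℝ → ℝ} {sp : ℝ} (hF : CondF F sp) :
    ∃ ε > 0, MonotoneOn F (Icc (sp - ε) sp) := by
  have hd : Continuous (deriv F) := hF.1.continuous_deriv le_rfl
  obtain ⟨δ, hδ, hball⟩ := Metric.eventually_nhds_iff.1
    (hd.continuousAt.eventually (lt_mem_nhds hF.2.2.2.2.2))
  refine ⟨δ / 2, by positivity, monotoneOn_of_deriv_nonneg (convex_Icc _ _)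
    hF.1.continuous.continuousOn (hF.1.differentiable one_ne_zero).differentiableOn ?_⟩
  intro x hx
  rw [interior_Icc] at hx
  refine (hball ?_).le
  rw [Real.dist_eq, abs_lt]
  constructor <;> linarith [hx.1, hx.2]

lemma CondF.nonpos {F : ℝ → ℝ} {sp : ℝ} (hF : CondF F sp) {x : ℝ} (h0 : 0 ≤ x) (h1 : x ≤ sp) :
    F x ≤ 0 := by
  rcases h0.eq_or_lt with rfl | h0
  · exact hF.2.1.le
  rcases h1.eq_or_lt with rfl | h1
  · exact hF.2.2.1.le
  exact (hF.2.2.2.1 x ⟨h0, h1⟩).le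

end Calculus

section Profiles

/-- `y` solves, at the point `t`, the equation `y'' + a y' - q y = e^{2t} F(y)`, which is (⋆) with
`a = p - 1` in the logarithmic variable `t = log r`. -/
def IsLogSolAt (a q : ℝ) (F y : ℝ → ℝ) (t : ℝ) : Prop :=
  (∀ᶠ x in 𝓝 t, DifferentiableAt ℝ y x) ∧
    HasDerivAt (deriv y) (q * y t - a * deriv y t + Real.exp (2 * t) * F (y t)) t

/-- A non-negative function on the line that solves the logarithmic equation on `D`, is constantly
`sp` off `D`, and tends to `0` at `-∞` and to `sp` at `+∞`. -/
structure IsProfile (a q sp : ℝ) (F : ℝ → ℝ) (D : Set ℝ) (y : ℝ → ℝ) : Prop where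
  continuous : Continuous y
  nonneg : ∀ t, 0 ≤ y t
  tendsto_atBot : Tendsto y atBot (𝓝 0)
  tendsto_atTop : Tendsto y atTop (𝓝 sp)
  eq_off : ∀ t ∉ D, y t = sp
  isLogSolAt : ∀ t ∈ D, IsLogSolAt a q F y t

variable {a q sp : ℝ} {F y v : ℝ → ℝ} {D E : Set ℝ}

lemma IsProfile.le (hy : IsProfile a q sp F D y) (hF : CondF F sp) (hsp : 0 < sp) (hq : 0 < q)
    (t : ℝ) : y t ≤ sp := by
  by_contra! ht
  obtain ⟨c, hc, hct⟩ := ((hy.tendsto_atBot.eventually (gt_mem_nhds (hsp.trans ht))).and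
    (eventually_lt_atBot t)).exists
  obtain ⟨d, hd, htd⟩ := ((hy.tendsto_atTop.eventually (gt_mem_nhds ht)).and
    (eventually_gt_atTop t)).exists
  obtain ⟨x, -, hxt, hmin⟩ := exists_isLocalMin_of_lt (w := fun x => 0 - y x)
    (continuous_const.sub hy.continuous).continuousOn hct htd (by linarith) (by linarith)
  have hx : sp < y x := by linarith
  have hxD : x ∈ D := by
    by_contra h
    exact hx.ne' (hy.eq_off x h)
  obtain ⟨h1, h2⟩ := hy.isLogSolAt x hxD
  obtain ⟨h3, h4⟩ := deriv_eq_and_le_of_isLocalMin_sub (f := fun _ => 0) (A := 0) (by simp) h1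
    (by simpa using hasDerivAt_const x (0 : ℝ)) h2 hmin
  rw [← h3] at h4
  have := mul_pos (Real.exp_pos (2 * x)) (hF.2.2.2.2.1 _ hx)
  have := mul_pos hq (hsp.trans hx)
  simp at h4
  linarith

lemma IsProfile.lt_of_mem (hy : IsProfile a q sp F D y) (hF : CondF F sp) (hsp : 0 < sp)
    (hq : 0 < q) {t : ℝ} (ht : t ∈ D) : y t < sp := by
  refine lt_of_le_of_ne (hy.le hF hsp hq t) fun heq => ?_
  have hmin : IsLocalMin (fun x => 0 - y x) t :=
    Eventually.of_forall fun x => by simpa [heq] using hy.le hF hsp hq x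
  obtain ⟨h1, h2⟩ := hy.isLogSolAt t ht
  obtain ⟨h3, h4⟩ := deriv_eq_and_le_of_isLocalMin_sub (f := fun _ => 0) (A := 0) (by simp) h1
    (by simpa using hasDerivAt_const t (0 : ℝ)) h2 hmin
  rw [← h3, heq, hF.2.2.1] at h4
  have := mul_pos hq hsp
  simp at h4
  linarith

lemma IsProfile.mem_iff (hy : IsProfile a q sp F D y) (hF : CondF F sp) (hsp : 0 < sp)
    (hq : 0 < q) {t : ℝ} : t ∈ D ↔ y t < sp :=
  ⟨hy.lt_of_mem hF hsp hq, fun h => by_contra fun hD => h.ne (hy.eq_off t hD)⟩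

lemma IsProfile.pos (hy : IsProfile a q sp F D y) (hF : CondF F sp) (hsp : 0 < sp) (hq : 0 < q)
    (t : ℝ) : 0 < y t := by
  refine lt_of_le_of_ne (hy.nonneg t) fun heq => ?_
  obtain ⟨d, hd, htd⟩ := ((hy.tendsto_atTop.eventually (lt_mem_nhds hsp)).and
    (eventually_gt_atTop t)).exists
  obtain ⟨k, hk, hk0⟩ : ∃ k : ℝ, 0 < k ^ 2 + a * k - q ∧ 0 < k := by
    refine ⟨|a| + q + 1, ?_, by positivity⟩
    nlinarith [neg_abs_le a, abs_nonneg a]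
  obtain ⟨δ, hδ, hδd⟩ : ∃ δ > 0, δ * (Real.exp (k * d) - Real.exp (k * (t - 1))) < y d := by
    have hX : 0 < Real.exp (k * d) - Real.exp (k * (t - 1)) :=
      sub_pos.2 (Real.exp_lt_exp.2 (by nlinarith))
    refine ⟨y d / 2 / (Real.exp (k * d) - Real.exp (k * (t - 1))), by positivity, ?_⟩
    rw [div_mul_cancel₀ _ hX.ne']
    linarith
  set C := Real.exp (k * (t - 1)) with hC
  have hφ (x : ℝ) : HasDerivAt (fun x => δ * (Real.exp (k * x) - C))
      (δ * (Real.exp (k * x) * k)) x := by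
    have := (((hasDerivAt_id x).const_mul k).exp.sub_const C).const_mul δ
    simpa using this
  have hφd : deriv (fun x => δ * (Real.exp (k * x) - C)) =
      fun x => δ * (Real.exp (k * x) * k) := funext fun x => (hφ x).deriv
  have hφ2 (x : ℝ) : HasDerivAt (deriv fun x => δ * (Real.exp (k * x) - C))
      (δ * (Real.exp (k * x) * k * k)) x := by
    rw [hφd]
    have := ((((hasDerivAt_id x).const_mul k).exp).mul_const k).const_mul δ
    simpa using this
  have hCt : C < Real.exp (k * t) := Real.exp_lt_exp.2 (by nlinarith)
  have hneg : y t - δ * (Real.exp (k * t) - C) < 0 := by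
    rw [← heq]
    nlinarith
  obtain ⟨x, hx, hxt, hmin⟩ := exists_isLocalMin_of_lt (c := t - 1) (d := d) (t := t)
    (w := fun x => y x - δ * (Real.exp (k * x) - C))
    (hy.continuous.sub (by fun_prop)).continuousOn (by linarith) htd
    (by have := hy.nonneg (t - 1); linarith) (by linarith)
  have hxd : Real.exp (k * x) ≤ Real.exp (k * d) :=
    Real.exp_le_exp.2 (mul_le_mul_of_nonneg_left hx.2.le hk0.le)
  have hyx : y x < δ * (Real.exp (k * x) - C) := by linarith
  have hxD : x ∈ D := (hy.mem_iff hF hsp hq).2 <| by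
    have := hy.le hF hsp hq d
    have := mul_le_mul_of_nonneg_left hxd hδ.le
    linarith
  obtain ⟨h1, h2⟩ := hy.isLogSolAt x hxD
  obtain ⟨h3, h4⟩ := deriv_eq_and_le_of_isLocalMin_sub h1
    (Eventually.of_forall fun x => (hφ x).differentiableAt) h2 (hφ2 x) hmin
  rw [h3, hφd] at h4
  have hFx : Real.exp (2 * x) * F (y x) ≤ 0 :=
    mul_nonpos_of_nonneg_of_nonpos (Real.exp_pos _).le
      (hF.nonpos (hy.nonneg x) (hy.le hF hsp hq x))
  have e1 := mul_lt_mul_of_pos_left hyx hq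
  have e2 := mul_pos (mul_pos hδ (Real.exp_pos (k * x))) hk
  have e3 : 0 < q * (δ * C) := by positivity
  nlinarith

lemma IsLogSolAt.comp_add_const {t s : ℝ} (h : IsLogSolAt a q F y (t + s)) :
    (∀ᶠ x in 𝓝 t, DifferentiableAt ℝ (fun x => y (x + s)) x) ∧
      HasDerivAt (deriv fun x => y (x + s)) (q * y (t + s) - a * deriv (fun x => y (x + s)) t
        + Real.exp (2 * (t + s)) * F (y (t + s))) t := by
  have hd : (deriv fun x => y (x + s)) = fun x => deriv y (x + s) :=
    funext fun x => deriv_comp_add_const ..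
  refine ⟨?_, ?_⟩
  · have : Tendsto (fun x => x + s) (𝓝 t) (𝓝 (t + s)) :=
      (continuous_add_const s).continuousAt
    filter_upwards [this.eventually h.1] with x hx using differentiableAt_comp_add_const.2 hx
  · rw [hd]
    exact HasDerivAt.comp_add_const t s h.2

/-- At a local minimum of `y(· + s) - v`, where both functions solve the equation, the difference
of the two equations has a sign. -/
lemma IsLogSolAt.le_of_isLocalMin {t s : ℝ} (hy : IsLogSolAt a q F y (t + s))
    (hv : IsLogSolAt a q F v t) (hmin : IsLocalMin (fun x => y (x + s) - v x) t) :
    q * v t + Real.exp (2 * t) * F (v t) ≤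
      q * y (t + s) + Real.exp (2 * t) * (Real.exp (2 * s) * F (y (t + s))) := by
  obtain ⟨h1, h2⟩ := hy.comp_add_const
  obtain ⟨h3, h4⟩ := deriv_eq_and_le_of_isLocalMin_sub h1 hv.1 h2 hv.2 hmin
  rw [h3] at h4
  rw [← mul_assoc, ← Real.exp_add, ← mul_add]
  linarith

lemma IsProfile.isOpen (hy : IsProfile a q sp F D y) (hF : CondF F sp) (hsp : 0 < sp)
    (hq : 0 < q) : IsOpen D := by
  have : D = {t | y t < sp} := Set.ext fun t => hy.mem_iff hF hsp hq
  rw [this]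
  exact isOpen_lt hy.continuous continuous_const

lemma IsProfile.nonempty (hy : IsProfile a q sp F D y) (hsp : 0 < sp) : D.Nonempty := by
  obtain ⟨t, ht⟩ := (hy.tendsto_atBot.eventually (gt_mem_nhds hsp)).exists
  exact ⟨t, by_contra fun h => ht.ne (hy.eq_off t h)⟩

lemma IsProfile.exists_forall_ge (hy : IsProfile a q sp F D y) (hv : IsProfile a q sp F E v)
    (hDE : D ⊆ E) (hF : CondF F sp) (hsp : 0 < sp) (hq : 0 < q) {ε : ℝ} (hε : 0 < ε) :
    ∃ T ∈ E, ∀ t ≥ T, sp - ε ≤ v t ∧ sp - ε ≤ y t := by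
  have hε' : sp - ε < sp := by linarith
  by_cases hbdd : BddAbove E
  · have hT : sSup E ∉ E := fun h => by
      have hev : ∀ᶠ x in 𝓝[>] sSup E, x ∈ E :=
        mem_nhdsWithin_of_mem_nhds ((hv.isOpen hF hsp hq).mem_nhds h)
      obtain ⟨x, hx, hxE⟩ := (hev.and self_mem_nhdsWithin).exists
      exact (le_csSup hbdd hx).not_gt hxE
    have hnear : ∀ᶠ t in 𝓝 (sSup E), sp - ε < v t ∧ sp - ε < y t :=
      ((hv.continuous.continuousAt.eventually (lt_mem_nhds (by rwa [hv.eq_off _ hT]))).and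
        (hy.continuous.continuousAt.eventually
          (lt_mem_nhds (by rwa [hy.eq_off _ fun h => hT (hDE h)]))))
    obtain ⟨T, hT1, hT2⟩ := exists_Ioc_subset_of_mem_nhds hnear (exists_lt _)
    obtain ⟨x, hxE, hx⟩ := exists_lt_of_lt_csSup (hv.nonempty hsp) hT1
    refine ⟨x, hxE, fun t ht => ?_⟩
    rcases le_or_gt t (sSup E) with h | h
    · have := hT2 ⟨hx.trans_le ht, h⟩
      exact ⟨this.1.le, this.2.le⟩
    · have htE : t ∉ E := fun h' => (le_csSup hbdd h').not_gt h
      rw [hv.eq_off t htE, hy.eq_off t fun h => htE (hDE h)]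
      exact ⟨hε'.le, hε'.le⟩
  · obtain ⟨T, hT⟩ := eventually_atTop.1 ((hv.tendsto_atTop.eventually (lt_mem_nhds hε')).and
      (hy.tendsto_atTop.eventually (lt_mem_nhds hε')))
    obtain ⟨x, hxE, hx⟩ := not_bddAbove_iff.1 hbdd T
    refine ⟨x, hxE, fun t ht => ?_⟩
    have := hT t (hx.le.trans ht)
    exact ⟨this.1.le, this.2.le⟩

lemma IsProfile.not_isLocalMin_of_neg (hy : IsProfile a q sp F D y) (hv : IsProfile a q sp F E v)
    (hDE : D ⊆ E) (hD : IsLowerSet D) (hF : CondF F sp) (hsp : 0 < sp) (hq : 0 < q) {s x : ℝ}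
    (hs : 0 ≤ s) (hneg : y (x + s) < v x)
    (h : Real.exp (2 * x) * (F (y (x + s)) - F (v x)) < q * (v x - y (x + s))) :
    ¬ IsLocalMin (fun x => y (x + s) - v x) x := by
  intro hmin
  have hxD : x + s ∈ D := (hy.mem_iff hF hsp hq).2 (hneg.trans_le (hv.le hF hsp hq x))
  have hxE : x ∈ E := hDE (hD (by linarith) hxD)
  have key := (hy.isLogSolAt _ hxD).le_of_isLocalMin (hv.isLogSolAt _ hxE) hmin
  have h1 : Real.exp (2 * s) * F (y (x + s)) ≤ F (y (x + s)) := by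
    have := hF.nonpos (hy.nonneg (x + s)) (hy.le hF hsp hq _)
    have := Real.one_le_exp (show 0 ≤ 2 * s by linarith)
    nlinarith
  have := mul_le_mul_of_nonneg_left h1 (Real.exp_pos (2 * x)).le
  linarith

lemma IsProfile.lt_of_forall_le (hy : IsProfile a q sp F D y) (hv : IsProfile a q sp F E v)
    (hF : CondF F sp) (hsp : 0 < sp) (hq : 0 < q) {s : ℝ} (hs : 0 < s)
    (hle : ∀ t, v t ≤ y (t + s)) {t : ℝ} (ht : t ∈ E) : v t < y (t + s) := by
  refine lt_of_le_of_ne (hle t) fun heq => ?_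
  have hlt := hv.lt_of_mem hF hsp hq ht
  have hmin : IsLocalMin (fun x => y (x + s) - v x) t := Eventually.of_forall fun x => by
    simpa [heq] using hle x
  have key := (hy.isLogSolAt (t + s) ((hy.mem_iff hF hsp hq).2 (heq ▸ hlt))).le_of_isLocalMin
    (hv.isLogSolAt t ht) hmin
  rw [← heq] at key
  have hFv := hF.2.2.2.1 (v t) ⟨hv.pos hF hsp hq t, hlt⟩
  have h1 : Real.exp (2 * s) * F (v t) < F (v t) := by
    have := Real.one_lt_exp_iff.2 (show 0 < 2 * s by linarith)
    nlinarith
  have := mul_lt_mul_of_pos_left h1 (Real.exp_pos (2 * t))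
  linarith

/-- Ordering on a suitable compact interval propagates to the whole line. -/
lemma IsProfile.exists_interval (hy : IsProfile a q sp F D y) (hv : IsProfile a q sp F E v)
    (hDE : D ⊆ E) (hD : IsLowerSet D) (hF : CondF F sp) (hsp : 0 < sp) (hq : 0 < q) :
    ∃ T₀, ∃ T₁ ∈ E, ∀ s ≥ 0, (∀ t ∈ Icc T₀ T₁, v t ≤ y (t + s)) →
      ∀ t, v t ≤ y (t + s) := by
  obtain ⟨K, hK, hLip⟩ := hF.lipschitz
  obtain ⟨ε, hε, hmono⟩ := hF.exists_monotoneOn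
  obtain ⟨T₁, hT₁, hge⟩ := hy.exists_forall_ge hv hDE hF hsp hq hε
  obtain ⟨T₀, hT₀, hT₀₁⟩ : ∃ T₀, Real.exp (2 * T₀) * K < q ∧ T₀ < T₁ := by
    have : Tendsto (fun t : ℝ => Real.exp (2 * t) * K) atBot (𝓝 (0 * K)) :=
      (Real.tendsto_exp_atBot.comp (tendsto_id.const_mul_atBot two_pos)).mul_const K
    rw [zero_mul] at this
    exact ((this.eventually (gt_mem_nhds hq)).and (eventually_lt_atBot T₁)).exists
  have hcont (s : ℝ) : Continuous fun x => y (x + s) - v x :=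
    (hy.continuous.comp (continuous_add_const s)).sub hv.continuous
  refine ⟨T₀, T₁, hT₁, fun s hs hmid t => ?_⟩
  by_contra! hlt
  rcases lt_or_ge t T₀ with ht | ht
  · have hlim : Tendsto (fun x => y (x + s) - v x) atBot (𝓝 (0 - 0)) :=
      (hy.tendsto_atBot.comp (tendsto_atBot_add_const_right _ s tendsto_id)).sub
        hv.tendsto_atBot
    obtain ⟨c, hc, hct⟩ := ((hlim.eventually (lt_mem_nhds (show y (t + s) - v t < 0 - 0 by
      linarith))).and (eventually_lt_atBot t)).exists
    have := hmid T₀ ⟨le_rfl, hT₀₁.le⟩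
    obtain ⟨x, hx, hxt, hmin⟩ := exists_isLocalMin_of_lt (hcont s).continuousOn hct ht hc
      (by linarith)
    have hneg : y (x + s) < v x := by linarith
    refine hy.not_isLocalMin_of_neg hv hDE hD hF hsp hq hs hneg ?_ hmin
    have h1 := (le_abs_self _).trans (hLip _ ⟨hy.nonneg (x + s), hy.le hF hsp hq _⟩ _
      ⟨hv.nonneg x, hv.le hF hsp hq _⟩)
    rw [abs_sub_comm, abs_of_pos (sub_pos.2 hneg)] at h1
    have h2 : Real.exp (2 * x) * K < q := lt_of_le_of_lt (mul_le_mul_of_nonneg_right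
      (Real.exp_le_exp.2 (by linarith [hx.2])) hK.le) hT₀
    calc _ ≤ Real.exp (2 * x) * (K * (v x - y (x + s))) :=
          mul_le_mul_of_nonneg_left h1 (Real.exp_pos _).le
      _ = Real.exp (2 * x) * K * (v x - y (x + s)) := by ring
      _ < _ := mul_lt_mul_of_pos_right h2 (sub_pos.2 hneg)
  · have ht' : T₁ < t := by
      by_contra! h
      exact (hmid t ⟨ht, h⟩).not_gt hlt
    have hlim : Tendsto (fun x => y (x + s) - v x) atTop (𝓝 (sp - sp)) :=
      (hy.tendsto_atTop.comp (tendsto_atTop_add_const_right _ s tendsto_id)).sub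
        hv.tendsto_atTop
    obtain ⟨d, hd, htd⟩ := ((hlim.eventually (lt_mem_nhds (show y (t + s) - v t < sp - sp by
      linarith))).and (eventually_gt_atTop t)).exists
    have := hmid T₁ ⟨hT₀₁.le, le_rfl⟩
    obtain ⟨x, hx, hxt, hmin⟩ := exists_isLocalMin_of_lt (hcont s).continuousOn ht' htd
      (by linarith) hd
    have hneg : y (x + s) < v x := by linarith
    refine hy.not_isLocalMin_of_neg hv hDE hD hF hsp hq hs hneg ?_ hmin
    have h1 := hmono ⟨(hge (x + s) (by linarith [hx.1])).2, hy.le hF hsp hq _⟩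
      ⟨(hge x hx.1.le).1, hv.le hF hsp hq _⟩ hneg.le
    have := mul_nonpos_of_nonneg_of_nonpos (Real.exp_pos (2 * x)).le (sub_nonpos.2 h1)
    have := mul_pos hq (sub_pos.2 hneg)
    linarith

/-- The sliding method: in the logarithmic variable every translate `y(· + s)` with `s > 0` of a
profile lies above every profile on a larger set. -/
theorem IsProfile.le_translate (hy : IsProfile a q sp F D y) (hv : IsProfile a q sp F E v)
    (hDE : D ⊆ E) (hD : IsLowerSet D) (hE : IsLowerSet E) (hF : CondF F sp) (hsp : 0 < sp)
    (hq : 0 < q) {s : ℝ} (hs : 0 < s) (t : ℝ) : v t ≤ y (t + s) := by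
  obtain ⟨T₀, T₁, hT₁, hall⟩ := hy.exists_interval hv hDE hD hF hsp hq
  set U : Set ℝ := {s | ∀ t ∈ Icc T₀ T₁, v t < y (t + s)} with hU
  have hlt (t : ℝ) (ht : t ∈ Icc T₀ T₁) : t ∈ E := hE ht.2 hT₁
  have hUo : IsOpen U := isOpen_iff_mem_nhds.2 fun s hs =>
    isCompact_Icc.eventually_forall_of_forall_eventually fun t ht =>
      ((hv.continuous.comp continuous_snd).continuousAt).eventually_lt
        ((hy.continuous.comp (continuous_snd.add continuous_fst)).continuousAt) (hs t ht)
  have hne : (Ioi 0 ∩ U).Nonempty := by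
    obtain ⟨δ, hδ, hvδ⟩ : ∃ δ > 0, ∀ t ∈ Icc T₀ T₁, v t < sp - δ := by
      rcases (Icc T₀ T₁).eq_empty_or_nonempty with h | h
      · exact ⟨1, one_pos, by simp [h]⟩
      obtain ⟨x, hx, hmax⟩ := isCompact_Icc.exists_isMaxOn h hv.continuous.continuousOn
      have := hv.lt_of_mem hF hsp hq (hlt x hx)
      refine ⟨(sp - v x) / 2, by linarith, fun t ht => ?_⟩
      have : v t ≤ v x := hmax ht
      linarith
    obtain ⟨T, hT⟩ := eventually_atTop.1 (hy.tendsto_atTop.eventually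
      (lt_mem_nhds (show sp - δ < sp by linarith)))
    refine ⟨max 1 (T - T₀), mem_Ioi.2 (lt_max_of_lt_left one_pos), fun t ht => ?_⟩
    have := hT (t + max 1 (T - T₀)) (by linarith [ht.1, le_max_right 1 (T - T₀)])
    exact (hvδ t ht).trans this
  have hcl : closure U ∩ Ioi 0 ⊆ U := by
    rintro s ⟨hs, hs0⟩ t ht
    have hcl' : closure U ⊆ {s | ∀ t ∈ Icc T₀ T₁, v t ≤ y (t + s)} := by
      refine closure_minimal (fun s hs t ht => (hs t ht).le) ?_
      simp only [ofPred_forall]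
      exact isClosed_biInter fun t _ => isClosed_le continuous_const
        (hy.continuous.comp (continuous_const_add t))
    exact hy.lt_of_forall_le hv hF hsp hq hs0 (hall s (le_of_lt hs0) (hcl' hs)) (hlt t ht)
  have := isPreconnected_Ioi.subset_of_closure_inter_subset hUo hne hcl hs
  exact hall s hs.le (fun t ht => (this t ht).le) t

lemma IsProfile.le_of_subset (hy : IsProfile a q sp F D y) (hv : IsProfile a q sp F E v)
    (hDE : D ⊆ E) (hD : IsLowerSet D) (hE : IsLowerSet E) (hF : CondF F sp) (hsp : 0 < sp)
    (hq : 0 < q) (t : ℝ) : v t ≤ y t := by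
  have hlim : Tendsto (fun s => y (t + s)) (𝓝[>] 0) (𝓝 (y (t + 0))) :=
    ((hy.continuous.comp (continuous_const_add t)).tendsto 0).mono_left nhdsWithin_le_nhds
  rw [add_zero] at hlim
  refine ge_of_tendsto hlim ?_
  filter_upwards [self_mem_nhdsWithin] with s hs
    using hy.le_translate hv hDE hD hE hF hsp hq hs t

lemma IsProfile.monotone (hy : IsProfile a q sp F D y) (hD : IsLowerSet D) (hF : CondF F sp)
    (hsp : 0 < sp) (hq : 0 < q) : Monotone y := by
  intro t t' h
  rcases h.eq_or_lt with rfl | h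
  · rfl
  simpa using hy.le_translate hy subset_rfl hD hD hF hsp hq (sub_pos.2 h) t

lemma IsProfile.strictMonoOn (hy : IsProfile a q sp F D y) (hD : IsLowerSet D) (hF : CondF F sp)
    (hsp : 0 < sp) (hq : 0 < q) : StrictMonoOn y D := by
  intro t ht t' _ h
  simpa using hy.lt_of_forall_le hy hF hsp hq (sub_pos.2 h)
    (hy.le_translate hy subset_rfl hD hD hF hsp hq (sub_pos.2 h)) ht

end Profiles

section LinearProblem

lemma exists_linear_dirichlet (a M b : ℝ) (hM : 0 < M) {c d : ℝ} (hcd : c < d) {h : ℝ → ℝ}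
    (hh : Continuous h) : ∃ y : ℝ → ℝ, y c = 0 ∧ y d = b ∧ Differentiable ℝ y ∧
      ∀ t, HasDerivAt (deriv y) (M * y t - a * deriv y t - h t) t := by
  obtain ⟨α, β, hα, hβ, hsum, hprod⟩ :
      ∃ α β : ℝ, 0 < α ∧ 0 < β ∧ α - β = -a ∧ α * β = M := by
    have h0 : 0 ≤ a ^ 2 + 4 * M := by positivity
    have h1 : |a| < √(a ^ 2 + 4 * M) := Real.lt_sqrt_of_sq_lt (by rw [sq_abs]; linarith)
    have h2 := Real.sq_sqrt h0
    refine ⟨(√(a ^ 2 + 4 * M) - a) / 2, (√(a ^ 2 + 4 * M) + a) / 2, ?_, ?_, by ring, ?_⟩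
    · linarith [le_abs_self a]
    · linarith [neg_abs_le a]
    · linarith
  have hexp (k t : ℝ) : HasDerivAt (fun t => Real.exp (k * t)) (Real.exp (k * t) * k) t := by
    simpa using ((hasDerivAt_id t).const_mul k).exp
  have hint {f : ℝ → ℝ} (hf : Continuous f) (t : ℝ) :
      HasDerivAt (fun t => ∫ x in c..t, f x) (f t) t :=
    intervalIntegral.integral_hasDerivAt_right (hf.intervalIntegrable _ _)
      (hf.stronglyMeasurableAtFilter _ _) hf.continuousAt
  -- Solve the two first order factors `(∂ - α) g = -h` and `(∂ + β) z = g` successively.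
  set g : ℝ → ℝ := fun t => Real.exp (α * t) * ∫ x in c..t, -(Real.exp (-α * x) * h x) with hg
  have hg1 (t : ℝ) : HasDerivAt g (α * g t - h t) t := by
    refine ((hexp α t).mul (hint (f := fun x => -(Real.exp (-α * x) * h x))
      (by fun_prop) t)).congr_deriv ?_
    have : Real.exp (α * t) * Real.exp (-α * t) = 1 := by rw [← Real.exp_add]; simp
    simp only [hg]
    linear_combination (-h t) * this
  have hgc : Continuous g := continuous_iff_continuousAt.2 fun t => (hg1 t).continuousAt
  set z : ℝ → ℝ := fun t => Real.exp (-β * t) * ∫ x in c..t, Real.exp (β * x) * g x with hz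
  have hz1 (t : ℝ) : HasDerivAt z (g t - β * z t) t := by
    refine ((hexp (-β) t).mul (hint (f := fun x => Real.exp (β * x) * g x)
      (by fun_prop) t)).congr_deriv ?_
    have : Real.exp (-β * t) * Real.exp (β * t) = 1 := by rw [← Real.exp_add]; simp
    simp only [hz]
    linear_combination (g t) * this
  set A := Real.exp (-α * c) with hA
  set B := Real.exp (β * c) with hB
  set φ : ℝ → ℝ := fun t => A * Real.exp (α * t) - B * Real.exp (-β * t) with hφ
  have hφc : φ c = 0 := by
    simp only [hφ, hA, hB, ← Real.exp_add]
    simp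
  have hφd : 0 < φ d := by
    simp only [hφ, hA, hB, ← Real.exp_add]
    exact sub_pos.2 (Real.exp_lt_exp.2 (by nlinarith))
  set κ := (b - z d) / φ d with hκ
  have hy1 (t : ℝ) : HasDerivAt (fun t => z t + κ * φ t)
      (g t - β * z t + κ * (A * (Real.exp (α * t) * α) - B * (Real.exp (-β * t) * -β))) t :=
    (hz1 t).add ((((hexp α t).const_mul A).sub ((hexp (-β) t).const_mul B)).const_mul κ)
  have hd : deriv (fun t => z t + κ * φ t) = fun t => g t - β * z t
      + κ * (A * (Real.exp (α * t) * α) - B * (Real.exp (-β * t) * -β)) :=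
    funext fun t => (hy1 t).deriv
  refine ⟨fun t => z t + κ * φ t, ?_, ?_, fun t => (hy1 t).differentiableAt, fun t => ?_⟩
  · simp [hφc, hz]
  · simp only [hκ]
    field_simp
    ring
  · rw [hd]
    refine (((hg1 t).sub ((hz1 t).const_mul β)).add
      (((((hexp α t).mul_const α).const_mul A).sub
        (((hexp (-β) t).mul_const (-β)).const_mul B)).const_mul κ)).congr_deriv ?_
    have ha : a = β - α := by linarith
    simp only [hφ]
    rw [ha, ← hprod]
    ring

/-- A bounded pointwise limit of solutions of `yₙ'' + a yₙ' = fₙ` solves the limiting equation. -/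
lemma hasDerivAt_deriv_of_tendsto {a c d B : ℝ} (hcd : c < d) {y f : ℝ → ℝ} {Y G : ℕ → ℝ → ℝ}
    (hY : ∀ n, ∀ t ∈ Icc c d, DifferentiableAt ℝ (Y n) t)
    (hY2 : ∀ n, ∀ t ∈ Icc c d, HasDerivAt (deriv (Y n)) (G n t - a * deriv (Y n) t) t)
    (hG : ∀ n, ContinuousOn (G n) (Icc c d))
    (hYB : ∀ n, ∀ t ∈ Icc c d, |Y n t| ≤ B) (hGB : ∀ n, ∀ t ∈ Icc c d, |G n t| ≤ B)
    (hYlim : ∀ t ∈ Icc c d, Tendsto (fun n => Y n t) atTop (𝓝 (y t)))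
    (hGlim : ∀ t ∈ Icc c d, Tendsto (fun n => G n t) atTop (𝓝 (f t)))
    (hf : ContinuousOn y (Icc c d) → ContinuousOn f (Icc c d)) {t : ℝ} (ht : t ∈ Ioo c d) :
    DifferentiableAt ℝ y t ∧ HasDerivAt (deriv y) (f t - a * deriv y t) t := by
  have hYc (n : ℕ) : ContinuousOn (Y n) (Icc c d) := fun t ht =>
    (hY n t ht).continuousAt.continuousWithinAt
  have hsub {t : ℝ} (ht : t ∈ Icc c d) : uIcc c t ⊆ Icc c d := by
    rw [uIcc_of_le ht.1]
    exact Icc_subset_Icc_right ht.2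
  have hsubo {t : ℝ} (ht : t ∈ Icc c d) : uIoc c t ⊆ Icc c d :=
    uIoc_subset_uIcc.trans (hsub ht)
  -- Bounded pointwise limits of continuous functions: integrability and limits of integrals.
  have hlim {Z : ℕ → ℝ → ℝ} {z : ℝ → ℝ} {C : ℝ} (hZ : ∀ n, ContinuousOn (Z n) (Icc c d))
      (hZB : ∀ n, ∀ t ∈ Icc c d, |Z n t| ≤ C)
      (hZl : ∀ t ∈ Icc c d, Tendsto (fun n => Z n t) atTop (𝓝 (z t))) :
      IntegrableOn z (Icc c d) ∧ ∀ t ∈ Icc c d,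
        Tendsto (fun n => ∫ x in c..t, Z n x) atTop (𝓝 (∫ x in c..t, z x)) := by
    have hae : ∀ᵐ x ∂volume.restrict (Icc c d), Tendsto (fun n => Z n x) atTop (𝓝 (z x)) :=
      (ae_restrict_iff' measurableSet_Icc).2 (Eventually.of_forall hZl)
    have hmeas (n : ℕ) : AEStronglyMeasurable (Z n) (volume.restrict (Icc c d)) :=
      (hZ n).aestronglyMeasurable measurableSet_Icc
    refine ⟨Integrable.of_bound (aestronglyMeasurable_of_tendsto_ae atTop hmeas hae) C
      ((ae_restrict_iff' measurableSet_Icc).2 (Eventually.of_forall fun x hx =>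
        le_of_tendsto (hZl x hx).norm (Eventually.of_forall fun n => hZB n x hx))), ?_⟩
    intro t ht
    refine intervalIntegral.tendsto_integral_filter_of_dominated_convergence (fun _ => C)
      (Eventually.of_forall fun n =>
        (hmeas n).mono_measure (Measure.restrict_mono (hsubo ht) le_rfl))
      (Eventually.of_forall fun n => Eventually.of_forall fun x hx => hZB n x (hsubo ht hx))
      (by simp) (Eventually.of_forall fun x hx => hZl x (hsubo ht hx))
  have hprim {Z : ℝ → ℝ} (hZ : ContinuousOn Z (Icc c d)) {t : ℝ} (ht : t ∈ Ioo c d) :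
      HasDerivAt (fun t => ∫ x in c..t, Z x) (Z t) t :=
    intervalIntegral.integral_hasDerivAt_right
      ((hZ.mono (hsub (Ioo_subset_Icc_self ht))).intervalIntegrable)
      (hZ.mono Ioo_subset_Icc_self |>.stronglyMeasurableAtFilter isOpen_Ioo t ht)
      (hZ.continuousAt (Icc_mem_nhds ht.1 ht.2))
  have hprimc {Z : ℝ → ℝ} (hZ : IntegrableOn Z (Icc c d)) :
      ContinuousOn (fun t => ∫ x in c..t, Z x) (Icc c d) :=
    intervalIntegral.continuousOn_primitive_interval (by rwa [uIcc_of_le hcd.le]) |>.mono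
      (by rw [uIcc_of_le hcd.le])
  obtain ⟨hyi, hyl⟩ := hlim hYc hYB hYlim
  obtain ⟨hfi, hfl⟩ := hlim hG hGB hGlim
  have hGpb (n : ℕ) (t : ℝ) (ht : t ∈ Icc c d) : |∫ x in c..t, G n x| ≤ B * (d - c) := by
    have h1 := intervalIntegral.norm_integral_le_of_norm_le_const (f := G n) (a := c) (b := t)
      (C := B) fun x hx => hGB n x (hsubo ht hx)
    have hB : 0 ≤ B := (abs_nonneg _).trans (hGB n t ht)
    rw [abs_of_nonneg (sub_nonneg.2 ht.1)] at h1
    exact h1.trans (mul_le_mul_of_nonneg_left (by linarith [ht.2]) hB)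
  obtain ⟨-, hffl⟩ := hlim (fun n => hprimc ((hG n).integrableOn_Icc)) hGpb hfl
  have hrep (n : ℕ) {t : ℝ} (ht : t ∈ Icc c d) : Y n t = Y n c - a * (∫ x in c..t, Y n x)
      + (deriv (Y n) c + a * Y n c) * (t - c) + ∫ x in c..t, ∫ s in c..x, G n s := by
    have hfirst {t : ℝ} (ht : t ∈ Icc c d) :
        deriv (Y n) t = -a * Y n t + (deriv (Y n) c + a * Y n c) + ∫ s in c..t, G n s := by
      have := intervalIntegral.integral_eq_sub_of_hasDerivAt (a := c) (b := t)
        (f := fun x => deriv (Y n) x + a * Y n x) (f' := G n)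
        (fun x hx => by
          have := (hY2 n x (hsub ht hx)).add ((hY n x (hsub ht hx)).hasDerivAt.const_mul a)
          exact this.congr_deriv (by ring))
        ((hG n).mono (hsub ht)).intervalIntegrable
      rw [this]
      ring
    have hi1 : IntervalIntegrable (fun x => -a * Y n x) volume c t :=
      (((hYc n).mono (hsub ht)).const_mul (-a)).intervalIntegrable
    have hi2 : IntervalIntegrable (fun x => ∫ s in c..x, G n s) volume c t :=
      ((hprimc ((hG n).integrableOn_Icc)).mono (hsub ht)).intervalIntegrable
    have hi3 : IntervalIntegrable (fun _ : ℝ => deriv (Y n) c + a * Y n c) volume c t :=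
      intervalIntegrable_const
    have h := intervalIntegral.integral_eq_sub_of_hasDerivAt (a := c) (b := t) (f := Y n)
      (f' := fun x => -a * Y n x + (deriv (Y n) c + a * Y n c) + ∫ s in c..x, G n s)
      (fun x hx => by
        rw [← hfirst (hsub ht hx)]
        exact (hY n x (hsub ht hx)).hasDerivAt) ((hi1.add hi3).add hi2)
    rw [intervalIntegral.integral_add (hi1.add hi3) hi2, intervalIntegral.integral_add hi1 hi3,
      intervalIntegral.integral_const_mul, intervalIntegral.integral_const, smul_eq_mul] at h
    linarith
  have hcI : c ∈ Icc c d := ⟨le_rfl, hcd.le⟩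
  have hdI : d ∈ Icc c d := ⟨hcd.le, le_rfl⟩
  have hdc : d - c ≠ 0 := (sub_pos.2 hcd).ne'
  set C := (y d - y c + a * (∫ x in c..d, y x) - ∫ x in c..d, ∫ s in c..x, f s) / (d - c) with hC
  have hClim : Tendsto (fun n => deriv (Y n) c + a * Y n c) atTop (𝓝 C) := by
    have : (fun n => deriv (Y n) c + a * Y n c) = fun n => (Y n d - Y n c
        + a * (∫ x in c..d, Y n x) - ∫ x in c..d, ∫ s in c..x, G n s) / (d - c) := by
      funext n
      have := hrep n hdI
      field_simp
      linarith
    rw [this]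
    exact ((((hYlim d hdI).sub (hYlim c hcI)).add ((hyl d hdI).const_mul a)).sub
      (hffl d hdI)).div_const _
  have hyrep : ∀ t ∈ Icc c d, y t = y c - a * (∫ x in c..t, y x) + C * (t - c)
      + ∫ x in c..t, ∫ s in c..x, f s := by
    intro t ht
    refine tendsto_nhds_unique (hYlim t ht) ?_
    simp_rw [fun n => hrep n ht]
    exact (((hYlim c hcI).sub ((hyl t ht).const_mul a)).add (hClim.mul_const _)).add (hffl t ht)
  have hyc : ContinuousOn y (Icc c d) := by
    refine ContinuousOn.congr ?_ hyrep
    exact ((continuousOn_const.sub ((hprimc hyi).const_mul a)).add (by fun_prop)).add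
      (hprimc (hprimc hfi).integrableOn_Icc)
  have hfc := hf hyc
  have hder {t : ℝ} (ht : t ∈ Ioo c d) :
      HasDerivAt y (-a * y t + C + ∫ s in c..t, f s) t := by
    have h := (((hasDerivAt_const t (y c)).sub ((hprim hyc ht).const_mul a)).add
      (((hasDerivAt_id t).sub_const c).const_mul C)).add (hprim (hprimc hfi) ht)
    refine (h.congr_of_eventuallyEq ?_).congr_deriv (by ring)
    filter_upwards [Ioo_mem_nhds ht.1 ht.2] with x hx using hyrep x (Ioo_subset_Icc_self hx)
  refine ⟨(hder ht).differentiableAt, ?_⟩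
  have h2 := (((hder ht).const_mul (-a)).add_const C).add (hprim hfc ht)
  refine (h2.congr_of_eventuallyEq ?_).congr_deriv (by rw [(hder ht).deriv]; ring)
  filter_upwards [Ioo_mem_nhds ht.1 ht.2] with x hx using (hder hx).deriv

end LinearProblem

section FiniteInterval

/-- `y'' + a y' - M y = -h` on `(c, d)`. -/
def IsLinearSolOn (a M : ℝ) (h : ℝ → ℝ) (c d : ℝ) (y : ℝ → ℝ) : Prop :=
  ∀ t ∈ Ioo c d, (∀ᶠ x in 𝓝 t, DifferentiableAt ℝ y x) ∧
    HasDerivAt (deriv y) (M * y t - a * deriv y t - h t) t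

lemma IsLinearSolOn.le {a M c d : ℝ} {f g u v : ℝ → ℝ} (hM : 0 < M)
    (hu : IsLinearSolOn a M f c d u) (hv : IsLinearSolOn a M g c d v)
    (hcu : ContinuousOn u (Icc c d)) (hcv : ContinuousOn v (Icc c d))
    (hfg : ∀ t ∈ Ioo c d, f t ≤ g t) (hc : u c ≤ v c) (hd : u d ≤ v d) {t : ℝ}
    (ht : t ∈ Icc c d) : u t ≤ v t := by
  by_contra! hlt
  have hct : c < t := lt_of_le_of_ne ht.1 (by rintro rfl; linarith)
  have htd : t < d := lt_of_le_of_ne ht.2 (by rintro rfl; linarith)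
  obtain ⟨x, hx, hxt, hmin⟩ := exists_isLocalMin_of_lt (w := fun x => v x - u x) (hcv.sub hcu)
    hct htd (by linarith) (by linarith)
  obtain ⟨h1, h2⟩ := hu x hx
  obtain ⟨h3, h4⟩ := hv x hx
  obtain ⟨h5, h6⟩ := deriv_eq_and_le_of_isLocalMin_sub h3 h1 h4 h2 hmin
  have := hfg x hx
  rw [h5] at h6
  have := mul_pos hM (show 0 < u x - v x by linarith)
  linarith

lemma IsLinearSolOn.mono {a M c d c' : ℝ} {f u : ℝ → ℝ} (hu : IsLinearSolOn a M f c d u)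
    (hc : c ≤ c') : IsLinearSolOn a M f c' d u :=
  fun t ht => hu t ⟨hc.trans_lt ht.1, ht.2⟩

lemma isLinearSolOn_const (a M c d k : ℝ) :
    IsLinearSolOn a M (fun _ => M * k) c d (fun _ => k) := by
  intro t _
  refine ⟨by simp, ?_⟩
  simpa using hasDerivAt_const t (0 : ℝ)

lemma isLinearSolOn_exp (a M c d D μ : ℝ) :
    IsLinearSolOn a M (fun t => D * Real.exp (μ * t) * (M - μ ^ 2 - a * μ)) c d
      (fun t => D * Real.exp (μ * t)) := by
  have hexp (t : ℝ) :
      HasDerivAt (fun t => D * Real.exp (μ * t)) (D * (Real.exp (μ * t) * μ)) t := by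
    simpa using (((hasDerivAt_id t).const_mul μ).exp).const_mul D
  have hd : (deriv fun t => D * Real.exp (μ * t)) = fun t => (D * Real.exp (μ * t)) * μ :=
    funext fun t => by rw [(hexp t).deriv]; ring
  intro t _
  refine ⟨Eventually.of_forall fun x => (hexp x).differentiableAt, ?_⟩
  rw [hd]
  exact ((hexp t).mul_const μ).congr_deriv (by ring)

lemma exists_isLinearSolOn_extension (a M b : ℝ) (hM : 0 < M) {c d : ℝ} (hcd : c < d)
    {h : ℝ → ℝ} (hh : Continuous h) : ∃ y : C(ℝ, ℝ), (∀ t ≤ c, y t = 0) ∧ (∀ t ≥ d, y t = b) ∧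
      IsLinearSolOn a M h c d y := by
  obtain ⟨y, hyc, hyd, hy1, hy2⟩ := exists_linear_dirichlet a M b hM hcd hh
  refine ⟨⟨fun t => y (max c (min t d)), hy1.continuous.comp (by fun_prop)⟩, fun t ht => ?_,
    fun t ht => ?_, fun t ht => ?_⟩
  · simpa [ht, ht.trans hcd.le] using hyc
  · rw [ge_iff_le] at ht
    simpa [ht, hcd.le] using hyd
  · have hev {x : ℝ} (hx : x ∈ Ioo c d) : (fun t => y (max c (min t d))) =ᶠ[𝓝 x] y := by
      filter_upwards [Ioo_mem_nhds hx.1 hx.2] with z hz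
      rw [min_eq_left hz.2.le, max_eq_right hz.1.le]
    refine ⟨?_, ?_⟩
    · filter_upwards [Ioo_mem_nhds ht.1 ht.2] with z hz
      exact ((hy1 z).congr_of_eventuallyEq (hev hz))
    · have := (hy2 t).congr_of_eventuallyEq (hev ht).deriv
      rw [← (hev ht).deriv.self_of_nhds, ← (hev ht).self_of_nhds] at this
      exact this

lemma exists_exponential_barrier {a q : ℝ} (hq : 0 < q) (T sp m : ℝ) (hsp : 0 ≤ sp) (hm : 0 ≤ m) :
    ∃ D μ : ℝ, 0 < μ ∧ (∀ t ≥ T, sp ≤ D * Real.exp (μ * t)) ∧ 0 ≤ D ∧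
      ∀ t ≤ T, m * Real.exp (2 * t) ≤ D * Real.exp (μ * t) * (q - μ ^ 2 - a * μ) := by
  set μ := min 1 (q / (2 * (1 + |a|))) with hμ
  have hμ0 : 0 < μ := lt_min one_pos (by positivity)
  have hμ1 : μ ≤ 1 := min_le_left _ _
  have hκ : 0 < q - μ ^ 2 - a * μ := by
    have h1 : μ * (2 * (1 + |a|)) ≤ q := (le_div_iff₀ (by positivity)).1 (min_le_right _ _)
    have h2 := mul_le_mul_of_nonneg_right (le_abs_self a) hμ0.le
    nlinarith
  set κ := q - μ ^ 2 - a * μ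
  refine ⟨sp * Real.exp (-(μ * T)) + m * Real.exp ((2 - μ) * T) / κ, μ, hμ0, fun t ht => ?_,
    by positivity, fun t ht => ?_⟩
  · have h1 : Real.exp (μ * T) ≤ Real.exp (μ * t) :=
      Real.exp_le_exp.2 (mul_le_mul_of_nonneg_left ht hμ0.le)
    have h2 : Real.exp (-(μ * T)) * Real.exp (μ * T) = 1 := by rw [← Real.exp_add]; simp
    calc sp = sp * Real.exp (-(μ * T)) * Real.exp (μ * T) := by rw [mul_assoc, h2, mul_one]
      _ ≤ sp * Real.exp (-(μ * T)) * Real.exp (μ * t) := by gcongr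
      _ ≤ _ := mul_le_mul_of_nonneg_right (le_add_of_nonneg_right (by positivity))
        (Real.exp_pos _).le
  · have h1 : Real.exp (2 * t) ≤ Real.exp ((2 - μ) * T) * Real.exp (μ * t) := by
      rw [← Real.exp_add]
      exact Real.exp_le_exp.2 (by nlinarith)
    calc m * Real.exp (2 * t) ≤ m * (Real.exp ((2 - μ) * T) * Real.exp (μ * t)) := by gcongr
      _ = m * Real.exp ((2 - μ) * T) / κ * Real.exp (μ * t) * κ := by field_simp
      _ ≤ _ := by
        gcongr
        exact le_add_of_nonneg_left (by positivity)

variable {a q sp : ℝ} {F : ℝ → ℝ}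

/-- Existence on bounded intervals by monotone iteration, starting from `0`; the `k`-th step solves
a linear Dirichlet problem on `(T - 1 - k, T)`. -/
theorem exists_isProfile_Iio (hF : CondF F sp) (hsp : 0 < sp) (hq : 0 < q) (T : ℝ) :
    ∃ y, IsProfile a q sp F (Iio T) y := by
  obtain ⟨K, hK, hLip⟩ := hF.lipschitz
  have hFc : Continuous F := hF.1.continuous
  set N := K * Real.exp (2 * T) with hN
  have hN0 : 0 < N := by positivity
  set H : ℝ → ℝ → ℝ := fun t x => N * x - Real.exp (2 * t) * F x with hH
  have hexp {t : ℝ} (ht : t ≤ T) : Real.exp (2 * t) ≤ Real.exp (2 * T) :=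
    Real.exp_le_exp.2 (by linarith)
  have hHmono {t x x' : ℝ} (ht : t ≤ T) (hx : 0 ≤ x) (hxx' : x ≤ x') (hx' : x' ≤ sp) :
      H t x ≤ H t x' := by
    have h1 := (le_abs_self _).trans (hLip x' ⟨hx.trans hxx', hx'⟩ x ⟨hx, hxx'.trans hx'⟩)
    rw [abs_of_nonneg (sub_nonneg.2 hxx')] at h1
    have h2 : Real.exp (2 * t) * (F x' - F x) ≤ N * (x' - x) :=
      calc Real.exp (2 * t) * (F x' - F x) ≤ Real.exp (2 * t) * (K * (x' - x)) := by gcongr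
        _ ≤ Real.exp (2 * T) * (K * (x' - x)) :=
          mul_le_mul_of_nonneg_right (hexp ht) (mul_nonneg hK.le (sub_nonneg.2 hxx'))
        _ = N * (x' - x) := by rw [hN]; ring
    simp only [hH]
    linarith
  have hH0 (t : ℝ) : H t 0 = 0 := by simp [hH, hF.2.1]
  have hHsp (t : ℝ) : H t sp = N * sp := by simp [hH, hF.2.2.1]
  have hM : 0 < q + N := by positivity
  have hstep (Z : C(ℝ, ℝ)) (k : ℕ) : ∃ Z' : C(ℝ, ℝ), (∀ t ≤ T - 1 - k, Z' t = 0) ∧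
      (∀ t ≥ T, Z' t = sp) ∧
      IsLinearSolOn a (q + N) (fun t => H t (Z t)) (T - 1 - k) T Z' := by
    refine exists_isLinearSolOn_extension a (q + N) sp hM ?_ (by fun_prop)
    have : (0 : ℝ) ≤ k := k.cast_nonneg
    linarith
  choose step hleft hright hsol using hstep
  obtain ⟨Z, hZ0, hZsucc⟩ : ∃ Z : ℕ → C(ℝ, ℝ), Z 0 = 0 ∧ ∀ k, Z (k + 1) = step (Z k) k :=
    ⟨fun k => Nat.rec 0 (fun k Z => step Z k) k, rfl, fun _ => rfl⟩
  have hZl (k : ℕ) {t : ℝ} (ht : t ≤ T - 1 - k) : Z (k + 1) t = 0 := by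
    rw [hZsucc]
    exact hleft (Z k) k t ht
  have hZr (k : ℕ) {t : ℝ} (ht : T ≤ t) : Z (k + 1) t = sp := by
    rw [hZsucc]
    exact hright (Z k) k t ht
  have hZs (k : ℕ) :
      IsLinearSolOn a (q + N) (fun t => H t (Z k t)) (T - 1 - k) T (Z (k + 1)) := by
    rw [hZsucc]
    exact hsol (Z k) k
  have hZc (k : ℕ) (s : Set ℝ) : ContinuousOn (Z k) s := (Z k).continuous.continuousOn
  -- Membership in `[T - 1 - k, T]` is the only case where there is something to prove.
  have hcases (k : ℕ) (t : ℝ) (P : ℝ → Prop) (h0 : P 0) (h1 : T ≤ t → P sp)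
      (h : t ∈ Icc (T - 1 - k) T → P (Z (k + 1) t)) : P (Z (k + 1) t) := by
    rcases le_total t (T - 1 - k) with ht | ht
    · rwa [hZl k ht]
    rcases le_total T t with ht' | ht'
    · rw [hZr k ht']
      exact h1 ht'
    · exact h ⟨ht, ht'⟩
  have hbd (k : ℕ) (t : ℝ) : 0 ≤ Z k t ∧ Z k t ≤ sp := by
    induction k generalizing t with
    | zero => simpa [hZ0] using hsp.le
    | succ k ih =>
      refine hcases k t (fun x => 0 ≤ x ∧ x ≤ sp) ⟨le_rfl, hsp.le⟩ (fun _ => ⟨hsp.le, le_rfl⟩)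
        fun ht => ⟨?_, ?_⟩
      · refine (isLinearSolOn_const a (q + N) _ T 0).le hM (hZs k) continuousOn_const (hZc _ _)
          (fun x hx => ?_) (hZl k le_rfl).ge (by rw [hZr k le_rfl]; exact hsp.le) ht
        rw [mul_zero, ← hH0 x]
        exact hHmono hx.2.le le_rfl (ih x).1 (ih x).2
      · refine (hZs k).le hM (isLinearSolOn_const a (q + N) _ T sp) (hZc _ _) continuousOn_const
          (fun x hx => ?_) (by rw [hZl k le_rfl]; exact hsp.le) (hZr k le_rfl).le ht
        have h1 := hHmono hx.2.le (ih x).1 (ih x).2 le_rfl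
        rw [hHsp] at h1
        nlinarith
  have hstepmono (k : ℕ) (t : ℝ) : Z k t ≤ Z (k + 1) t := by
    induction k generalizing t with
    | zero => simpa [hZ0] using (hbd 1 t).1
    | succ k ih =>
      refine hcases k t (fun x => x ≤ Z (k + 2) t) (hbd _ t).1 (fun h => (hZr (k + 1) h).ge)
        fun ht => ?_
      refine (hZs k).le hM ((hZs (k + 1)).mono (by push_cast; linarith)) (hZc _ _) (hZc _ _)
        (fun x hx => hHmono hx.2.le (hbd k x).1 (ih x) (hbd _ x).2)
        (by rw [hZl k le_rfl]; exact (hbd _ _).1) (by rw [hZr k le_rfl, hZr _ le_rfl]) ht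
  have hmono (t : ℝ) : Monotone fun k => Z k t := monotone_nat_of_le_succ fun k => hstepmono k t
  have hFbd {x : ℝ} (hx : 0 ≤ x ∧ x ≤ sp) : |F x| ≤ K * sp := by
    have := hLip x hx 0 ⟨le_rfl, hsp.le⟩
    rw [hF.2.1, sub_zero, sub_zero, abs_of_nonneg hx.1] at this
    exact this.trans (mul_le_mul_of_nonneg_left hx.2 hK.le)
  obtain ⟨D, μ, hμ, hDsp, hD0, hDm⟩ := exists_exponential_barrier (a := a) hq T sp (K * sp) hsp.le
    (by positivity)
  have hbar (k : ℕ) (t : ℝ) : Z k t ≤ D * Real.exp (μ * t) := by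
    induction k generalizing t with
    | zero => simpa [hZ0] using mul_nonneg hD0 (Real.exp_pos _).le
    | succ k ih =>
      refine hcases k t (fun x => x ≤ D * Real.exp (μ * t)) (mul_nonneg hD0 (Real.exp_pos _).le)
        (hDsp t) fun ht => ?_
      refine (hZs k).le hM (isLinearSolOn_exp a (q + N) _ T D μ) (hZc _ _) (by fun_prop)
        (fun x hx => ?_) (by rw [hZl k le_rfl]; exact mul_nonneg hD0 (Real.exp_pos _).le)
        (by rw [hZr k le_rfl]; exact hDsp T le_rfl) ht
      have h1 := mul_le_mul_of_nonneg_left ((neg_le_abs _).trans (hFbd (hbd k x)))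
        (Real.exp_pos (2 * x)).le
      have h2 := hDm x hx.2.le
      have h3 := mul_le_mul_of_nonneg_left (ih x) hN0.le
      simp only [hH]
      linarith
  set y : ℝ → ℝ := fun t => ⨆ k, Z k t with hy
  have hlim (t : ℝ) : Tendsto (fun k => Z k t) atTop (𝓝 (y t)) :=
    tendsto_atTop_ciSup (hmono t) ⟨sp, by rintro _ ⟨k, rfl⟩; exact (hbd k t).2⟩
  have hy0 (t : ℝ) : 0 ≤ y t := ge_of_tendsto (hlim t) (Eventually.of_forall fun k => (hbd k t).1)
  have hysp (t : ℝ) : y t ≤ sp :=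
    le_of_tendsto (hlim t) (Eventually.of_forall fun k => (hbd k t).2)
  have hyr {t : ℝ} (ht : T ≤ t) : y t = sp := by
    refine tendsto_nhds_unique (hlim t) (tendsto_const_nhds.congr' ?_)
    filter_upwards [eventually_ge_atTop 1] with k hk
    obtain ⟨k, rfl⟩ := Nat.exists_eq_add_of_le' hk
    exact (hZr k ht).symm
  have hsolve {t : ℝ} (ht : t < T) : IsLogSolAt a q F y t := by
    obtain ⟨n₀, hn₀⟩ := exists_nat_gt (T - t)
    have hmem (n : ℕ) {z : ℝ} (hz : z ∈ Icc (t - 1) ((t + T) / 2)) :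
        z ∈ Ioo (T - 1 - ((n + n₀ : ℕ) : ℝ)) T := by
      have := hz.1
      have := hz.2
      have : (0 : ℝ) ≤ n := n.cast_nonneg
      push_cast
      constructor <;> linarith
    have key : ∀ x ∈ Ioo (t - 1) ((t + T) / 2), DifferentiableAt ℝ y x ∧
        HasDerivAt (deriv y) (((q + N) * y x - H x (y x)) - a * deriv y x) x := by
      intro x hx
      refine hasDerivAt_deriv_of_tendsto (a := a) (c := t - 1) (d := (t + T) / 2)
        (B := sp + ((q + N) * sp + (N * sp + Real.exp (2 * T) * (K * sp))))
        (Y := fun n => Z (n + n₀ + 1))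
        (G := fun n t => (q + N) * Z (n + n₀ + 1) t - H t (Z (n + n₀) t))
        (y := y) (f := fun t => (q + N) * y t - H t (y t)) (by linarith)
        (fun n z hz => (hZs (n + n₀) z (hmem n hz)).1.self_of_nhds)
        (fun n z hz => (hZs (n + n₀) z (hmem n hz)).2.congr_deriv (by ring))
        (fun n => by simp only [hH]; fun_prop) (fun n z _ => ?_) (fun n z hz => ?_)
        (fun z _ => (tendsto_add_atTop_iff_nat (f := fun k => Z k z) (n₀ + 1)).2 (hlim z))
        (fun z _ => ?_) (fun hy => by simp only [hH]; fun_prop) hx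
      · rw [abs_of_nonneg (hbd _ z).1]
        exact (hbd _ z).2.trans (le_add_of_nonneg_right (by positivity))
      · have h1 : |(q + N) * Z (n + n₀ + 1) z| ≤ (q + N) * sp := by
          rw [abs_of_nonneg (mul_nonneg hM.le (hbd _ z).1)]
          exact mul_le_mul_of_nonneg_left (hbd _ z).2 hM.le
        have h2 : |N * Z (n + n₀) z| ≤ N * sp := by
          rw [abs_of_nonneg (mul_nonneg hN0.le (hbd _ z).1)]
          exact mul_le_mul_of_nonneg_left (hbd _ z).2 hN0.le
        have h3 : |Real.exp (2 * z) * F (Z (n + n₀) z)| ≤ Real.exp (2 * T) * (K * sp) := by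
          rw [abs_mul, abs_of_pos (Real.exp_pos _)]
          exact mul_le_mul (hexp (hmem n hz).2.le) (hFbd (hbd _ z)) (abs_nonneg _)
            (Real.exp_pos _).le
        have h4 := abs_sub ((q + N) * Z (n + n₀ + 1) z) (H z (Z (n + n₀) z))
        have h5 := abs_sub (N * Z (n + n₀) z) (Real.exp (2 * z) * F (Z (n + n₀) z))
        simp only [hH] at h4 ⊢
        linarith
      · have h1 := (tendsto_add_atTop_iff_nat (f := fun k => Z k z) (n₀ + 1)).2 (hlim z)
        have h2 := (tendsto_add_atTop_iff_nat (f := fun k => Z k z) n₀).2 (hlim z)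
        exact (h1.const_mul (q + N)).sub ((h2.const_mul N).sub
          (((hFc.tendsto _).comp h2).const_mul (Real.exp (2 * z))))
    have htI : t ∈ Ioo (t - 1) ((t + T) / 2) := ⟨by linarith, by linarith⟩
    refine ⟨?_, ?_⟩
    · filter_upwards [Ioo_mem_nhds htI.1 htI.2] with x hx using (key x hx).1
    · refine (key t htI).2.congr_deriv ?_
      simp only [hH]
      ring
  have hyc : Continuous y := by
    refine continuous_iff_continuousAt.2 fun t => ?_
    rcases lt_or_ge t T with ht | ht
    · exact (hsolve ht).1.self_of_nhds.continuousAt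
    · have h1 : Tendsto (Z 1) (𝓝 t) (𝓝 sp) := by
        rw [← hZr 0 ht]
        exact (Z 1).continuous.tendsto t
      rw [ContinuousAt, hyr ht]
      exact tendsto_of_tendsto_of_tendsto_of_le_of_le h1 tendsto_const_nhds
        (fun x => (hmono x).ge_of_tendsto (hlim x) 1) hysp
  refine ⟨y, hyc, hy0, ?_, ?_, fun t ht => hyr (not_lt.1 ht), fun t ht => hsolve ht⟩
  · have h1 : Tendsto (fun t : ℝ => D * Real.exp (μ * t)) atBot (𝓝 (D * 0)) :=
      (Real.tendsto_exp_atBot.comp (tendsto_id.const_mul_atBot hμ)).const_mul D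
    rw [mul_zero] at h1
    exact tendsto_of_tendsto_of_tendsto_of_le_of_le tendsto_const_nhds h1 hy0
      fun t => le_of_tendsto (hlim t) (Eventually.of_forall fun k => hbar k t)
  · refine tendsto_const_nhds.congr' ?_
    filter_upwards [eventually_ge_atTop T] with t ht using (hyr ht).symm

end FiniteInterval

section UnboundedInterval

lemma CondF.exists_neg_bound {F : ℝ → ℝ} {sp x₀ x₁ : ℝ} (hF : CondF F sp) (h0 : 0 < x₀)
    (h01 : x₀ ≤ x₁) (h1 : x₁ < sp) : ∃ m > 0, ∀ x ∈ Icc x₀ x₁, F x ≤ -m := by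
  obtain ⟨z, hz, hmax⟩ := isCompact_Icc.exists_isMaxOn ⟨x₀, le_rfl, h01⟩
    hF.1.continuous.continuousOn
  have := hF.2.2.2.1 z ⟨h0.trans_le hz.1, hz.2.trans_lt h1⟩
  refine ⟨-F z, by linarith, fun x hx => ?_⟩
  rw [neg_neg]
  exact hmax hx

lemma le_of_hasDerivAt_nonpos {f f' : ℝ → ℝ} {c d : ℝ} (hcd : c ≤ d)
    (hf : ∀ x ∈ Icc c d, HasDerivAt f (f' x) x) (hf' : ∀ x ∈ Icc c d, f' x ≤ 0) : f d ≤ f c :=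
  antitoneOn_of_hasDerivWithinAt_nonpos (convex_Icc c d)
    (fun x hx => (hf x hx).continuousAt.continuousWithinAt)
    (fun x hx => (hf x (interior_subset hx)).hasDerivWithinAt)
    (fun x hx => hf' x (interior_subset hx)) ⟨le_rfl, hcd⟩ ⟨hcd, le_rfl⟩ hcd

variable {a q sp : ℝ} {F y : ℝ → ℝ}

lemma IsLogSolAt.hasDerivAt_comp_log {r : ℝ} (hr : 0 < r) (h : IsLogSolAt a q F y (Real.log r)) :
    (∀ᶠ x in 𝓝 r, HasDerivAt (fun x => y (Real.log x)) (deriv y (Real.log x) / x) x) ∧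
      HasDerivAt (fun x => deriv y (Real.log x) / x)
        (q / r ^ 2 * y (Real.log r) - (a + 1) / r * (deriv y (Real.log r) / r)
          + F (y (Real.log r))) r := by
  have hlog := Real.hasDerivAt_log hr.ne'
  refine ⟨?_, ?_⟩
  · filter_upwards [hlog.continuousAt.eventually h.1, lt_mem_nhds hr] with x hx hx0
    exact hx.hasDerivAt.comp x (Real.hasDerivAt_log hx0.ne')
  · have hexp : Real.exp (2 * Real.log r) = r ^ 2 := by
      rw [two_mul, Real.exp_add, Real.exp_log hr, sq]
    refine ((h.2.comp r hlog).div (hasDerivAt_id r) hr.ne').congr_deriv ?_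
    rw [hexp]
    simp only [Function.comp_apply, id]
    field_simp
    ring

/-- Profiles on `(-∞, T)` do not escape to `+∞` as `T → ∞`. -/
lemma exists_forall_le_of_isProfile_Iio (ha : 0 ≤ a + 1) (hF : CondF F sp) (hsp : 0 < sp)
    (hq : 0 < q) :
    ∃ t₀, ∀ T > t₀, ∀ y, IsProfile a q sp F (Iio T) y → sp / 4 ≤ y t₀ := by
  obtain ⟨m, hm, hFm⟩ := hF.exists_neg_bound (x₀ := sp / 4) (x₁ := sp / 2) (by linarith)
    (by linarith) (by linarith)
  set A := √(m * sp / 4) with hA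
  have hA0 : 0 < A := Real.sqrt_pos.2 (by positivity)
  have hA2 : A ^ 2 = m * sp / 4 := Real.sq_sqrt (by positivity)
  obtain ⟨R₀, ⟨⟨hR0, hR1⟩, hR2⟩, hR3⟩ := ((((eventually_gt_atTop (0 : ℝ)).and
    ((tendsto_pow_atTop two_ne_zero).eventually_ge_atTop (q * sp / (m / 2)))).and
    (eventually_ge_atTop (4 * q * sp / A))).and (eventually_gt_atTop (sp / A))).exists
  rw [div_le_iff₀ (by positivity)] at hR1
  rw [div_le_iff₀ hA0] at hR2
  rw [div_lt_iff₀ hA0] at hR3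
  refine ⟨Real.log R₀, fun T hT y hy => ?_⟩
  by_contra! hlt
  have hmono := hy.monotone (isLowerSet_Iio T) hF hsp hq
  have hTy : y T = sp := hy.eq_off T (by simp)
  obtain ⟨ta, hta, hya⟩ := intermediate_value_Icc hT.le hy.continuous.continuousOn
    (show sp / 4 ∈ Icc _ _ from ⟨hlt.le, by linarith⟩)
  obtain ⟨tb, htb, hyb⟩ := intermediate_value_Icc hta.2 hy.continuous.continuousOn
    (show sp / 2 ∈ Icc _ _ from ⟨by linarith, by linarith⟩)
  have htbT : tb < T := (hy.mem_iff hF hsp hq).2 (by linarith)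
  have hRa : R₀ ≤ Real.exp ta := (Real.log_le_iff_le_exp hR0).1 hta.1
  set ra := Real.exp ta with hra
  set rb := Real.exp tb with hrb
  have hra0 : 0 < ra := Real.exp_pos _
  have hrab : ra ≤ rb := Real.exp_le_exp.2 htb.1
  set u : ℝ → ℝ := fun x => y (Real.log x) with hu
  set w : ℝ → ℝ := fun x => deriv y (Real.log x) / x with hw
  have hua : u ra = sp / 4 := by simp [hu, hra, hya]
  have hub : u rb = sp / 2 := by simp [hu, hrb, hyb]
  have hw0 {x : ℝ} (hx : 0 < x) : 0 ≤ w x := div_nonneg hmono.deriv_nonneg hx.le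
  have hsol (x : ℝ) (hx : 0 < x) (hxb : x ≤ rb) : ∃ w', HasDerivAt u (w x) x ∧
      HasDerivAt w w' x ∧ w' ≤ q * sp / x ^ 2 + F (u x) := by
    have hxT : Real.log x < T := ((Real.log_le_iff_le_exp hx).2 hxb).trans_lt htbT
    obtain ⟨h1, h2⟩ := (hy.isLogSolAt _ hxT).hasDerivAt_comp_log hx
    refine ⟨_, h1.self_of_nhds, h2, ?_⟩
    have h3 : 0 ≤ (a + 1) / x * w x := mul_nonneg (by positivity) (hw0 hx)
    have h4 : q / x ^ 2 * y (Real.log x) ≤ q / x ^ 2 * sp := by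
      gcongr
      exact hy.le hF hsp hq _
    simp only [hw, hu] at h3 ⊢
    rw [mul_div_right_comm]
    linarith
  have humono {x x' : ℝ} (hx : 0 < x) (h : x ≤ x') : u x ≤ u x' :=
    hmono (Real.log_le_log hx h)
  choose! w' hu' hw' hle using hsol
  have hpos {x : ℝ} (hx : ra / 2 ≤ x) : 0 < x := by linarith
  -- The energy `w² / 2 + (m / 2) u` decreases on `[ra, rb]`, which bounds `w ra` below.
  have hwa : A ≤ w ra := by
    have h := le_of_hasDerivAt_nonpos (f := fun x => w x ^ 2 / 2 + m / 2 * u x)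
      (f' := fun x => w x * (w' x + m / 2)) hrab
      (fun x hx => ((((hw' x (hra0.trans_le hx.1) hx.2).pow 2).div_const 2).add
        ((hu' x (hra0.trans_le hx.1) hx.2).const_mul (m / 2))).congr_deriv (by norm_num; ring))
      (fun x hx => by
        have hx0 := hra0.trans_le hx.1
        refine mul_nonpos_of_nonneg_of_nonpos (hw0 hx0) ?_
        have h1 := hFm (u x) ⟨hua ▸ humono hra0 hx.1, hub ▸ humono hx0 hx.2⟩
        have h2 : q * sp / x ^ 2 ≤ m / 2 := by
          rw [div_le_iff₀ (by positivity)]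
          have : R₀ ^ 2 ≤ x ^ 2 := by
            gcongr
            exact hRa.trans hx.1
          nlinarith
        linarith [hle x hx0 hx.2])
    simp only [hua, hub] at h
    refine le_of_sq_le_sq ?_ (hw0 hra0)
    nlinarith [sq_nonneg (w rb)]
  -- Going back from `ra`, `w` stays above `A / 2` on `[ra / 2, ra]`.
  have hwA {x : ℝ} (hx : x ∈ Icc (ra / 2) ra) : A / 2 ≤ w x := by
    have h := le_of_hasDerivAt_nonpos (f := fun x => w x - 4 * q * sp / ra ^ 2 * x)
      (f' := fun x => w' x - 4 * q * sp / ra ^ 2) hx.2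
      (fun z hz => ((hw' z (hpos (hx.1.trans hz.1)) (hz.2.trans hrab)).sub
        ((hasDerivAt_id z).const_mul _)).congr_deriv (by simp))
      (fun z hz => by
        have hz0 := hpos (hx.1.trans hz.1)
        have h1 := hF.nonpos (hy.nonneg (Real.log z)) (hy.le hF hsp hq _)
        have h2 : q * sp / z ^ 2 ≤ 4 * q * sp / ra ^ 2 := by
          rw [div_le_div_iff₀ (by positivity) (by positivity)]
          have : ra ^ 2 ≤ 4 * z ^ 2 := by nlinarith [hx.1, hz.1]
          have := mul_le_mul_of_nonneg_left this (mul_pos hq hsp).le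
          linarith
        have h3 := hle z hz0 (hz.2.trans hrab)
        simp only [hu] at h3
        linarith)
    have h1 : 4 * q * sp / ra ^ 2 * (ra - x) ≤ A / 2 := by
      rw [div_mul_eq_mul_div, div_le_iff₀ (by positivity)]
      have h2 : 4 * q * sp ≤ A * ra := by nlinarith
      have h3 : ra - x ≤ ra / 2 := by linarith [hx.1]
      calc 4 * q * sp * (ra - x) ≤ 4 * q * sp * (ra / 2) := by gcongr
        _ ≤ A * ra * (ra / 2) := by gcongr
        _ = _ := by ring
    linarith
  have h := le_of_hasDerivAt_nonpos (f := fun x => A / 2 * x - u x)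
    (f' := fun x => A / 2 - w x) (show ra / 2 ≤ ra by linarith)
    (fun x hx => (((hasDerivAt_id x).const_mul _).sub
      (hu' x (hpos hx.1) (hx.2.trans hrab))).congr_deriv (by simp))
    (fun x hx => sub_nonpos.2 (hwA hx))
  have h1 : 0 ≤ u (ra / 2) := hy.nonneg _
  simp only [hua] at h
  nlinarith

theorem exists_isProfile_univ (ha : 0 ≤ a + 1) (hF : CondF F sp) (hsp : 0 < sp) (hq : 0 < q) :
    ∃ y, IsProfile a q sp F univ y := by
  obtain ⟨K, hK, hLip⟩ := hF.lipschitz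
  have hFc : Continuous F := hF.1.continuous
  have hFbd {x : ℝ} (h0 : 0 ≤ x) (h1 : x ≤ sp) : |F x| ≤ K * sp := by
    have := hLip x ⟨h0, h1⟩ 0 ⟨le_rfl, hsp.le⟩
    rw [hF.2.1, sub_zero, sub_zero, abs_of_nonneg h0] at this
    exact this.trans (mul_le_mul_of_nonneg_left h1 hK.le)
  choose Y hY using fun n : ℕ => exists_isProfile_Iio (a := a) hF hsp hq (n : ℝ)
  have hanti (t : ℝ) : Antitone fun n => Y n t := fun n k hnk =>
    (hY n).le_of_subset (hY k) (Iio_subset_Iio (by exact_mod_cast hnk)) (isLowerSet_Iio _)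
      (isLowerSet_Iio _) hF hsp hq t
  set y : ℝ → ℝ := fun t => ⨅ n, Y n t with hy
  have hlim (t : ℝ) : Tendsto (fun n => Y n t) atTop (𝓝 (y t)) :=
    tendsto_atTop_ciInf (hanti t) ⟨0, by rintro _ ⟨n, rfl⟩; exact (hY n).nonneg t⟩
  have hy0 (t : ℝ) : 0 ≤ y t := ge_of_tendsto' (hlim t) fun n => (hY n).nonneg t
  have hysp (t : ℝ) : y t ≤ sp := le_of_tendsto' (hlim t) fun n => (hY n).le hF hsp hq t
  have hymono : Monotone y := fun t t' h => le_of_tendsto_of_tendsto' (hlim t) (hlim t') fun n =>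
    (hY n).monotone (isLowerSet_Iio _) hF hsp hq h
  have hsolve (t : ℝ) : IsLogSolAt a q F y t := by
    obtain ⟨n₀, hn₀⟩ := exists_nat_gt (t + 1)
    have key : ∀ x ∈ Ioo (t - 1) (t + 1), DifferentiableAt ℝ y x ∧
        HasDerivAt (deriv y) ((q * y x + Real.exp (2 * x) * F (y x)) - a * deriv y x) x := by
      intro x hx
      have hmem (n : ℕ) {z : ℝ} (hz : z ∈ Icc (t - 1) (t + 1)) : z ∈ Iio ((n + n₀ : ℕ) : ℝ) := by
        have : (0 : ℝ) ≤ n := n.cast_nonneg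
        rw [mem_Iio]
        push_cast
        linarith [hz.2]
      refine hasDerivAt_deriv_of_tendsto (a := a) (c := t - 1) (d := t + 1)
        (B := sp + (q * sp + Real.exp (2 * (t + 1)) * (K * sp))) (Y := fun n => Y (n + n₀))
        (G := fun n z => q * Y (n + n₀) z + Real.exp (2 * z) * F (Y (n + n₀) z))
        (y := y) (f := fun z => q * y z + Real.exp (2 * z) * F (y z)) (by linarith)
        (fun n z hz => ((hY _).isLogSolAt z (hmem n hz)).1.self_of_nhds)
        (fun n z hz => ((hY _).isLogSolAt z (hmem n hz)).2.congr_deriv (by ring))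
        (fun n => ?_) (fun n z _ => ?_) (fun n z hz => ?_)
        (fun z _ => (tendsto_add_atTop_iff_nat (f := fun n => Y n z) n₀).2 (hlim z))
        (fun z _ => ?_) (fun hy => by fun_prop) hx
      · have := (hY (n + n₀)).continuous
        fun_prop
      · rw [abs_of_nonneg ((hY _).nonneg z)]
        exact ((hY _).le hF hsp hq z).trans (le_add_of_nonneg_right (by positivity))
      · have h0 := (hY (n + n₀)).nonneg z
        have h1 := (hY (n + n₀)).le hF hsp hq z
        refine (abs_add_le _ _).trans (le_add_of_nonneg_of_le hsp.le (add_le_add ?_ ?_))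
        · rw [abs_of_nonneg (mul_nonneg hq.le h0)]
          exact mul_le_mul_of_nonneg_left h1 hq.le
        · rw [abs_mul, abs_of_pos (Real.exp_pos _)]
          exact mul_le_mul (Real.exp_le_exp.2 (by linarith [hz.2])) (hFbd h0 h1) (abs_nonneg _)
            (Real.exp_pos _).le
      · have h := (tendsto_add_atTop_iff_nat (f := fun n => Y n z) n₀).2 (hlim z)
        exact (h.const_mul q).add (((hFc.tendsto _).comp h).const_mul _)
    have htI : t ∈ Ioo (t - 1) (t + 1) := ⟨by linarith, by linarith⟩
    refine ⟨?_, (key t htI).2.congr_deriv (by ring)⟩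
    filter_upwards [Ioo_mem_nhds htI.1 htI.2] with x hx using (key x hx).1
  have hdiff (t : ℝ) : DifferentiableAt ℝ y t := (hsolve t).1.self_of_nhds
  obtain ⟨t₀, ht₀⟩ := exists_forall_le_of_isProfile_Iio (a := a) ha hF hsp hq
  have hyt₀ : sp / 4 ≤ y t₀ := by
    refine ge_of_tendsto (hlim t₀) ?_
    filter_upwards [tendsto_natCast_atTop_atTop.eventually_gt_atTop t₀] with n hn
      using ht₀ _ hn _ (hY n)
  set l := ⨆ t, y t
  have hbdd : BddAbove (range y) := ⟨sp, by rintro _ ⟨t, rfl⟩; exact hysp t⟩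
  have hyl (t : ℝ) : y t ≤ l := le_ciSup hbdd t
  have hll : l = sp := by
    refine (ciSup_le hysp).eq_of_not_lt fun hlt => ?_
    obtain ⟨m, hm, hFm⟩ := hF.exists_neg_bound (x₀ := sp / 4) (by linarith)
      (hyt₀.trans (hyl t₀)) hlt
    obtain ⟨t₁, ht₁, hexp⟩ : ∃ t₁ ≥ t₀, q * sp + 1 ≤ Real.exp (2 * t₁) * m :=
      ((eventually_ge_atTop t₀).and (((Real.tendsto_exp_atTop.comp
        (tendsto_id.const_mul_atTop two_pos)).atTop_mul_const hm).eventually_ge_atTop _)).exists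
    have hay (t : ℝ) : |a * y t| ≤ |a| * sp := by
      rw [abs_mul, abs_of_nonneg (hy0 t)]
      gcongr
      exact hysp t
    obtain ⟨t₂, ht₂, hlt₂⟩ : ∃ t₂, t₁ ≤ t₂ ∧ deriv y t₁ + t₁ + 2 * (|a| * sp) + 1 ≤ t₂ :=
      ⟨max t₁ _, le_max_left _ _, le_max_right _ _⟩
    have h := le_of_hasDerivAt_nonpos (f := fun t => deriv y t + a * y t + t)
      (f' := fun t => q * y t + Real.exp (2 * t) * F (y t) + 1) ht₂
      (fun t _ => (((hsolve t).2.add ((hdiff t).hasDerivAt.const_mul a)).add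
        (hasDerivAt_id t)).congr_deriv (by ring))
      (fun t ht => by
        have h1 := hFm (y t) ⟨hyt₀.trans (hymono (ht₁.trans ht.1)), hyl t⟩
        have h2 : Real.exp (2 * t₁) ≤ Real.exp (2 * t) := Real.exp_le_exp.2 (by linarith [ht.1])
        have h3 := mul_le_mul_of_nonneg_left h1 (Real.exp_pos (2 * t)).le
        have h4 := mul_le_mul_of_nonneg_right h2 hm.le
        have h5 := mul_le_mul_of_nonneg_left (hysp t) hq.le
        linarith)
    have h1 : 0 ≤ deriv y t₂ := hymono.deriv_nonneg
    have h3 := abs_le.1 (hay t₁)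
    have h4 := abs_le.1 (hay t₂)
    linarith
  refine ⟨y, continuous_iff_continuousAt.2 fun t => (hdiff t).continuousAt, hy0, ?_, ?_,
    fun t ht => (ht (mem_univ t)).elim, fun t _ => hsolve t⟩
  · exact tendsto_of_tendsto_of_tendsto_of_le_of_le tendsto_const_nhds (hY 0).tendsto_atBot hy0
      fun t => (hanti t).le_of_tendsto (hlim t) 0
  · rw [← hll]
    exact tendsto_atTop_ciSup hymono hbdd

end UnboundedInterval

section BoundaryValueProblem

lemma contDiffAt_two_of_hasDerivAt {f f' f'' : ℝ → ℝ} {U : Set ℝ} (hU : IsOpen U)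
    (hf : ∀ x ∈ U, HasDerivAt f (f' x) x) (hf' : ∀ x ∈ U, HasDerivAt f' (f'' x) x)
    (hf'' : ContinuousOn f'' U) {x : ℝ} (hx : x ∈ U) :
    ContDiffAt ℝ 2 f x ∧ deriv f x = f' x ∧ deriv (deriv f) x = f'' x := by
  have h1 : ContDiffOn ℝ 1 f' U := by
    rw [show (1 : WithTop ℕ∞) = 0 + 1 from rfl, contDiffOn_succ_iff_deriv_of_isOpen hU]
    exact ⟨fun z hz => (hf' z hz).differentiableAt.differentiableWithinAt, by simp,
      contDiffOn_zero.2 (hf''.congr fun z hz => (hf' z hz).deriv)⟩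
  have h2 : ContDiffOn ℝ 2 f U := by
    rw [show (2 : WithTop ℕ∞) = 1 + 1 from rfl, contDiffOn_succ_iff_deriv_of_isOpen hU]
    exact ⟨fun z hz => (hf z hz).differentiableAt.differentiableWithinAt, by simp,
      h1.congr fun z hz => (hf z hz).deriv⟩
  have hev : deriv f =ᶠ[𝓝 x] f' := by
    filter_upwards [hU.mem_nhds hx] with z hz using (hf z hz).deriv
  exact ⟨h2.contDiffAt (hU.mem_nhds hx), hev.self_of_nhds, by rw [hev.deriv_eq, (hf' x hx).deriv]⟩

lemma ODEAt.isLogSolAt_comp_exp {p q : ℝ} {F v : ℝ → ℝ} {t : ℝ}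
    (h : ODEAt p q F v (Real.exp t)) (hv : ContDiffAt ℝ 2 v (Real.exp t)) :
    IsLogSolAt (p - 1) q F (fun t => v (Real.exp t)) t := by
  have hdiff : ∀ᶠ x in 𝓝 t, DifferentiableAt ℝ v (Real.exp x) :=
    Real.continuous_exp.continuousAt.eventually
      ((hv.eventually (by simp)).mono fun x hx => hx.differentiableAt two_ne_zero)
  have hder {x : ℝ} (hx : DifferentiableAt ℝ v (Real.exp x)) :
      HasDerivAt (fun t => v (Real.exp t)) (deriv v (Real.exp x) * Real.exp x) x :=
    hx.hasDerivAt.comp x (Real.hasDerivAt_exp x)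
  have hev : deriv (fun t => v (Real.exp t)) =ᶠ[𝓝 t] fun x => deriv v (Real.exp x) * Real.exp x :=
    hdiff.mono fun x hx => (hder hx).deriv
  have hv2 : HasDerivAt (deriv v) (deriv (deriv v) (Real.exp t)) (Real.exp t) :=
    ((hv.derivWithin (m := 1) (by norm_num)).differentiableAt one_ne_zero).hasDerivAt
  refine ⟨hdiff.mono fun x hx => (hder hx).differentiableAt, ?_⟩
  refine HasDerivAt.congr_of_eventuallyEq (((hv2.comp t (Real.hasDerivAt_exp t)).mul
    (Real.hasDerivAt_exp t)).congr_deriv ?_) hev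
  have hr := (Real.exp_pos t).ne'
  have hode : deriv (deriv v) (Real.exp t) = F (v (Real.exp t)) -
      p / Real.exp t * deriv v (Real.exp t) + q / Real.exp t ^ 2 * v (Real.exp t) := by
    rw [← h]
    ring
  rw [hev.self_of_nhds, two_mul, Real.exp_add, Function.comp_apply, hode]
  field_simp
  ring

/-- The interval `(0, R)` in the logarithmic variable. -/
def logDomain (R : ℝ≥0∞) : Set ℝ := {t | ENNReal.ofReal (Real.exp t) < R}

lemma logDomain_top : logDomain ⊤ = univ := by
  simp [logDomain]

lemma logDomain_ofReal {R' : ℝ} (hR' : 0 < R') :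
    logDomain (ENNReal.ofReal R') = Iio (Real.log R') := by
  ext t
  rw [logDomain, mem_ofPred_eq, ENNReal.ofReal_lt_ofReal_iff hR', mem_Iio,
    Real.lt_log_iff_exp_lt hR']

lemma isLowerSet_logDomain (R : ℝ≥0∞) : IsLowerSet (logDomain R) := fun _ _ h ht =>
  (ENNReal.ofReal_le_ofReal (Real.exp_le_exp.2 h)).trans_lt ht

lemma isOpen_logDomain (R : ℝ≥0∞) : IsOpen (logDomain R) :=
  isOpen_lt (ENNReal.continuous_ofReal.comp Real.continuous_exp) continuous_const

lemma log_mem_logDomain {R : ℝ≥0∞} {r : ℝ} (hr : 0 < r) :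
    Real.log r ∈ logDomain R ↔ ENNReal.ofReal r < R := by
  rw [logDomain, mem_ofPred_eq, Real.exp_log hr]

lemma eq_top_or_exists_ofReal {R : ℝ≥0∞} (hR : 0 < R) :
    R = ⊤ ∨ ∃ R' : ℝ, 0 < R' ∧ R = ENNReal.ofReal R' := by
  by_cases h : R = ⊤
  · exact Or.inl h
  · exact Or.inr ⟨R.toReal, ENNReal.toReal_pos hR.ne' h, (ENNReal.ofReal_toReal h).symm⟩

variable {p q sp : ℝ} {F y v : ℝ → ℝ} {R : ℝ≥0∞}

theorem exists_isProfile_logDomain (hp : 0 ≤ p) (hq : 0 < q) (hsp : 0 < sp) (hF : CondF F sp)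
    (hR : 0 < R) : ∃ y, IsProfile (p - 1) q sp F (logDomain R) y := by
  obtain rfl | ⟨R', hR', rfl⟩ := eq_top_or_exists_ofReal hR
  · rw [logDomain_top]
    exact exists_isProfile_univ (by linarith) hF hsp hq
  · rw [logDomain_ofReal hR']
    exact exists_isProfile_Iio hF hsp hq _

theorem IsProfile.isBVPSolution (hy : IsProfile (p - 1) q sp F (logDomain R) y)
    (hF : CondF F sp) :
    IsBVPSolution p q F sp R fun r => if r ≤ 0 then 0 else y (Real.log r) := by
  set u : ℝ → ℝ := fun r => if r ≤ 0 then 0 else y (Real.log r) with hu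
  have hupos {r : ℝ} (hr : 0 < r) : u r = y (Real.log r) := if_neg hr.not_ge
  have hev {r : ℝ} (hr : 0 < r) : u =ᶠ[𝓝 r] fun x => y (Real.log x) := by
    filter_upwards [lt_mem_nhds hr] with x hx using hupos hx
  have hcont {r : ℝ} (hr : 0 < r) : ContinuousAt u r :=
    (hy.continuous.continuousAt.comp (Real.continuousAt_log hr.ne')).congr_of_eventuallyEq (hev hr)
  have hode (r : ℝ) (hr : 0 < r) (hrR : ENNReal.ofReal r < R) :
      ContDiffAt ℝ 2 u r ∧ ODEAt p q F u r := by
    have hopen : IsOpen {r : ℝ | 0 < r ∧ ENNReal.ofReal r < R} :=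
      (isOpen_lt continuous_const continuous_id).inter
        (isOpen_lt ENNReal.continuous_ofReal continuous_const)
    have hsol (x : ℝ) (hx : x ∈ {r : ℝ | 0 < r ∧ ENNReal.ofReal r < R}) :=
      (hy.isLogSolAt _ ((log_mem_logDomain hx.1).2 hx.2)).hasDerivAt_comp_log hx.1
    have hFc : Continuous F := hF.1.continuous
    have hyc := hy.continuous
    obtain ⟨h1, h2, h3⟩ := contDiffAt_two_of_hasDerivAt hopen
      (fun x hx => (hsol x hx).1.self_of_nhds.congr_of_eventuallyEq (hev hx.1))
      (fun x hx => (hsol x hx).2)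
      (fun x hx => by
        have hw := (hsol x hx).2.continuousAt
        have hx0 := hx.1.ne'
        refine ContinuousAt.continuousWithinAt ?_
        fun_prop (disch := positivity)) ⟨hr, hrR⟩
    refine ⟨h1, ?_⟩
    rw [ODEAt, h2, h3, hupos hr]
    ring
  refine ⟨fun r hr => ?_, fun r hr hrR => (hode r hr hrR).1, fun r hr hrR => (hode r hr hrR).2,
    if_pos le_rfl, fun R' hR' hRR' => ?_, ?_⟩
  · rcases hr.1.eq_or_lt with rfl | hr0
    · refine ContinuousWithinAt.mono (t := Ici 0) (continuousWithinAt_Ioi_iff_Ici.1 ?_)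
        fun x hx => hx.1
      have h0 : u 0 = 0 := if_pos le_rfl
      rw [ContinuousWithinAt, h0]
      refine (hy.tendsto_atBot.comp Real.tendsto_log_nhdsGT_zero).congr' ?_
      filter_upwards [self_mem_nhdsWithin] with x hx using (hupos hx).symm
    · exact (hcont hr0).continuousWithinAt
  · have h : u R' = sp := by
      rw [hupos hR', hy.eq_off]
      rw [log_mem_logDomain hR', ← hRR']
      exact lt_irrefl _
    have := (hcont hR').tendsto
    rw [h] at this
    exact this.mono_left nhdsWithin_le_nhds
  · rintro rfl
    refine (hy.tendsto_atTop.comp Real.tendsto_log_atTop).congr' ?_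
    filter_upwards [eventually_gt_atTop 0] with x hx using (hupos hx).symm

theorem IsBVPSolution.isProfile (hv : IsBVPSolution p q F sp R v)
    (hv0 : ∀ r : ℝ, 0 < r → ENNReal.ofReal r < R → 0 ≤ v r) (hsp : 0 < sp) (hR : 0 < R) :
    IsProfile (p - 1) q sp F (logDomain R)
      fun t => if ENNReal.ofReal (Real.exp t) < R then v (Real.exp t) else sp := by
  obtain ⟨hvc, hv2, hvode, hvz, hvR, hvtop⟩ := hv
  set V : ℝ → ℝ := fun t => if ENNReal.ofReal (Real.exp t) < R then v (Real.exp t) else sp with hV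
  have hVin {t : ℝ} (ht : t ∈ logDomain R) : V t = v (Real.exp t) := if_pos ht
  have hVout {t : ℝ} (ht : t ∉ logDomain R) : V t = sp := if_neg ht
  have hev {t : ℝ} (ht : t ∈ logDomain R) : V =ᶠ[𝓝 t] fun t => v (Real.exp t) := by
    filter_upwards [(isOpen_logDomain R).mem_nhds ht] with x hx using hVin hx
  have hsol (t : ℝ) (ht : t ∈ logDomain R) : IsLogSolAt (p - 1) q F V t := by
    obtain ⟨h1, h2⟩ := (hvode _ (Real.exp_pos t) ht).isLogSolAt_comp_exp (hv2 _ (Real.exp_pos t) ht)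
    refine ⟨?_, ?_⟩
    · filter_upwards [h1, (isOpen_logDomain R).mem_nhds ht] with x hx hxR
        using hx.congr_of_eventuallyEq (hev hxR)
    · rw [hVin ht, (hev ht).deriv_eq]
      exact h2.congr_of_eventuallyEq (hev ht).deriv
  refine ⟨continuous_iff_continuousAt.2 fun t => ?_, fun t => ?_, ?_, ?_, fun t => hVout, hsol⟩
  · by_cases ht : t ∈ logDomain R
    · exact (hsol t ht).1.self_of_nhds.continuousAt
    obtain rfl | ⟨R', hR', rfl⟩ := eq_top_or_exists_ofReal hR
    · rw [logDomain_top] at ht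
      exact (ht (mem_univ t)).elim
    rw [ContinuousAt, hVout ht]
    rw [logDomain_ofReal hR', mem_Iio, not_lt] at ht
    have hge {x : ℝ} (hx : Real.log R' ≤ x) : V x = sp :=
      hVout (by rw [logDomain_ofReal hR', mem_Iio, not_lt]; exact hx)
    rcases ht.eq_or_lt with rfl | ht
    · rw [← nhdsLT_sup_nhdsGE, tendsto_sup]
      refine ⟨?_, tendsto_const_nhds.congr' ?_⟩
      · have hexp : Tendsto Real.exp (𝓝[<] Real.log R') (𝓝[<] R') := by
          refine tendsto_nhdsWithin_iff.2 ⟨?_, ?_⟩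
          · have := Real.continuous_exp.tendsto (Real.log R')
            rw [Real.exp_log hR'] at this
            exact this.mono_left nhdsWithin_le_nhds
          · filter_upwards [self_mem_nhdsWithin] with x hx
            exact (Real.lt_log_iff_exp_lt hR').1 hx
        refine ((hvR R' hR' rfl).comp hexp).congr' ?_
        filter_upwards [self_mem_nhdsWithin] with x hx
        exact (hVin (by rw [logDomain_ofReal hR']; exact hx)).symm
      · filter_upwards [self_mem_nhdsWithin] with x hx using (hge hx).symm
    · refine tendsto_const_nhds.congr' ?_
      filter_upwards [lt_mem_nhds ht] with x hx using (hge hx.le).symm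
  · by_cases ht : t ∈ logDomain R
    · rw [hVin ht]
      exact hv0 _ (Real.exp_pos t) ht
    · rw [hVout ht]
      exact hsp.le
  · have hR0 : ∀ᶠ r : ℝ in 𝓝[>] 0, 0 ≤ r ∧ ENNReal.ofReal r < R := by
      have h : ∀ᶠ r : ℝ in 𝓝 0, ENNReal.ofReal r < R :=
        ENNReal.continuous_ofReal.continuousAt.eventually (gt_mem_nhds (by simpa using hR))
      filter_upwards [self_mem_nhdsWithin, nhdsWithin_le_nhds h] with r h1 h2
        using ⟨le_of_lt h1, h2⟩
    have h0 : Tendsto v (𝓝[>] 0) (𝓝 0) := by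
      have h := hvc 0 ⟨le_rfl, by simpa using hR⟩
      rw [ContinuousWithinAt, hvz] at h
      exact h.mono_left (nhdsWithin_le_iff.2 hR0)
    refine (h0.comp Real.tendsto_exp_atBot_nhdsGT).congr' ?_
    filter_upwards [Real.tendsto_exp_atBot_nhdsGT.eventually hR0] with t ht using (hVin ht.2).symm
  · obtain rfl | ⟨R', hR', rfl⟩ := eq_top_or_exists_ofReal hR
    · refine ((hvtop rfl).comp Real.tendsto_exp_atTop).congr fun t => (hVin ?_).symm
      rw [logDomain_top]
      trivial
    · refine tendsto_const_nhds.congr' ?_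
      filter_upwards [eventually_ge_atTop (Real.log R')] with t ht
      exact (hVout (by rw [logDomain_ofReal hR', mem_Iio, not_lt]; exact ht)).symm

end BoundaryValueProblem

/-- main theorem — existence and uniqueness of a non-negative solution of
(⋆)&(BC) on `(0,R)` for every `R ∈ (0,∞]`; the solution satisfies `0 < u < s₊` and is
strictly increasing on `(0,R)`. -/
theorem stmt12 (p q sp : ℝ) (hp : 0 ≤ p) (hq : 0 < q) (hsp : 0 < sp)
    (F : ℝ → ℝ) (hF : CondF F sp)
    (R : ℝ≥0∞) (hR : 0 < R) :
    ∃ u : ℝ → ℝ, IsBVPSolution p q F sp R u ∧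
      (∀ r : ℝ, 0 < r → ENNReal.ofReal r < R → 0 ≤ u r) ∧
      (∀ r : ℝ, 0 < r → ENNReal.ofReal r < R → 0 < u r ∧ u r < sp) ∧
      StrictMonoOn u {r : ℝ | 0 < r ∧ ENNReal.ofReal r < R} ∧
      ∀ v : ℝ → ℝ, IsBVPSolution p q F sp R v →
        (∀ r : ℝ, 0 < r → ENNReal.ofReal r < R → 0 ≤ v r) →
        ∀ r : ℝ, 0 ≤ r → ENNReal.ofReal r < R → v r = u r := by
  obtain ⟨y, hy⟩ := exists_isProfile_logDomain hp hq hsp hF hR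
  have hD := isLowerSet_logDomain R
  have hu {r : ℝ} (hr : 0 < r) : (if r ≤ 0 then 0 else y (Real.log r)) = y (Real.log r) :=
    if_neg hr.not_ge
  refine ⟨_, hy.isBVPSolution hF, fun r hr _ => ?_, fun r hr hrR => ?_, ?_, ?_⟩
  · simpa only [hu hr] using hy.nonneg _
  · simp only [hu hr]
    exact ⟨hy.pos hF hsp hq _, hy.lt_of_mem hF hsp hq ((log_mem_logDomain hr).2 hrR)⟩
  · intro r hr r' hr' h
    simp only [hu hr.1, hu hr'.1]
    exact hy.strictMonoOn hD hF hsp hq ((log_mem_logDomain hr.1).2 hr.2)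
      ((log_mem_logDomain hr'.1).2 hr'.2) (Real.log_lt_log hr.1 h)
  · intro v hv hv0 r hr hrR
    rcases hr.eq_or_lt with rfl | hr
    · simpa using hv.2.2.2.1
    have hV := hv.isProfile hv0 hsp hR
    have h := le_antisymm (hy.le_of_subset hV subset_rfl hD hD hF hsp hq (Real.log r))
      (hV.le_of_subset hy subset_rfl hD hD hF hsp hq (Real.log r))
    simpa only [hu hr, Real.exp_log hr, if_pos hrR] using h
end

section
/- Asymptotics of non-negative solutions: Let u be a solution of the boundary-value problem (⋆)&(BC) on (0,∞) with u ≥ 0 on (0,∞). Then there exist constants α > 0 and β > 0 such that u(r) = α·r^{γ_+} + o(r^{γ_+}) as r → 0 and u(r) = s_+ − β·r^{−2} + o(r^{−2}) as r → ∞. -/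
open Set Filter Topology MeasureTheory
open scoped ENNReal NNReal

theorem monotoneOn_Ioo_of_hasDerivAt_nonneg {f f' : ℝ → ℝ} {a b : ℝ}
    (hf : ∀ r ∈ Ioo a b, HasDerivAt f (f' r) r) (hf' : ∀ r ∈ Ioo a b, 0 ≤ f' r) :
    MonotoneOn f (Ioo a b) := by
  refine monotoneOn_of_deriv_nonneg (convex_Ioo a b)
    (fun r hr => (hf r hr).continuousAt.continuousWithinAt)
    (fun r hr => (hf r (interior_subset hr)).differentiableAt.differentiableWithinAt)
    fun r hr => ?_
  rw [(hf r (interior_subset hr)).deriv]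
  exact hf' r (interior_subset hr)

theorem gammaPlus_pos {p q : ℝ} (hq : 0 < q) : 0 < gammaPlus p q := by
  have : p - 1 < Real.sqrt ((p - 1) ^ 2 + 4 * q) := Real.lt_sqrt_of_sq_lt (by linarith)
  unfold gammaPlus
  linarith

theorem add_gammaPlus_sub_one_pos {p q : ℝ} (hq : 0 < q) : 0 < p + gammaPlus p q - 1 := by
  have : 1 - p < Real.sqrt ((p - 1) ^ 2 + 4 * q) := Real.lt_sqrt_of_sq_lt (by linarith)
  unfold gammaPlus
  linarith

theorem gammaPlus_mul_add_sub_one {p q : ℝ} (hq : 0 < q) :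
    gammaPlus p q * (p + gammaPlus p q - 1) = q := by
  have := Real.sq_sqrt (show 0 ≤ (p - 1) ^ 2 + 4 * q by positivity)
  unfold gammaPlus
  linarith

/-- A function with nonnegative derivative on `(0, ε)` stays above its limit at `0`. -/
theorem le_of_tendsto_zero_of_hasDerivAt_nonneg {f f' : ℝ → ℝ} {ε L : ℝ}
    (hf : ∀ r ∈ Ioo 0 ε, HasDerivAt f (f' r) r) (hf' : ∀ r ∈ Ioo 0 ε, 0 ≤ f' r)
    (hL : Tendsto f (𝓝[>] 0) (𝓝 L)) : ∀ r ∈ Ioo 0 ε, L ≤ f r := by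
  have hm := monotoneOn_Ioo_of_hasDerivAt_nonneg hf hf'
  intro r hr
  refine le_of_tendsto hL ?_
  filter_upwards [Ioo_mem_nhdsGT hr.1] with s hs
  exact hm ⟨hs.1, hs.2.trans hr.2⟩ hr hs.2.le

/-- Weak maximum principle on a half-line for functions vanishing at infinity. -/
theorem nonpos_of_deriv_deriv_pos_of_tendsto_zero {f f' f'' : ℝ → ℝ} {R : ℝ}
    (h1 : ∀ r ∈ Ici R, HasDerivAt f (f' r) r) (h2 : ∀ r ∈ Ici R, HasDerivAt f' (f'' r) r)
    (hR : f R ≤ 0) (hlim : Tendsto f atTop (𝓝 0))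
    (hpos : ∀ r, R < r → 0 < f r → f' r = 0 → 0 < f'' r) : ∀ r ∈ Ici R, f r ≤ 0 := by
  intro r0 hr0
  by_contra! h0
  obtain ⟨R2, hR2, hlt⟩ : ∃ R2, r0 < R2 ∧ f R2 < f r0 :=
    ((eventually_gt_atTop r0).and (hlim.eventually_lt_const h0)).exists
  have hr0' : R ≤ r0 := hr0
  obtain ⟨x, hx, hmax⟩ := isCompact_Icc.exists_isMaxOn (s := Icc R R2)
    ⟨r0, hr0', hR2.le⟩ (fun y hy => (h1 y hy.1).continuousAt.continuousWithinAt)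
  have hx0 : f r0 ≤ f x := hmax ⟨hr0', hR2.le⟩
  have hxR : R < x := lt_of_le_of_ne hx.1 (by rintro rfl; linarith)
  have hxR2 : x < R2 := lt_of_le_of_ne hx.2 (by rintro rfl; linarith)
  have hloc : IsLocalMax f x := hmax.isLocalMax (Icc_mem_nhds hxR hxR2)
  have hd0 : f' x = 0 := hloc.hasDerivAt_eq_zero (h1 x hx.1)
  have hdd := hpos x hxR (by linarith) hd0
  have hev : deriv f =ᶠ[𝓝 x] f' := by
    filter_upwards [Ioi_mem_nhds hxR] with y hy using (h1 y (Ioi_subset_Ici_self hy)).deriv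
  have hdd2 : deriv (deriv f) x = f'' x := by
    rw [hev.deriv_eq, (h2 x hx.1).deriv]
  have hmin : IsLocalMin f x := isLocalMin_of_deriv_deriv_pos (by rwa [hdd2])
    (by rw [(h1 x hx.1).deriv, hd0]) (h1 x hx.1).continuousAt
  have hconst : f =ᶠ[𝓝 x] fun _ => f x := by
    filter_upwards [hloc, hmin] with y hy hy' using le_antisymm hy hy'
  have h3 : deriv f =ᶠ[𝓝 x] fun _ => 0 := by
    simpa using hconst.deriv
  rw [← hdd2, h3.deriv_eq] at hdd
  simp at hdd

/-- If `W'' + (p/r) W' = g/r² + d W` with `W → 0`, `g → g₀` and `d → k > 0` at infinity, then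
`limsup r² W ≤ -g₀/k`. -/
theorem eventually_mul_sq_lt_of_ode {W W' g d : ℝ → ℝ} {p k g₀ b : ℝ} (hk : 0 < k)
    (h1 : ∀ r, 0 < r → HasDerivAt W (W' r) r)
    (h2 : ∀ r, 0 < r → HasDerivAt W' (g r / r ^ 2 + d r * W r - p / r * W' r) r)
    (hW : Tendsto W atTop (𝓝 0)) (hg : Tendsto g atTop (𝓝 g₀)) (hd : Tendsto d atTop (𝓝 k))
    (hb : -g₀ / k < b) : ∀ᶠ r in atTop, W r * r ^ 2 < b := by
  obtain ⟨b', hb1, hb2⟩ := exists_between hb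
  have hb1' : 0 < g₀ + k * b' := by
    rw [div_lt_iff₀ hk] at hb1; linarith
  have hinv : ∀ n : ℕ, n ≠ 0 → Tendsto (fun r : ℝ => (r ^ n)⁻¹) atTop (𝓝 0) := fun n hn =>
    (tendsto_pow_atTop hn).inv_tendsto_atTop
  have e1 : ∀ᶠ r in atTop, 0 < g r + d r * b' - b' * (2 * (3 - p)) * (r ^ 2)⁻¹ := by
    have := (hg.add (hd.mul_const b')).sub ((hinv 2 two_ne_zero).const_mul (b' * (2 * (3 - p))))
    exact this.eventually_const_lt (by simpa using hb1')
  have e2 : ∀ᶠ r in atTop, 0 < d r - 3 * (4 - p) * (r ^ 2)⁻¹ := by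
    have := hd.sub ((hinv 2 two_ne_zero).const_mul (3 * (4 - p)))
    exact this.eventually_const_lt (by simpa using hk)
  have e3 : ∀ᶠ r in atTop, 0 < d r := hd.eventually_const_lt hk
  obtain ⟨R, hR⟩ := eventually_atTop.1 (e1.and (e2.and (e3.and (eventually_gt_atTop 0))))
  have hR0 : 0 < R := (hR R le_rfl).2.2.2
  obtain ⟨A, hA0, hA⟩ : ∃ A : ℝ, 0 ≤ A ∧ (W R - b' / R ^ 2) * R ^ 3 ≤ A :=
    ⟨max 0 ((W R - b' / R ^ 2) * R ^ 3), le_max_left _ _, le_max_right _ _⟩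
  have key : ∀ r ∈ Ici R, W r - b' * (r ^ 2)⁻¹ - A * (r ^ 3)⁻¹ ≤ 0 := by
    refine nonpos_of_deriv_deriv_pos_of_tendsto_zero
      (f' := fun r => W' r + 2 * b' * (r ^ 3)⁻¹ + 3 * A * (r ^ 4)⁻¹)
      (f'' := fun r => (g r / r ^ 2 + d r * W r - p / r * W' r) - 6 * b' * (r ^ 4)⁻¹
        - 12 * A * (r ^ 5)⁻¹) ?_ ?_ ?_ ?_ ?_
    · intro r hr
      have hr0 : r ≠ 0 := (hR r hr).2.2.2.ne'
      have := ((h1 r (hR r hr).2.2.2).sub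
        (((hasDerivAt_pow 2 r).inv (by positivity)).const_mul b')).sub
        (((hasDerivAt_pow 3 r).inv (by positivity)).const_mul A)
      refine this.congr_deriv ?_
      field_simp
      push_cast
      ring
    · intro r hr
      have hr0 : r ≠ 0 := (hR r hr).2.2.2.ne'
      have := ((h2 r (hR r hr).2.2.2).add
        (((hasDerivAt_pow 3 r).inv (by positivity)).const_mul (2 * b'))).add
        (((hasDerivAt_pow 4 r).inv (by positivity)).const_mul (3 * A))
      refine this.congr_deriv ?_
      field_simp
      push_cast
      ring
    · have h3 : (0:ℝ) < R ^ 3 := by positivity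
      have h4 : W R - b' / R ^ 2 ≤ A / R ^ 3 := (le_div_iff₀ h3).2 hA
      rw [div_eq_mul_inv] at h4
      rw [div_eq_mul_inv] at h4
      linarith
    · simpa using (hW.sub ((hinv 2 two_ne_zero).const_mul b')).sub
        ((hinv 3 three_ne_zero).const_mul A)
    · intro r hr hf hf'
      obtain ⟨q1, q2, q3, q4⟩ := hR r hr.le
      have hW' : W' r = - (2 * b' * (r ^ 3)⁻¹) - 3 * A * (r ^ 4)⁻¹ := by linarith
      have hm : d r * (b' * (r ^ 2)⁻¹ + A * (r ^ 3)⁻¹) < d r * W r :=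
        mul_lt_mul_of_pos_left (by linarith) q3
      have t1 : 0 < (r ^ 2)⁻¹ * (g r + d r * b' - b' * (2 * (3 - p)) * (r ^ 2)⁻¹) := by positivity
      have t2 : 0 ≤ A * (r ^ 3)⁻¹ * (d r - 3 * (4 - p) * (r ^ 2)⁻¹) := by positivity
      have t3 : g r / r ^ 2 + d r * (b' * (r ^ 2)⁻¹ + A * (r ^ 3)⁻¹) - p / r * W' r
          - 6 * b' * (r ^ 4)⁻¹ - 12 * A * (r ^ 5)⁻¹
          = (r ^ 2)⁻¹ * (g r + d r * b' - b' * (2 * (3 - p)) * (r ^ 2)⁻¹)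
            + A * (r ^ 3)⁻¹ * (d r - 3 * (4 - p) * (r ^ 2)⁻¹) := by
        rw [hW']
        field_simp
        ring
      linarith
  have e4 : ∀ᶠ r : ℝ in atTop, A * (r ^ 1)⁻¹ < b - b' :=
    ((hinv 1 one_ne_zero).const_mul A).eventually_lt_const (by simpa using hb2)
  filter_upwards [e4, eventually_ge_atTop R] with r hr hrR
  have hr0 : 0 < r := hR0.trans_le hrR
  have h5 : W r ≤ b' * (r ^ 2)⁻¹ + A * (r ^ 3)⁻¹ := by linarith [key r hrR]
  calc W r * r ^ 2 ≤ (b' * (r ^ 2)⁻¹ + A * (r ^ 3)⁻¹) * r ^ 2 := by gcongr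
    _ = b' + A * (r ^ 1)⁻¹ := by field_simp
    _ < b := by linarith

/-- A nonnegative solution that does not vanish identically near infinity has no zeros. -/
theorem pos_of_nonneg_of_linear_ode {u u' c : ℝ → ℝ} {p q l : ℝ} (hp : 0 ≤ p) (hl : l ≠ 0)
    (h1 : ∀ r, 0 < r → HasDerivAt u (u' r) r)
    (h2 : ∀ r, 0 < r → HasDerivAt u' (c r * u r + q / r ^ 2 * u r - p / r * u' r) r)
    (hc : ContinuousOn c (Ioi 0)) (hlim : Tendsto u atTop (𝓝 l))
    (hnn : ∀ r, 0 < r → 0 ≤ u r) : ∀ r, 0 < r → 0 < u r := by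
  intro r0 hr0
  refine lt_of_le_of_ne (hnn r0 hr0) fun h0 => ?_
  have hloc : IsLocalMin u r0 := by
    filter_upwards [Ioi_mem_nhds hr0] with y hy
    rw [← h0]
    exact hnn y hy
  have hd0 : u' r0 = 0 := hloc.hasDerivAt_eq_zero (h1 r0 hr0)
  have hz : ∀ R, r0 ≤ R → u R = 0 := by
    intro R hR
    have hpos : ∀ r ∈ Icc r0 R, 0 < r := fun r hr => hr0.trans_le hr.1
    have hcont : ContinuousOn (fun r => c r + q / r ^ 2 + 1) (Icc r0 R) := by
      refine ((hc.mono fun r hr => hpos r hr).add ?_).add continuousOn_const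
      exact continuousOn_const.div (by fun_prop) fun r hr => by have := hpos r hr; positivity
    obtain ⟨M, hM⟩ := isCompact_Icc.exists_bound_of_continuousOn hcont
    have hanti : AntitoneOn (fun r => (u r ^ 2 + u' r ^ 2) * Real.exp (-(M * r))) (Icc r0 R) := by
      have hder : ∀ r ∈ Icc r0 R,
          HasDerivAt (fun r => (u r ^ 2 + u' r ^ 2) * Real.exp (-(M * r)))
          ((2 * (c r + q / r ^ 2 + 1) * (u r * u' r) - 2 * (p / r) * u' r ^ 2
            - M * (u r ^ 2 + u' r ^ 2)) * Real.exp (-(M * r))) r := by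
        intro r hr
        have hr := hpos r hr
        have := (((h1 r hr).pow 2).add ((h2 r hr).pow 2)).mul
          (((hasDerivAt_id r).const_mul M).neg.exp)
        refine this.congr_deriv ?_
        simp
        ring
      refine antitoneOn_of_deriv_nonpos (convex_Icc _ _)
        (fun r hr => (hder r hr).continuousAt.continuousWithinAt)
        (fun r hr => (hder r (interior_subset hr)).differentiableAt.differentiableWithinAt)
        fun r hr => ?_
      have hr := interior_subset hr
      rw [(hder r hr).deriv]
      refine mul_nonpos_of_nonpos_of_nonneg ?_ (Real.exp_pos _).le
      have hb : |c r + q / r ^ 2 + 1| ≤ M := hM r hr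
      have hpr : 0 ≤ 2 * (p / r) * u' r ^ 2 := by
        have := hpos r hr
        positivity
      have hab : 2 * |u r * u' r| ≤ u r ^ 2 + u' r ^ 2 := by
        rw [abs_mul]
        nlinarith [sq_nonneg (|u r| - |u' r|), sq_abs (u r), sq_abs (u' r)]
      have hM0 : 0 ≤ M := (abs_nonneg _).trans hb
      have : 2 * (c r + q / r ^ 2 + 1) * (u r * u' r) ≤ M * (u r ^ 2 + u' r ^ 2) :=
        calc 2 * (c r + q / r ^ 2 + 1) * (u r * u' r)
            = (c r + q / r ^ 2 + 1) * (2 * (u r * u' r)) := by ring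
          _ ≤ |(c r + q / r ^ 2 + 1) * (2 * (u r * u' r))| := le_abs_self _
          _ = |c r + q / r ^ 2 + 1| * (2 * |u r * u' r|) := by
              rw [abs_mul, abs_mul 2, abs_two]
          _ ≤ M * (u r ^ 2 + u' r ^ 2) := by gcongr
      linarith
    have hE := hanti ⟨le_rfl, hR⟩ ⟨hR, le_rfl⟩ hR
    simp only [← h0, hd0] at hE
    have hexp := Real.exp_pos (-(M * R))
    have : u R ^ 2 + u' R ^ 2 ≤ 0 := by
      by_contra! h
      have := mul_pos h hexp
      norm_num at hE
      linarith
    nlinarith [sq_nonneg (u R), sq_nonneg (u' R)]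
  have : Tendsto u atTop (𝓝 0) := tendsto_const_nhds.congr' (by
    filter_upwards [eventually_ge_atTop r0] with r hr using (hz r hr).symm)
  exact hl (tendsto_nhds_unique hlim this)

theorem hasDerivAt_rpow_mul {f f' : ℝ → ℝ} {a r : ℝ} (hr : 0 < r) (hf : HasDerivAt f (f' r) r) :
    HasDerivAt (fun s => s ^ a * f s) (r ^ a * (f' r + a / r * f r)) r := by
  refine ((Real.hasDerivAt_rpow_const (p := a) (Or.inl hr.ne')).mul hf).congr_deriv ?_
  rw [Real.rpow_sub_one hr.ne']
  ring

theorem tendsto_rpow_nhdsGT_zero {a : ℝ} (ha : 0 < a) :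
    Tendsto (fun r : ℝ => r ^ a) (𝓝[>] 0) (𝓝 0) := by
  have := (Real.continuousAt_rpow_const 0 a (Or.inr ha.le)).tendsto
  rw [Real.zero_rpow ha.ne'] at this
  exact this.mono_left nhdsWithin_le_nhds

/-- Positive solutions of `u'' + (p/r) u' - (q/r²) u = c u` with `c` bounded and nonpositive that
vanish at `0` are nondecreasing near `0`. -/
theorem deriv_nonneg_of_linear_ode_near_zero {u u' c : ℝ → ℝ} {p q C ε : ℝ}
    (h1 : ∀ r ∈ Ioo 0 ε, HasDerivAt u (u' r) r)
    (h2 : ∀ r ∈ Ioo 0 ε, HasDerivAt u' (c r * u r + q / r ^ 2 * u r - p / r * u' r) r)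
    (hpos : ∀ r ∈ Ioo 0 ε, 0 < u r) (hlim : Tendsto u (𝓝[>] 0) (𝓝 0))
    (hC : ∀ r ∈ Ioo 0 ε, -C ≤ c r) (hC0 : 0 ≤ C) (hε : C * ε ^ 2 ≤ q) :
    MonotoneOn (fun r => r ^ p * u' r) (Ioo 0 ε) ∧ ∀ r ∈ Ioo 0 ε, 0 ≤ u' r := by
  have hder : ∀ r ∈ Ioo 0 ε, HasDerivAt (fun r => r ^ p * u' r)
      (r ^ p * ((c r + q / r ^ 2) * u r)) r := fun r hr =>
    (hasDerivAt_rpow_mul hr.1 (f' := fun r => c r * u r + q / r ^ 2 * u r - p / r * u' r)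
      (h2 r hr)).congr_deriv (by ring)
  have hmono : MonotoneOn (fun r => r ^ p * u' r) (Ioo 0 ε) := by
    refine monotoneOn_Ioo_of_hasDerivAt_nonneg hder fun r hr => ?_
    have hr0 : 0 < r := hr.1
    have hq : C ≤ q / r ^ 2 := by
      rw [le_div_iff₀ (by positivity)]
      have : C * r ^ 2 ≤ C * ε ^ 2 := by
        have := hr.2.le
        gcongr
      linarith
    have := hpos r hr
    have : 0 ≤ c r + q / r ^ 2 := by linarith [hC r hr]
    positivity
  refine ⟨hmono, fun r0 hr0 => ?_⟩
  by_contra! hneg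
  have hsub : ∀ r ∈ Ioo 0 r0, r ∈ Ioo 0 ε := fun r hr => ⟨hr.1, hr.2.trans hr0.2⟩
  have hle : ∀ r ∈ Ioo 0 r0, -0 ≤ -u r := by
    refine le_of_tendsto_zero_of_hasDerivAt_nonneg (f' := fun r => -u' r)
      (fun r hr => (h1 r (hsub r hr)).neg) (fun r hr => ?_) hlim.neg
    have h3 : r ^ p * u' r ≤ r0 ^ p * u' r0 := hmono (hsub r hr) hr0 hr.2.le
    have h4 : r0 ^ p * u' r0 < 0 := mul_neg_of_pos_of_neg (Real.rpow_pos_of_pos hr0.1 p) hneg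
    have h5 : 0 < r ^ p := Real.rpow_pos_of_pos hr.1 p
    by_contra! h6
    have := mul_pos h5 (show 0 < u' r by linarith)
    linarith
  have hm : r0 / 2 ∈ Ioo 0 r0 := ⟨half_pos hr0.1, half_lt_self hr0.1⟩
  linarith [hle _ hm, hpos _ (hsub _ hm)]

/-- Positive solutions of `u'' + (p/r) u' - (q/r²) u = c u` with `c` bounded and nonpositive that
vanish at `0` behave like a positive multiple of `r ^ γ`, where `γ² + (p-1)γ = q`. -/
theorem exists_tendsto_rpow_neg_mul_of_linear_ode {u u' c : ℝ → ℝ} {p q γ C ε : ℝ}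
    (hγ : 0 < γ) (hγp : 0 < p + γ - 1) (hγq : γ * (p + γ - 1) = q) (hε0 : 0 < ε)
    (h1 : ∀ r ∈ Ioo 0 ε, HasDerivAt u (u' r) r)
    (h2 : ∀ r ∈ Ioo 0 ε, HasDerivAt u' (c r * u r + q / r ^ 2 * u r - p / r * u' r) r)
    (hpos : ∀ r ∈ Ioo 0 ε, 0 < u r) (hlim : Tendsto u (𝓝[>] 0) (𝓝 0))
    (hC : ∀ r ∈ Ioo 0 ε, -C ≤ c r) (hc : ∀ r ∈ Ioo 0 ε, c r ≤ 0) (hC0 : 0 ≤ C)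
    (hε : C * ε ^ 2 ≤ q) :
    ∃ α > 0, Tendsto (fun r => r ^ (-γ) * u r) (𝓝[>] 0) (𝓝 α) := by
  obtain ⟨hmono, hu'⟩ := deriv_nonneg_of_linear_ode_near_zero h1 h2 hpos hlim hC hC0 hε
  have hmid : ε / 2 ∈ Ioo 0 ε := ⟨half_pos hε0, half_lt_self hε0⟩
  set G : ℝ → ℝ := fun r => r ^ (p + γ) * u' r - γ * (r ^ (p + γ - 1) * u r) with hG
  have hGlim : Tendsto G (𝓝[>] 0) (𝓝 0) := by
    have t1 : Tendsto (fun r => r ^ (p + γ) * u' r) (𝓝[>] 0) (𝓝 0) := by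
      have hb : Tendsto (fun r : ℝ => r ^ γ * ((ε / 2) ^ p * u' (ε / 2))) (𝓝[>] 0) (𝓝 0) := by
        simpa using (tendsto_rpow_nhdsGT_zero hγ).mul_const ((ε / 2) ^ p * u' (ε / 2))
      refine squeeze_zero' ?_ ?_ hb
      · filter_upwards [Ioo_mem_nhdsGT hε0] with r hr
        exact mul_nonneg (Real.rpow_nonneg hr.1.le _) (hu' r hr)
      · filter_upwards [Ioo_mem_nhdsGT hmid.1] with r hr
        have h3 : r ^ p * u' r ≤ (ε / 2) ^ p * u' (ε / 2) :=
          hmono ⟨hr.1, hr.2.trans hmid.2⟩ hmid hr.2.le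
        rw [add_comm p γ, Real.rpow_add hr.1, mul_assoc]
        exact mul_le_mul_of_nonneg_left h3 (Real.rpow_nonneg hr.1.le _)
    simpa using t1.sub (((tendsto_rpow_nhdsGT_zero hγp).mul hlim).const_mul γ)
  have hGder : ∀ r ∈ Ioo 0 ε, HasDerivAt G (r ^ (p + γ) * (c r * u r)) r := by
    intro r hr
    have hr0 : r ≠ 0 := hr.1.ne'
    have := (hasDerivAt_rpow_mul hr.1 (a := p + γ)
      (f' := fun r => c r * u r + q / r ^ 2 * u r - p / r * u' r) (h2 r hr)).sub
      ((hasDerivAt_rpow_mul hr.1 (a := p + γ - 1) (h1 r hr)).const_mul γ)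
    refine this.congr_deriv ?_
    rw [Real.rpow_sub_one hr0, ← hγq]
    field_simp
    ring
  have hGle : ∀ r ∈ Ioo 0 ε, G r ≤ 0 := by
    have : ∀ r ∈ Ioo 0 ε, -0 ≤ -G r := by
      refine le_of_tendsto_zero_of_hasDerivAt_nonneg (fun r hr => (hGder r hr).neg)
        (fun r hr => ?_) hGlim.neg
      have := mul_nonneg (Real.rpow_nonneg hr.1.le (p + γ))
        (mul_nonneg (neg_nonneg.2 (hc r hr)) (hpos r hr).le)
      linarith
    intro r hr
    linarith [this r hr]
  have hs : 0 < p + γ + 1 := by linarith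
  set K := C / (p + γ + 1) with hK
  have hK0 : 0 ≤ K := by positivity
  have hKC : K * (p + γ + 1) = C := by rw [hK]; field_simp
  have hGge : ∀ r ∈ Ioo 0 ε, 0 ≤ G r + K * (r ^ (p + γ + 1) * u r) := by
    refine le_of_tendsto_zero_of_hasDerivAt_nonneg (fun r hr => (hGder r hr).add
      ((hasDerivAt_rpow_mul hr.1 (a := p + γ + 1) (h1 r hr)).const_mul K)) (fun r hr => ?_) ?_
    · have hr0 : 0 < r := hr.1
      rw [Real.rpow_add_one hr0.ne']
      have e : r ^ (p + γ) * (c r * u r) + K * (r ^ (p + γ) * r * (u' r + (p + γ + 1) / r * u r))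
          = r ^ (p + γ) * ((c r + K * (p + γ + 1)) * u r + K * r * u' r) := by
        field_simp
        ring
      rw [e, hKC]
      have := hpos r hr
      have := hu' r hr
      have : 0 ≤ c r + C := by linarith [hC r hr]
      positivity
    · simpa using hGlim.add (((tendsto_rpow_nhdsGT_zero hs).mul hlim).const_mul K)
  have hwder : ∀ r ∈ Ioo 0 ε, HasDerivAt (fun r => r ^ (-γ) * u r)
      (r ^ (-γ) * (u' r + -γ / r * u r)) r := fun r hr => hasDerivAt_rpow_mul hr.1 (h1 r hr)
  have hGeq : ∀ r ∈ Ioo 0 ε, G r = r ^ (p + γ) * (u' r + -γ / r * u r) := by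
    intro r hr
    have hr0 := hr.1.ne'
    simp only [hG]
    rw [Real.rpow_sub_one hr0]
    field_simp
    ring
  have hanti : MonotoneOn (fun r => -(r ^ (-γ) * u r)) (Ioo 0 ε) := by
    refine monotoneOn_Ioo_of_hasDerivAt_nonneg (fun r hr => (hwder r hr).neg) fun r hr => ?_
    have h3 := hGle r hr
    rw [hGeq r hr] at h3
    have h4 := nonpos_of_mul_nonpos_right h3 (Real.rpow_pos_of_pos hr.1 _)
    have := mul_nonneg (Real.rpow_nonneg hr.1.le (-γ)) (neg_nonneg.2 h4)
    linarith
  have hexp : MonotoneOn (fun r => r ^ (-γ) * u r * Real.exp (K * r ^ 2 / 2)) (Ioo 0 ε) := by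
    refine monotoneOn_Ioo_of_hasDerivAt_nonneg (fun r hr => (hwder r hr).mul
      (((hasDerivAt_pow 2 r).const_mul K).div_const 2).exp) fun r hr => ?_
    have h3 := hGge r hr
    rw [hGeq r hr, Real.rpow_add_one hr.1.ne'] at h3
    have h4 : 0 ≤ r ^ (p + γ) * (u' r + -γ / r * u r + K * r * u r) := by linarith
    have h5 := nonneg_of_mul_nonneg_right h4 (Real.rpow_pos_of_pos hr.1 _)
    have := mul_nonneg (mul_nonneg (Real.rpow_nonneg hr.1.le (-γ))
      (Real.exp_pos (K * r ^ 2 / 2)).le) h5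
    refine this.trans_eq ?_
    push_cast
    ring
  have hbdd : BddBelow ((fun r => -(r ^ (-γ) * u r)) '' Ioo 0 ε) := by
    refine ⟨-((ε / 2) ^ (-γ) * u (ε / 2) * Real.exp (K * (ε / 2) ^ 2 / 2)), ?_⟩
    rintro _ ⟨r, hr, rfl⟩
    have hwpos : ∀ s ∈ Ioo 0 ε, 0 < s ^ (-γ) * u s := fun s hs =>
      mul_pos (Real.rpow_pos_of_pos hs.1 _) (hpos s hs)
    have hone : ∀ s : ℝ, 1 ≤ Real.exp (K * s ^ 2 / 2) := fun s =>
      Real.one_le_exp (by positivity)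
    simp only [neg_le_neg_iff]
    rcases le_total r (ε / 2) with h | h
    · exact (le_mul_of_one_le_right (hwpos r hr).le (hone r)).trans (hexp hr hmid h)
    · exact (neg_le_neg_iff.1 (hanti hmid hr h)).trans
        (le_mul_of_one_le_right (hwpos _ hmid).le (hone _))
  have hT := (hanti.tendsto_nhdsWithin_Ioo_right (nonempty_Ioo.2 hε0) hbdd).neg
  simp only [neg_neg] at hT
  refine ⟨_, ?_, hT⟩
  refine (mul_pos (Real.rpow_pos_of_pos hmid.1 (-γ)) (hpos _ hmid)).trans_le (ge_of_tendsto hT ?_)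
  filter_upwards [Ioo_mem_nhdsGT hmid.1] with r hr
  exact neg_le_neg_iff.1 (hanti ⟨hr.1, hr.2.trans hmid.2⟩ hmid hr.2.le)

/-- asymptotics of a non-negative solution of (⋆)&(BC) on `(0,∞)`. -/
theorem stmt13 (p q sp : ℝ) (hp : 0 ≤ p) (hq : 0 < q) (hsp : 0 < sp)
    (F : ℝ → ℝ) (hF : CondF F sp)
    (u : ℝ → ℝ) (hu : IsBVPSolution p q F sp ⊤ u)
    (hnn : ∀ r : ℝ, 0 < r → 0 ≤ u r) :
    ∃ α > (0:ℝ), ∃ β > (0:ℝ),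
      AsympZero u α (gammaPlus p q) ∧ AsympInfty u sp β := by
  obtain ⟨hucont, hu2, hode, hu0, -, hinf⟩ := hu
  obtain ⟨hFc, hF0, hFs, hFneg, -, hk⟩ := hF
  replace hinf := hinf rfl
  have hFd : ∀ x, DifferentiableAt ℝ F x := hFc.differentiable one_ne_zero
  have h1 : ∀ r, 0 < r → HasDerivAt u (deriv u r) r := fun r hr =>
    ((hu2 r hr ENNReal.ofReal_lt_top).differentiableAt two_ne_zero).hasDerivAt
  have h2 : ∀ r, 0 < r → HasDerivAt (deriv u)
      (F (u r) + q / r ^ 2 * u r - p / r * deriv u r) r := by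
    intro r hr
    have hd : ContDiffAt ℝ 1 (deriv u) r :=
      (hu2 r hr ENNReal.ofReal_lt_top).derivWithin (by norm_num)
    refine (hd.differentiableAt one_ne_zero).hasDerivAt.congr_deriv ?_
    have := hode r hr ENNReal.ofReal_lt_top
    unfold ODEAt at this
    linarith
  have hFdslope : ∀ a x, F a = 0 → F x = dslope F a x * (x - a) := by
    intro a x ha
    have := sub_smul_dslope F a x
    rw [ha, sub_zero, smul_eq_mul] at this
    linarith
  have hds : ∀ a, Continuous (dslope F a) := fun a => by
    rw [← continuousOn_univ, continuousOn_dslope univ_mem]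
    exact ⟨hFc.continuous.continuousOn, hFd a⟩
  have hpos : ∀ r, 0 < r → 0 < u r := by
    refine pos_of_nonneg_of_linear_ode (c := fun r => dslope F 0 (u r)) (q := q) hp hsp.ne' h1
      (fun r hr => (h2 r hr).congr_deriv ?_) ?_ hinf hnn
    · rw [hFdslope 0 (u r) hF0]
      ring
    · exact (hds 0).comp_continuousOn fun r hr => (h1 r hr).continuousAt.continuousWithinAt
  have hzero : Tendsto u (𝓝[>] 0) (𝓝 0) := by
    have := (hucont 0 ⟨le_rfl, by simp⟩).tendsto
    rw [hu0] at this
    exact this.mono_left (nhdsWithin_mono 0 fun r hr =>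
      ⟨le_of_lt hr, ENNReal.ofReal_lt_top⟩)
  obtain ⟨α, hα, hαlim⟩ : ∃ α > 0,
      Tendsto (fun r => r ^ (-gammaPlus p q) * u r) (𝓝[>] 0) (𝓝 α) := by
    set C := |deriv F 0| + 1 with hCdef
    have hC0 : 0 < C := by positivity
    have ev1 : ∀ᶠ r in 𝓝[>] (0:ℝ), -C < dslope F 0 (u r) := by
      have h3 : Tendsto (fun r => dslope F 0 (u r)) (𝓝[>] 0) (𝓝 (dslope F 0 0)) :=
        ((hds 0).tendsto 0).comp hzero
      refine h3.eventually_const_lt ?_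
      rw [dslope_same]
      linarith [neg_abs_le (deriv F 0)]
    have ev2 : ∀ᶠ r in 𝓝[>] (0:ℝ), u r < sp := hzero.eventually_lt_const hsp
    have ev3 : ∀ᶠ r in 𝓝[>] (0:ℝ), C * r ^ 2 < q := by
      have h3 : Tendsto (fun r : ℝ => C * r ^ 2) (𝓝 0) (𝓝 (C * 0 ^ 2)) :=
        Continuous.tendsto (by fun_prop) 0
      exact (h3.mono_left nhdsWithin_le_nhds).eventually_lt_const (by simpa using hq)
    obtain ⟨δ, hδ, hδ'⟩ := mem_nhdsGT_iff_exists_Ioo_subset.1 (ev1.and (ev2.and ev3))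
    have hδ0 : 0 < δ := hδ
    have hsub : ∀ r ∈ Ioo 0 (δ / 2), r ∈ Ioo 0 δ := fun r hr => ⟨hr.1, by linarith [hr.2]⟩
    refine exists_tendsto_rpow_neg_mul_of_linear_ode (c := fun r => dslope F 0 (u r))
      (C := C) (ε := δ / 2) (gammaPlus_pos hq) (add_gammaPlus_sub_one_pos hq)
      (gammaPlus_mul_add_sub_one hq) (half_pos hδ0) (fun r hr => h1 r hr.1)
      (fun r hr => (h2 r hr.1).congr_deriv ?_) (fun r hr => hpos r hr.1) hzero
      (fun r hr => (hδ' (hsub r hr)).1.le) (fun r hr => ?_) hC0.le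
      (hδ' (show δ / 2 ∈ Ioo 0 δ from ⟨half_pos hδ0, half_lt_self hδ0⟩)).2.2.le
    · rw [hFdslope 0 (u r) hF0]
      ring
    · have h3 := hFneg (u r) ⟨hpos r hr.1, (hδ' (hsub r hr)).2.1⟩
      rw [hFdslope 0 (u r) hF0, sub_zero] at h3
      exact (neg_of_mul_neg_left h3 (hpos r hr.1).le).le
  have hd : Tendsto (fun r => dslope F sp (u r)) atTop (𝓝 (deriv F sp)) := by
    rw [← dslope_same F sp]
    exact ((hds sp).tendsto sp).comp hinf
  have hup : ∀ b, -(q * sp / deriv F sp) < b → ∀ᶠ r in atTop, (u r - sp) * r ^ 2 < b := by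
    intro b hb
    refine eventually_mul_sq_lt_of_ode (p := p) (g := fun r => q * u r) hk
      (fun r hr => (h1 r hr).sub_const sp) (fun r hr => (h2 r hr).congr_deriv ?_) ?_
      (hinf.const_mul q) hd ?_
    · rw [hFdslope sp (u r) hFs]
      ring
    · simpa using hinf.sub_const sp
    · rwa [neg_div]
  have hlow : ∀ b, q * sp / deriv F sp < b → ∀ᶠ r in atTop, (-(u r - sp)) * r ^ 2 < b := by
    intro b hb
    refine eventually_mul_sq_lt_of_ode (p := p) (g := fun r => -(q * u r)) hk
      (fun r hr => ((h1 r hr).sub_const sp).neg) (fun r hr => (h2 r hr).neg.congr_deriv ?_) ?_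
      (hinf.const_mul q).neg hd ?_
    · rw [hFdslope sp (u r) hFs]
      ring
    · simpa using (hinf.sub_const sp).neg
    · rwa [neg_neg]
  refine ⟨α, hα, q * sp / deriv F sp, by positivity, ?_, ?_⟩
  · have h3 := hαlim.sub_const α
    rw [sub_self] at h3
    refine h3.congr' ?_
    filter_upwards [self_mem_nhdsWithin] with r hr
    have := (Real.rpow_pos_of_pos hr (gammaPlus p q)).ne'
    rw [Real.rpow_neg (le_of_lt hr)]
    field_simp
  · unfold AsympInfty
    have h3 : Tendsto (fun r => (u r - sp) * r ^ 2) atTop (𝓝 (-(q * sp / deriv F sp))) := by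
      refine tendsto_order.2 ⟨fun b hb => ?_, hup⟩
      filter_upwards [hlow (-b) (by linarith)] with r hr
      linarith
    have h4 := h3.add_const (q * sp / deriv F sp)
    rw [neg_add_cancel] at h4
    refine h4.congr' ?_
    filter_upwards [eventually_gt_atTop 0] with r hr
    field_simp
    ring
end
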